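/- Let u be the solution of the interior problem with parameters d > 0 and boundary value c > 0 (so u > 0 on Ω∖{0}). Assume that ∫_{∂Ω} (|Du|³ / u^{2(n−1)/(n−2)}) dσ = limsup_{t→+∞} ∫_{{u=t}} (|Du|³ / u^{2(n−1)/(n−2)}) dσ and that ∫_{∂Ω} |Du|² [ H/(n−1) − |Du|/((n−2)u) ] dσ ≥ 0. Then at every point of Ω∖{0} the Hessian identity u · D²u = (n/(n−2)) Du ⊗ Du − (|Du|²/(n−2)) · Id holds; equivalently, the Hessian of f = log u with respect to the conformal metric g = u^{2/(n−2)}·(Euclidean metric) vanishes identically on Ω∖{0}. -/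

import Mathlib

open MeasureTheory Metric Set Filter
open scoped Topology ENNReal NNReal InnerProductSpace

noncomputable section

/-- Hessian of `u` at `x`, evaluated on the pair of vectors `(v, w)`. -/
def hess2 {n : ℕ} (u : EuclideanSpace ℝ (Fin n) → ℝ) (x v w : EuclideanSpace ℝ (Fin n)) : ℝ :=
  iteratedFDeriv ℝ 2 u x ![v, w]

/-- Laplacian of `u` at `x`. -/
def lap {n : ℕ} (u : EuclideanSpace ℝ (Fin n) → ℝ) (x : EuclideanSpace ℝ (Fin n)) : ℝ :=
  ∑ i : Fin n, hess2 u x (EuclideanSpace.single i 1) (EuclideanSpace.single i 1)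

/-- Mean curvature at `x` of the level set of `u` through `x`, with respect to the unit
normal `ν = -Du/|Du|`:  `H = D²u(ν,ν)/|Du|` (valid for harmonic `u`). -/
def meanH {n : ℕ} (u : EuclideanSpace ℝ (Fin n) → ℝ) (x : EuclideanSpace ℝ (Fin n)) : ℝ :=
  hess2 u x (gradient u x) (gradient u x) / ‖gradient u x‖ ^ 3

/-- `(n-1)`-dimensional Hausdorff measure (area) of a subset of `ℝⁿ`. -/
def sArea {n : ℕ} (s : Set (EuclideanSpace ℝ (Fin n))) : ℝ :=
  (μH[(n : ℝ) - 1] s).toReal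

/-- Area of the unit sphere `𝕊^{n-1} ⊆ ℝⁿ`. -/
def sphereArea (n : ℕ) : ℝ := sArea (Metric.sphere (0 : EuclideanSpace ℝ (Fin n)) 1)

/-- `Ω` is a bounded domain containing the origin. -/
def GoodDomain {n : ℕ} (Ω : Set (EuclideanSpace ℝ (Fin n))) : Prop :=
  IsOpen Ω ∧ IsConnected Ω ∧ Bornology.IsBounded Ω ∧ (0 : EuclideanSpace ℝ (Fin n)) ∈ Ω

/-- The exterior problem: `u` is smooth up to the boundary on `ℝⁿ∖Ω`, harmonic in
`ℝⁿ∖closure(Ω)`, equal to `1` on `∂Ω`, and tends to `0` at infinity. -/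
def ExteriorSol {n : ℕ} (Ω : Set (EuclideanSpace ℝ (Fin n)))
    (u : EuclideanSpace ℝ (Fin n) → ℝ) : Prop :=
  (∃ U, IsOpen U ∧ Ωᶜ ⊆ U ∧ ContDiffOn ℝ (⊤ : ℕ∞) u U) ∧
  (∀ x ∈ (closure Ω)ᶜ, lap u x = 0) ∧
  (∀ x ∈ frontier Ω, u x = 1) ∧
  Tendsto u (cocompact (EuclideanSpace ℝ (Fin n))) (nhds 0)

/-- The interior problem with parameters `d > 0` and `c`: `u` is smooth up to the boundary away
from the origin, harmonic in `Ω∖{0}`, equal to `c` on `∂Ω`, and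
`u - d|∂Ω||x|^{2-n}/((n-2)|𝕊^{n-1}|)` extends to a harmonic function on `Ω`. -/
def InteriorSol {n : ℕ} (Ω : Set (EuclideanSpace ℝ (Fin n))) (d c : ℝ)
    (u : EuclideanSpace ℝ (Fin n) → ℝ) : Prop :=
  (∃ U, IsOpen U ∧ closure Ω ⊆ U ∧ ContDiffOn ℝ (⊤ : ℕ∞) u (U \ {0})) ∧
  (∀ x ∈ Ω \ {(0 : EuclideanSpace ℝ (Fin n))}, lap u x = 0) ∧
  (∀ x ∈ frontier Ω, u x = c) ∧
  (∃ v : EuclideanSpace ℝ (Fin n) → ℝ, ContDiffOn ℝ (⊤ : ℕ∞) v Ω ∧ (∀ x ∈ Ω, lap v x = 0) ∧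
    ∀ x ∈ Ω \ {(0 : EuclideanSpace ℝ (Fin n))},
      u x = d * sArea (frontier Ω) / (((n : ℝ) - 2) * sphereArea n) * ‖x‖ ^ ((2 : ℝ) - n) + v x)

/-- The `P`-function `|Du|²/u^{2(n-1)/(n-2)} = |∇f|_g²`. -/
def Pfun {n : ℕ} (u : EuclideanSpace ℝ (Fin n) → ℝ) (x : EuclideanSpace ℝ (Fin n)) : ℝ :=
  ‖gradient u x‖ ^ 2 / u x ^ (2 * ((n : ℝ) - 1) / ((n : ℝ) - 2))

/-- `|∇f|_g = |Du|/u^{(n-1)/(n-2)}`, the `g`-length of the gradient of `f = log u`. -/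
def gradg {n : ℕ} (u : EuclideanSpace ℝ (Fin n) → ℝ) (x : EuclideanSpace ℝ (Fin n)) : ℝ :=
  ‖gradient u x‖ / u x ^ (((n : ℝ) - 1) / ((n : ℝ) - 2))

/-- The tensor `T = D²f - (1/(n-2))(2 df⊗df - |Df|² Id)` for `f = log u`, evaluated on `(v,w)`. -/
def Tlog {n : ℕ} (u : EuclideanSpace ℝ (Fin n) → ℝ) (x v w : EuclideanSpace ℝ (Fin n)) : ℝ :=
  hess2 (fun y => Real.log (u y)) x v w -
    (1 / ((n : ℝ) - 2)) *
      (2 * ⟪gradient (fun y => Real.log (u y)) x, v⟫_ℝ *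
          ⟪gradient (fun y => Real.log (u y)) x, w⟫_ℝ -
        ‖gradient (fun y => Real.log (u y)) x‖ ^ 2 * ⟪v, w⟫_ℝ)

/-- `|∇²f|_g² = u^{-4/(n-2)} |T|²`, the squared `g`-norm of the `g`-Hessian of `f = log u`. -/
def hessgSq {n : ℕ} (u : EuclideanSpace ℝ (Fin n) → ℝ) (x : EuclideanSpace ℝ (Fin n)) : ℝ :=
  u x ^ (-(4 : ℝ) / ((n : ℝ) - 2)) *
    ∑ i : Fin n, ∑ j : Fin n,
      (Tlog u x (EuclideanSpace.single i 1) (EuclideanSpace.single j 1)) ^ 2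

/-- The `g`-mean curvature of a regular level set of `u`:
`H_g/(n-1) = u^{-1/(n-2)} ( H/(n-1) - |Du|/((n-2)u) )`. -/
def Hg {n : ℕ} (u : EuclideanSpace ℝ (Fin n) → ℝ) (x : EuclideanSpace ℝ (Fin n)) : ℝ :=
  ((n : ℝ) - 1) * u x ^ (-(1 : ℝ) / ((n : ℝ) - 2)) *
    (meanH u x / ((n : ℝ) - 1) - ‖gradient u x‖ / (((n : ℝ) - 2) * u x))

/-- The pointwise Hessian identity `u·D²u = (n/(n-2)) Du⊗Du - (|Du|²/(n-2)) Id`, equivalent to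
the vanishing of the `g`-Hessian of `f = log u`. -/
def HessId {n : ℕ} (u : EuclideanSpace ℝ (Fin n) → ℝ) (x : EuclideanSpace ℝ (Fin n)) : Prop :=
  ∀ v w : EuclideanSpace ℝ (Fin n),
    u x * hess2 u x v w =
      ((n : ℝ) / ((n : ℝ) - 2)) * (⟪gradient u x, v⟫_ℝ * ⟪gradient u x, w⟫_ℝ) -
        (‖gradient u x‖ ^ 2 / ((n : ℝ) - 2)) * ⟪v, w⟫_ℝ

/-- A smooth monotone function equal to `0` on `(-∞, 1]` and to `1` on `[2, ∞)`. -/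
def kstep (t : ℝ) : ℝ := Real.smoothTransition (t - 1)

lemma kstep_contDiff : ContDiff ℝ (⊤ : ℕ∞) kstep :=
  Real.smoothTransition.contDiff.comp (contDiff_id.sub contDiff_const)

lemma kstep_mono : Monotone kstep := fun _ _ h =>
  Real.smoothTransition.monotone (by linarith)

lemma kstep_zero {t : ℝ} (h : t ≤ 1) : kstep t = 0 :=
  Real.smoothTransition.zero_of_nonpos (by linarith)

lemma kstep_one {t : ℝ} (h : 2 ≤ t) : kstep t = 1 :=
  Real.smoothTransition.one_of_one_le (by linarith)

lemma kstep_nonneg (t : ℝ) : 0 ≤ kstep t := Real.smoothTransition.nonneg _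

lemma kstep_le_one (t : ℝ) : kstep t ≤ 1 := Real.smoothTransition.le_one _

lemma kstep_differentiable : Differentiable ℝ kstep :=
  kstep_contDiff.differentiable (by simp)

lemma kstep_deriv_continuous : Continuous (deriv kstep) :=
  kstep_contDiff.continuous_deriv (by simp)

lemma kstep_deriv_nonneg (t : ℝ) : 0 ≤ deriv kstep t := kstep_mono.deriv_nonneg

lemma kstep_deriv_left {t : ℝ} (h : t ≤ 1) : deriv kstep t = 0 := by
  have : ∀ s : ℝ, s < 1 → deriv kstep s = 0 := by
    intro s hs
    have : kstep =ᶠ[𝓝 s] fun _ => (0 : ℝ) := by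
      filter_upwards [gt_mem_nhds hs] with y hy using kstep_zero hy.le
    rw [this.deriv_eq]; simp
  have hc : IsClosed {s : ℝ | deriv kstep s = 0} :=
    isClosed_singleton.preimage kstep_deriv_continuous
  have := closure_minimal (show Iio (1 : ℝ) ⊆ _ from this) hc
  rw [closure_Iio] at this
  exact this h

lemma kstep_deriv_right {t : ℝ} (h : 2 ≤ t) : deriv kstep t = 0 := by
  have : ∀ s : ℝ, 2 < s → deriv kstep s = 0 := by
    intro s hs
    have : kstep =ᶠ[𝓝 s] fun _ => (1 : ℝ) := by
      filter_upwards [lt_mem_nhds hs] with y hy using kstep_one hy.le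
    rw [this.deriv_eq]; simp
  have hc : IsClosed {s : ℝ | deriv kstep s = 0} :=
    isClosed_singleton.preimage kstep_deriv_continuous
  have := closure_minimal (show Ioi (2 : ℝ) ⊆ _ from this) hc
  rw [closure_Ioi] at this
  exact this h

lemma kstep_deriv_bdd : ∃ B : ℝ, 0 ≤ B ∧ ∀ t, deriv kstep t ≤ B := by
  obtain ⟨B, hB⟩ := (isCompact_Icc (a := (1 : ℝ)) (b := 2)).bddAbove_image
    kstep_deriv_continuous.continuousOn
  refine ⟨max B 0, le_max_right _ _, fun t => ?_⟩
  by_cases h1 : t ≤ 1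
  · rw [kstep_deriv_left h1]; exact le_max_right _ _
  by_cases h2 : 2 ≤ t
  · rw [kstep_deriv_right h2]; exact le_max_right _ _
  · push Not at h1 h2
    exact (hB ⟨t, ⟨h1.le, h2.le⟩, rfl⟩).trans (le_max_left _ _)

/-- The rescaled step, rising from `0` to `1` on `[T + ε, T + 2ε]`. -/
def ramp (T ε t : ℝ) : ℝ := kstep ((t - T) / ε)

/-- The derivative of `ramp`, an approximate identity at `T` as `ε → 0+`. -/
def kern (T ε t : ℝ) : ℝ := deriv kstep ((t - T) / ε) / ε

lemma ramp_hasDerivAt (T ε t : ℝ) : HasDerivAt (ramp T ε) (kern T ε t) t := by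
  have h := (kstep_differentiable ((t - T) / ε)).hasDerivAt.comp t
    (((hasDerivAt_id t).sub_const T).div_const ε)
  refine h.congr_deriv ?_
  simp [kern, div_eq_mul_inv]

lemma ramp_contDiff (T ε : ℝ) : ContDiff ℝ (⊤ : ℕ∞) (ramp T ε) :=
  kstep_contDiff.comp ((contDiff_id.sub contDiff_const).div_const ε)

lemma kern_continuous (T ε : ℝ) : Continuous (kern T ε) := by
  unfold kern
  exact (kstep_deriv_continuous.comp (by fun_prop)).div_const ε

lemma ramp_nonneg (T ε t : ℝ) : 0 ≤ ramp T ε t := kstep_nonneg _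

lemma ramp_le_one (T ε t : ℝ) : ramp T ε t ≤ 1 := kstep_le_one _

lemma ramp_zero {T ε t : ℝ} (hε : 0 < ε) (h : t ≤ T + ε) : ramp T ε t = 0 :=
  kstep_zero ((div_le_one hε).2 (by linarith))

lemma ramp_one {T ε t : ℝ} (hε : 0 < ε) (h : T + 2 * ε ≤ t) : ramp T ε t = 1 :=
  kstep_one ((le_div_iff₀ hε).2 (by linarith))

lemma kern_nonneg {T ε : ℝ} (hε : 0 < ε) (t : ℝ) : 0 ≤ kern T ε t :=
  div_nonneg (kstep_deriv_nonneg _) hε.le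

lemma kern_left {T ε t : ℝ} (hε : 0 < ε) (h : t ≤ T + ε) : kern T ε t = 0 := by
  rw [kern, kstep_deriv_left ((div_le_one hε).2 (by linarith)), zero_div]

lemma kern_right {T ε t : ℝ} (hε : 0 < ε) (h : T + 2 * ε ≤ t) : kern T ε t = 0 := by
  rw [kern, kstep_deriv_right ((le_div_iff₀ hε).2 (by linarith)), zero_div]

/-- Orthogonal coordinates `(y, s) ↦ y + s • ν` relative to a unit vector `ν`. -/
lemma measurePreserving_orthogonal_coords {E : Type*} [NormedAddCommGroup E]
    [InnerProductSpace ℝ E] [FiniteDimensional ℝ E] [MeasurableSpace E] [BorelSpace E]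
    (ν : E) (hν : ‖ν‖ = 1) :
    ∃ Φ : ((ℝ ∙ ν)ᗮ × ℝ) ≃ₜ E, (∀ p, Φ p = (p.1 : E) + p.2 • ν) ∧
      MeasurePreserving Φ (volume.prod volume) volume := by
  let Y := (ℝ ∙ ν)ᗮ
  have hfin : Module.finrank ℝ (ℝ ∙ ν) = 1 := finrank_span_singleton (by
    rintro rfl; simp at hν)
  let L : WithLp 2 (Y × ℝ) →ₗᵢ[ℝ] E :=
    { toFun := fun p => ((WithLp.ofLp p).1 : E) + (WithLp.ofLp p).2 • ν
      map_add' := by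
        intro p q
        simp only [WithLp.ofLp_add, Prod.fst_add, Prod.snd_add, Submodule.coe_add, add_smul]
        abel
      map_smul' := by
        intro c p
        simp [mul_smul]
      norm_map' := by
        intro p
        have horth : inner ℝ ((WithLp.ofLp p).1 : E) ((WithLp.ofLp p).2 • ν) = 0 := by
          rw [inner_smul_right]
          have := (Submodule.mem_orthogonal_singleton_iff_inner_left (𝕜 := ℝ)).1
            (WithLp.ofLp p).1.2
          rw [this, mul_zero]
        have h1 := norm_add_sq_eq_norm_sq_add_norm_sq_of_inner_eq_zero
          ((WithLp.ofLp p).1 : E) ((WithLp.ofLp p).2 • ν) horth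
        have h2 := WithLp.prod_norm_sq_eq_of_L2 p
        rw [norm_smul, hν, mul_one] at h1
        have : ‖((WithLp.ofLp p).1 : E) + (WithLp.ofLp p).2 • ν‖ ^ 2 = ‖p‖ ^ 2 := by
          rw [h2, pow_two, h1]; simp [pow_two]
        exact (sq_eq_sq₀ (norm_nonneg _) (norm_nonneg _)).1 this }
  have hdim : Module.finrank ℝ (WithLp 2 (Y × ℝ)) = Module.finrank ℝ E := by
    rw [(WithLp.linearEquiv 2 ℝ (Y × ℝ)).finrank_eq, Module.finrank_prod]
    have := (ℝ ∙ ν).finrank_add_finrank_orthogonal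
    rw [hfin] at this
    simp only [Module.finrank_self]
    rw [add_comm]; exact this
  let L' := L.toLinearIsometryEquiv hdim
  refine ⟨(WithLp.homeomorphProd 2 Y ℝ).symm.trans L'.toHomeomorph, fun p => rfl, ?_⟩
  exact (L'.measurePreserving).comp (WithLp.volume_preserving_toLp Y ℝ)

section Surface

variable {E : Type*} [NormedAddCommGroup E] [InnerProductSpace ℝ E] [FiniteDimensional ℝ E]

/-- A level set of a `C¹` function is a graph with small slope near a regular point. -/
lemma exists_local_graph {V : Set E} (hV : IsOpen V) {u : E → ℝ} (hu : ContDiffOn ℝ 1 u V)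
    {x₀ : E} (hx₀ : x₀ ∈ V) (hg : gradient u x₀ ≠ 0) {τ : ℝ} (hτ : 0 < τ) (hτ' : τ ≤ 1 / 4) :
    ∃ (ν : E) (R a : ℝ) (h : (ℝ ∙ ν)ᗮ → ℝ), ‖ν‖ = 1 ∧ 0 < R ∧ 0 < a ∧ ball x₀ R ⊆ V ∧
      (∀ x ∈ ball x₀ R, (1 - τ) * a ≤ fderiv ℝ u x ν ∧ ‖gradient u x‖ ≤ (1 + τ) * a) ∧
      (∀ y : (ℝ ∙ ν)ᗮ, ‖y‖ < R / 4 → |h y| ≤ R / 3 ∧ u (x₀ + (y + h y • ν)) = u x₀ ∧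
        ∀ s : ℝ, |s| ≤ R / 2 →
          (h y ≤ s → a * (1 - τ) * (s - h y) ≤ u (x₀ + (y + s • ν)) - u x₀) ∧
          (s ≤ h y → u (x₀ + (y + s • ν)) - u x₀ ≤ a * (1 - τ) * (s - h y))) ∧
      (∀ y y' : (ℝ ∙ ν)ᗮ, ‖y‖ < R / 4 → ‖y'‖ < R / 4 →
        ‖(y + h y • ν) - (y' + h y' • ν)‖ ≤ (1 - τ)⁻¹ * ‖y - y'‖) := by
  set a := ‖gradient u x₀‖ with ha
  have ha0 : 0 < a := norm_pos_iff.2 hg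
  set ν : E := a⁻¹ • gradient u x₀ with hν
  have hν1 : ‖ν‖ = 1 := by
    rw [hν, norm_smul, norm_inv, Real.norm_of_nonneg ha0.le, ← ha, inv_mul_cancel₀ ha0.ne']
  have hgν : gradient u x₀ = a • ν := by rw [hν, smul_smul, mul_inv_cancel₀ ha0.ne', one_smul]
  have hcd : ContDiffAt ℝ 1 u x₀ := hu.contDiffAt (hV.mem_nhds hx₀)
  have hstrict := hcd.hasStrictFDerivAt (by simp)
  have hτa : 0 < τ * a := by positivity
  obtain ⟨S, hS, hSapp⟩ := hstrict.approximates_deriv_on_nhds (c := ⟨τ * a, hτa.le⟩)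
    (Or.inr hτa)
  have hgc : ContinuousAt (gradient u) x₀ := by
    have h1 : ContinuousAt (fderiv ℝ u) x₀ := hcd.continuousAt_fderiv (by simp)
    exact (InnerProductSpace.toDual ℝ E).symm.continuous.continuousAt.comp h1
  have hnear : ∀ᶠ x in 𝓝 x₀, ‖gradient u x - gradient u x₀‖ < τ * a := by
    have := (Metric.tendsto_nhds.1 hgc) (τ * a) hτa
    simpa [dist_eq_norm] using this
  obtain ⟨R, hR, hball⟩ := Metric.eventually_nhds_iff_ball.1
    ((hnear.and hS).and (hV.mem_nhds hx₀))
  have horth : ∀ y : (ℝ ∙ ν)ᗮ, inner ℝ ν (y : E) = 0 := fun y =>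
    (Submodule.mem_orthogonal_singleton_iff_inner_right (𝕜 := ℝ)).1 y.2
  have hνν : inner ℝ ν ν = (1 : ℝ) := by rw [real_inner_self_eq_norm_sq, hν1]; norm_num
  have hfd : ∀ v, fderiv ℝ u x₀ v = a * inner ℝ ν v := by
    intro v
    rw [← inner_gradient_left, hgν, real_inner_smul_left]
  have hmem : ∀ (y : (ℝ ∙ ν)ᗮ) (s : ℝ), ‖y‖ < R / 4 → |s| ≤ R / 2 →
      x₀ + ((y : E) + s • ν) ∈ ball x₀ R := by
    intro y s hy hs
    rw [mem_ball, dist_eq_norm, add_sub_cancel_left]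
    calc ‖(y : E) + s • ν‖ ≤ ‖(y : E)‖ + ‖s • ν‖ := norm_add_le _ _
      _ = ‖y‖ + |s| := by rw [norm_smul, hν1, mul_one]; rfl
      _ < R := by linarith
  have happ : ∀ (y y' : (ℝ ∙ ν)ᗮ) (s s' : ℝ), ‖y‖ < R / 4 → ‖y'‖ < R / 4 → |s| ≤ R / 2 →
      |s'| ≤ R / 2 → |u (x₀ + (y + s • ν)) - u (x₀ + (y' + s' • ν)) - a * (s - s')| ≤
        τ * a * (‖y - y'‖ + |s - s'|) := by
    intro y y' s s' hy hy' hs hs'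
    have h1 := hSapp _ (hball _ (hmem y s hy hs)).1.2 _ (hball _ (hmem y' s' hy' hs')).1.2
    have h2 : x₀ + ((y : E) + s • ν) - (x₀ + ((y' : E) + s' • ν)) =
        ((y - y' : (ℝ ∙ ν)ᗮ) : E) + (s - s') • ν := by
      rw [Submodule.coe_sub, sub_smul]; abel
    rw [h2, hfd, inner_add_right, horth, real_inner_smul_right, hνν, zero_add, mul_one,
      Real.norm_eq_abs] at h1
    refine h1.trans (mul_le_mul_of_nonneg_left ?_ hτa.le)
    refine (norm_add_le _ _).trans ?_
    rw [norm_smul, hν1, mul_one]; rfl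
  have hex : ∀ y : (ℝ ∙ ν)ᗮ, ‖y‖ < R / 4 → ∃ s : ℝ, |s| < R / 2 ∧
      u (x₀ + (y + s • ν)) = u x₀ := by
    intro y hy
    have hy0 : ‖(0 : (ℝ ∙ ν)ᗮ)‖ < R / 4 := by simp; positivity
    have hR2 : |R / 2| ≤ R / 2 := by rw [abs_of_pos (by positivity)]
    have hR2' : |-(R / 2)| ≤ R / 2 := by rw [abs_neg]; exact hR2
    have h0 : |(0 : ℝ)| ≤ R / 2 := by simp; positivity
    have hp := happ y 0 (R / 2) 0 hy hy0 hR2 h0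
    have hm := happ y 0 (-(R / 2)) 0 hy hy0 hR2' h0
    simp only [Submodule.coe_zero, zero_smul, add_zero, sub_zero] at hp hm
    rw [abs_of_pos (a := R / 2) (by positivity)] at hp
    rw [abs_neg, abs_of_pos (a := R / 2) (by positivity)] at hm
    have hbd : τ * a * (‖y‖ + R / 2) < a * (R / 2) := by
      have : τ * a * (‖y‖ + R / 2) ≤ (1 / 4) * a * (R / 4 + R / 2) := by gcongr
      nlinarith [mul_pos ha0 hR]
    have hpos : u x₀ < u (x₀ + (y + (R / 2) • ν)) := by
      have := (abs_le.1 hp).1; linarith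
    have hneg : u (x₀ + (y + (-(R / 2)) • ν)) < u x₀ := by
      have := (abs_le.1 hm).2; linarith
    have hcont : ContinuousOn (fun s : ℝ => u (x₀ + ((y : E) + s • ν)))
        (Icc (-(R / 2)) (R / 2)) := by
      refine hu.continuousOn.comp (by fun_prop) ?_
      intro s hs
      exact (hball _ (hmem y s hy (abs_le.2 hs))).2
    obtain ⟨s, hs, hsu⟩ := intermediate_value_Ioo (by linarith) hcont ⟨hneg, hpos⟩
    exact ⟨s, abs_lt.2 hs, hsu⟩
  classical
  let h : (ℝ ∙ ν)ᗮ → ℝ := fun y => if hy : ‖y‖ < R / 4 then (hex y hy).choose else 0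
  have hh : ∀ y, ‖y‖ < R / 4 → |h y| < R / 2 ∧ u (x₀ + (y + h y • ν)) = u x₀ := by
    intro y hy
    have := (hex y hy).choose_spec
    simpa only [h, dif_pos hy] using this
  refine ⟨ν, R, a, h, hν1, hR, ha0, fun x hx => (hball x hx).2, ?_, ?_, ?_⟩
  · intro x hx
    have h1 := (hball x hx).1.1
    constructor
    · have h2 : fderiv ℝ u x ν = a + inner ℝ (gradient u x - gradient u x₀) ν := by
        rw [inner_sub_left, inner_gradient_left, inner_gradient_left, hfd, hνν]; ring
      have h3 := abs_real_inner_le_norm (gradient u x - gradient u x₀) ν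
      rw [hν1, mul_one] at h3
      have := (abs_le.1 (h3.trans h1.le)).1
      linarith
    · have := norm_le_norm_add_norm_sub' (gradient u x) (gradient u x₀)
      linarith
  · intro y hy
    have h0 := happ y 0 (h y) 0 hy (by simpa using by positivity) (hh y hy).1.le
      (by simpa using by positivity)
    simp only [Submodule.coe_zero, zero_smul, add_zero, sub_zero] at h0
    rw [(hh y hy).2, sub_self, zero_sub, abs_neg, abs_mul, abs_of_pos ha0] at h0
    have hle : |h y| ≤ R / 3 := by
      have h1 : a * |h y| ≤ a * (1 / 4 * (‖y‖ + |h y|)) := by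
        have : τ * a * (‖y‖ + |h y|) ≤ 1 / 4 * a * (‖y‖ + |h y|) := by gcongr
        linarith
      have h2 := le_of_mul_le_mul_left h1 ha0
      linarith
    refine ⟨hle, (hh y hy).2, fun s hs => ?_⟩
    have h1 := happ y y s (h y) hy hy hs (hh y hy).1.le
    rw [(hh y hy).2, sub_self, norm_zero, zero_add] at h1
    constructor
    · intro hle
      rw [abs_of_nonneg (sub_nonneg.2 hle)] at h1
      have := (abs_le.1 h1).1; linarith
    · intro hle
      rw [abs_of_nonpos (sub_nonpos.2 hle)] at h1
      have := (abs_le.1 h1).2; linarith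
  · intro y y' hy hy'
    have h1 := happ y y' (h y) (h y') hy hy' (hh y hy).1.le (hh y' hy').1.le
    rw [(hh y hy).2, (hh y' hy').2, sub_self, zero_sub, abs_neg, abs_mul, abs_of_pos ha0] at h1
    have h2 : |h y - h y'| ≤ τ * (‖y - y'‖ + |h y - h y'|) := by
      have : a * |h y - h y'| ≤ a * (τ * (‖y - y'‖ + |h y - h y'|)) := by linarith
      exact le_of_mul_le_mul_left this ha0
    have h3 : ((y : E) + h y • ν) - (y' + h y' • ν) =
        ((y - y' : (ℝ ∙ ν)ᗮ) : E) + (h y - h y') • ν := by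
      rw [Submodule.coe_sub, sub_smul]; abel
    rw [h3]
    have h4 : ‖((y - y' : (ℝ ∙ ν)ᗮ) : E) + (h y - h y') • ν‖ ≤ ‖y - y'‖ + |h y - h y'| := by
      refine (norm_add_le _ _).trans ?_
      rw [norm_smul, hν1, mul_one]; rfl
    refine h4.trans ?_
    rw [inv_mul_eq_div, le_div_iff₀ (by linarith)]
    nlinarith

end Surface

lemma LipschitzOnWith.euclideanHausdorffMeasure_image_le {X Y : Type*} [EMetricSpace X]
    [MeasurableSpace X] [BorelSpace X] [EMetricSpace Y] [MeasurableSpace Y] [BorelSpace Y]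
    {f : X → Y} {K : ℝ≥0} {s : Set X} (h : LipschitzOnWith K f s) (m : ℕ) :
    μHE[m] (f '' s) ≤ (K : ℝ≥0∞) ^ m * μHE[m] s := by
  rw [Measure.euclideanHausdorffMeasure_def, Measure.euclideanHausdorffMeasure_def]
  simp only [Measure.smul_apply]
  have := h.hausdorffMeasure_image_le (d := m) (Nat.cast_nonneg m)
  rw [ENNReal.rpow_natCast] at this
  calc _ ≤ _ := smul_le_smul_of_nonneg_left this zero_le
    _ = _ := (mul_smul_comm _ _ _).symm

/-- Integrals over a Lipschitz graph compared with integrals over its base. -/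
lemma integral_graph_compare {E Y : Type*} [NormedAddCommGroup E]
    [MeasurableSpace E] [BorelSpace E] [NormedAddCommGroup Y] [InnerProductSpace ℝ Y]
    [FiniteDimensional ℝ Y] [MeasurableSpace Y] [BorelSpace Y] {m : ℕ}
    (hm : Module.finrank ℝ Y = m) {B : Set Y} (hB : MeasurableSet B) (hBfin : volume B ≠ ∞)
    {Γ : Y → E} {π : E → Y} {K : ℝ≥0} (hΓ : LipschitzOnWith K Γ B) (hπ : LipschitzWith 1 π)
    (hπΓ : ∀ y ∈ B, π (Γ y) = y) {ψ : E → ℝ} (hψ : Continuous ψ) (hψs : HasCompactSupport ψ)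
    (hψ0 : ∀ x, 0 ≤ ψ x) :
    IntegrableOn ψ (Γ '' B) μHE[m] ∧ IntegrableOn (fun y => ψ (Γ y)) B ∧
      (∫ y in B, ψ (Γ y)) ≤ ∫ x in Γ '' B, ψ x ∂μHE[m] ∧
      (∫ x in Γ '' B, ψ x ∂μHE[m]) ≤ (K : ℝ) ^ m * ∫ y in B, ψ (Γ y) := by
  subst hm
  set m := Module.finrank ℝ Y
  have hvol : (volume : Measure Y) = μHE[m] :=
    (InnerProductSpace.euclideanHausdorffMeasure_eq_volume).symm
  have hΓm : AEMeasurable Γ (volume.restrict B) := hΓ.continuousOn.aemeasurable hB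
  set ρ : Measure E := (volume.restrict B).map Γ with hρ
  set l : Measure E := (μHE[m] : Measure E).restrict (Γ '' B) with hl
  have hρA : ∀ A, MeasurableSet A → ρ A = μHE[m] (Γ ⁻¹' A ∩ B) := by
    intro A hA
    rw [hρ, Measure.map_apply_of_aemeasurable hΓm hA, Measure.restrict_apply' hB, hvol]
  have hlA : ∀ A, MeasurableSet A → l A = μHE[m] (Γ '' (Γ ⁻¹' A ∩ B)) := by
    intro A hA
    rw [hl, Measure.restrict_apply hA, image_preimage_inter]
  have h1 : ρ ≤ l := by
    refine Measure.le_iff.2 fun A hA => ?_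
    rw [hρA A hA, hlA A hA]
    have h2 : π '' (Γ '' (Γ ⁻¹' A ∩ B)) = Γ ⁻¹' A ∩ B := by
      rw [image_image]
      have : EqOn (fun y => π (Γ y)) id (Γ ⁻¹' A ∩ B) := fun y hy => hπΓ y hy.2
      rw [this.image_eq, image_id]
    have h3 := (hπ.lipschitzOnWith (s := Γ '' (Γ ⁻¹' A ∩ B))).euclideanHausdorffMeasure_image_le m
    rw [h2] at h3
    simpa using h3
  have h2 : l ≤ ((K : ℝ≥0∞) ^ m) • ρ := by
    refine Measure.le_iff.2 fun A hA => ?_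
    rw [Measure.smul_apply, hρA A hA, hlA A hA, smul_eq_mul]
    exact (hΓ.mono inter_subset_right).euclideanHausdorffMeasure_image_le m
  have hρfin : IsFiniteMeasure ρ := by
    have : IsFiniteMeasure (volume.restrict B) := ⟨by simpa using hBfin.lt_top⟩
    infer_instance
  obtain ⟨C, hC⟩ := hψs.exists_bound_of_continuous hψ
  have hint : Integrable ψ ρ := by
    refine Integrable.of_bound hψ.aestronglyMeasurable C (ae_of_all _ hC)
  have hint2 : Integrable ψ (((K : ℝ≥0∞) ^ m) • ρ) := hint.smul_measure (by simp)
  have hint3 : Integrable ψ l := hint2.mono_measure h2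
  have hmap : ∫ x, ψ x ∂ρ = ∫ y in B, ψ (Γ y) :=
    integral_map hΓm hψ.aestronglyMeasurable
  refine ⟨hint3, (integrable_map_measure hψ.aestronglyMeasurable hΓm).1 hint, ?_, ?_⟩
  · rw [← hmap]
    exact integral_mono_measure h1 (ae_of_all _ hψ0) hint3
  · have := integral_mono_measure h2 (ae_of_all _ hψ0) hint2
    rw [integral_smul_measure, hmap] at this
    simpa using this

/-- Along a line, `kern T ε ∘ g * g'` is an approximate identity at the point where `g = T`. -/
lemma abs_integral_kern_sub_le {g g' ρ : ℝ → ℝ} {L T ε r e : ℝ} (hL : 0 ≤ L) (hε : 0 < ε)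
    (hg : ∀ s ∈ Icc (-L) L, HasDerivAt g (g' s) s) (hg' : ContinuousOn g' (Icc (-L) L))
    (hρ : ContinuousOn ρ (Icc (-L) L)) (hpos : ∀ s ∈ Icc (-L) L, 0 ≤ g' s)
    (hleft : g (-L) ≤ T + ε) (hright : T + 2 * ε ≤ g L)
    (hclose : ∀ s ∈ Icc (-L) L, T + ε < g s → g s < T + 2 * ε → |ρ s - r| ≤ e) :
    |(∫ s in (-L)..L, kern T ε (g s) * ρ s * g' s) - r| ≤ e := by
  have hle : -L ≤ L := by linarith
  have hgc : ContinuousOn g (Icc (-L) L) := fun s hs => (hg s hs).continuousAt.continuousWithinAt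
  have hkc : ContinuousOn (fun s => kern T ε (g s)) (Icc (-L) L) :=
    (kern_continuous T ε).comp_continuousOn hgc
  have hftc : ∫ s in (-L)..L, kern T ε (g s) * g' s = 1 := by
    rw [intervalIntegral.integral_eq_sub_of_hasDerivAt (f := fun s => ramp T ε (g s))]
    · simp only [ramp_one hε hright, ramp_zero hε hleft, sub_zero]
    · intro s hs
      rw [uIcc_of_le hle] at hs
      exact (ramp_hasDerivAt T ε (g s)).comp s (hg s hs)
    · exact (hkc.mul hg').intervalIntegrable_of_Icc hle
  have h1 : (∫ s in (-L)..L, kern T ε (g s) * ρ s * g' s) - r =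
      ∫ s in (-L)..L, kern T ε (g s) * g' s * (ρ s - r) := by
    have : r = ∫ s in (-L)..L, kern T ε (g s) * g' s * r := by
      rw [intervalIntegral.integral_mul_const, hftc, one_mul]
    conv_lhs => rw [this]
    rw [← intervalIntegral.integral_sub]
    · congr 1; ext s; ring
    · exact ((hkc.mul hρ).mul hg').intervalIntegrable_of_Icc hle
    · exact ((hkc.mul hg').mul continuousOn_const).intervalIntegrable_of_Icc hle
  rw [h1]
  have h2 : ‖∫ s in (-L)..L, kern T ε (g s) * g' s * (ρ s - r)‖ ≤
      ∫ s in (-L)..L, kern T ε (g s) * g' s * e := by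
    refine intervalIntegral.norm_integral_le_of_norm_le hle ?_ ?_
    · refine ae_of_all _ fun s hs => ?_
      have hs' := Ioc_subset_Icc_self hs
      have h0 : 0 ≤ kern T ε (g s) * g' s := mul_nonneg (kern_nonneg hε _) (hpos s hs')
      rw [norm_mul, Real.norm_of_nonneg h0, Real.norm_eq_abs]
      by_cases ha : T + ε < g s
      · by_cases hb : g s < T + 2 * ε
        · exact mul_le_mul_of_nonneg_left (hclose s hs' ha hb) h0
        · rw [kern_right hε (not_lt.1 hb)]; simp
      · rw [kern_left hε (not_lt.1 ha)]; simp
    · exact ((hkc.mul hg').mul continuousOn_const).intervalIntegrable_of_Icc hle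
  rw [intervalIntegral.integral_mul_const, hftc, one_mul] at h2
  exact h2

section Surface

variable {E : Type*} [NormedAddCommGroup E] [InnerProductSpace ℝ E]

lemma norm_sq_add_smul_of_orthogonal {ν : E} (hν : ‖ν‖ = 1) (y : (ℝ ∙ ν)ᗮ) (s : ℝ) :
    ‖(y : E) + s • ν‖ ^ 2 = ‖y‖ ^ 2 + s ^ 2 := by
  have horth : inner ℝ (y : E) (s • ν) = 0 := by
    rw [inner_smul_right, (Submodule.mem_orthogonal_singleton_iff_inner_left (𝕜 := ℝ)).1 y.2,
      mul_zero]
  have h := norm_add_sq_eq_norm_sq_add_norm_sq_of_inner_eq_zero (y : E) (s • ν) horth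
  rw [norm_smul, hν, mul_one, Real.norm_eq_abs, abs_mul_abs_self] at h
  rw [pow_two, h, pow_two, pow_two]; rfl

lemma norm_le_norm_add_smul_of_orthogonal {ν : E} (hν : ‖ν‖ = 1) (y : (ℝ ∙ ν)ᗮ) (s : ℝ) :
    ‖y‖ ≤ ‖(y : E) + s • ν‖ := by
  have := norm_sq_add_smul_of_orthogonal hν y s
  exact le_of_sq_le_sq (by nlinarith [sq_nonneg s]) (norm_nonneg _)

lemma abs_le_norm_add_smul_of_orthogonal {ν : E} (hν : ‖ν‖ = 1) (y : (ℝ ∙ ν)ᗮ) (s : ℝ) :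
    |s| ≤ ‖(y : E) + s • ν‖ := by
  have := norm_sq_add_smul_of_orthogonal hν y s
  exact le_of_sq_le_sq (by rw [sq_abs]; nlinarith [sq_nonneg ‖y‖]) (norm_nonneg _)

/-- A product of a function continuous on `V` with one whose support lies inside `V`. -/
lemma continuous_mul_of_tsupport_subset {X : Type*} [TopologicalSpace X] {V : Set X}
    (hV : IsOpen V) {f ψ : X → ℝ} (hf : ContinuousOn f V) (hψ : Continuous ψ)
    (hs : tsupport ψ ⊆ V) : Continuous fun x => f x * ψ x := by
  refine continuous_of_tsupport fun x hx => ?_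
  have hxV : x ∈ V := hs (closure_mono (Function.support_mul_subset_right f ψ) hx)
  exact (hf.continuousAt (hV.mem_nhds hxV)).mul hψ.continuousAt

variable [FiniteDimensional ℝ E]

lemma continuousOn_gradient {V : Set E} (hV : IsOpen V) {u : E → ℝ} (hu : ContDiffOn ℝ 1 u V) :
    ContinuousOn (gradient u) V :=
  (InnerProductSpace.toDual ℝ E).symm.continuous.comp_continuousOn
    (hu.continuousOn_fderiv_of_isOpen hV (by simp))

variable [MeasurableSpace E] [BorelSpace E]

omit [NormedAddCommGroup E] [InnerProductSpace ℝ E] [FiniteDimensional ℝ E] [BorelSpace E] in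
lemma measurableSet_inter_level [TopologicalSpace E] [OpensMeasurableSpace E] {V : Set E}
    (hV : IsOpen V) {u : E → ℝ} (hu : ContinuousOn u V) (T : ℝ) :
    MeasurableSet (V ∩ {x | u x = T}) := by
  have h1 : IsOpen (V ∩ u ⁻¹' {T}ᶜ) := hu.isOpen_inter_preimage hV isOpen_compl_singleton
  have h2 : V ∩ {x | u x = T} = V \ (V ∩ u ⁻¹' {T}ᶜ) := by
    ext x; by_cases hx : u x = T <;> simp [hx]
  rw [h2]
  exact hV.measurableSet.diff h1.measurableSet

set_option maxHeartbeats 800000 in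
/-- The coarea formula as a limit, near a regular point, with relative error `γ`. -/
lemma exists_local_coarea {V : Set E} (hV : IsOpen V) {u : E → ℝ} (hu : ContDiffOn ℝ 1 u V)
    {m : ℕ} (hm : Module.finrank ℝ E = m + 1) {x₀ : E} (hx₀ : x₀ ∈ V) (hg : gradient u x₀ ≠ 0)
    {γ : ℝ} (hγ : 0 < γ) :
    ∃ r > 0, ball x₀ r ⊆ V ∧ ∀ ψ : E → ℝ, Continuous ψ → (∀ x, 0 ≤ ψ x) →
      tsupport ψ ⊆ ball x₀ r → IntegrableOn ψ (V ∩ {x | u x = u x₀}) μHE[m] ∧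
        ∀ e > 0, ∀ᶠ ε in 𝓝[>] (0 : ℝ),
          |(∫ x, kern (u x₀) ε (u x) * ψ x * ‖gradient u x‖) -
            ∫ x in V ∩ {x | u x = u x₀}, ψ x ∂μHE[m]| ≤
            γ * (∫ x in V ∩ {x | u x = u x₀}, ψ x ∂μHE[m]) + e := by
  obtain ⟨τ, hτ0, hτ1, hτ2⟩ : ∃ τ : ℝ, 0 < τ ∧ τ ≤ 1 / 4 ∧ τ * (3 + m) ≤ γ := by
    refine ⟨min (1 / 4) (γ / (3 + m)), by positivity, min_le_left _ _, ?_⟩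
    calc _ ≤ γ / (3 + m) * (3 + m) := by gcongr; exact min_le_right _ _
      _ = γ := by field_simp
  obtain ⟨ν, R, a, h, hν, hR, ha, hball, hder, hh, hlip⟩ :=
    exists_local_graph hV hu hx₀ hg hτ0 hτ1
  set T := u x₀ with hT
  obtain ⟨Φ, hΦ, hΦm⟩ := measurePreserving_orthogonal_coords ν hν
  set Ψ := Φ.trans (Homeomorph.addLeft x₀) with hΨdef
  have hΨ : ∀ p, Ψ p = x₀ + ((p.1 : E) + p.2 • ν) := fun p => by
    simp [hΨdef, hΦ]
  have hΨm : MeasurePreserving Ψ (volume.prod volume) volume :=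
    (measurePreserving_add_left volume x₀).comp hΦm
  set Γ : (ℝ ∙ ν)ᗮ → E := fun y => x₀ + ((y : E) + h y • ν) with hΓ
  set B : Set (ℝ ∙ ν)ᗮ := ball 0 (R / 4) with hB
  have hBmem : ∀ y, y ∈ B ↔ ‖y‖ < R / 4 := fun y => by simp [hB]
  have hτ3 : (0 : ℝ) < 1 - τ := by linarith
  set K : ℝ≥0 := ⟨(1 - τ)⁻¹, by positivity⟩ with hK
  have hΓlip : LipschitzOnWith K Γ B := by
    refine LipschitzOnWith.of_dist_le_mul fun y hy y' hy' => ?_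
    rw [dist_eq_norm, dist_eq_norm, hΓ]
    simp only [add_sub_add_left_eq_sub]
    exact hlip y y' ((hBmem y).1 hy) ((hBmem y').1 hy')
  have hinball : ∀ (y : (ℝ ∙ ν)ᗮ) (s : ℝ), ‖y‖ < R / 4 → |s| ≤ R / 2 →
      x₀ + ((y : E) + s • ν) ∈ ball x₀ R := by
    intro y s hy hs
    rw [mem_ball, dist_eq_norm, add_sub_cancel_left]
    calc ‖(y : E) + s • ν‖ ≤ ‖(y : E)‖ + ‖s • ν‖ := norm_add_le _ _
      _ = ‖y‖ + |s| := by rw [norm_smul, hν, mul_one]; rfl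
      _ < R := by linarith
  have hhR : ∀ y, ‖y‖ < R / 4 → |h y| ≤ R / 3 := fun y hy => (hh y hy).1
  have hhR2 : ∀ y, ‖y‖ < R / 4 → |h y| < R / 2 := fun y hy => by linarith [hhR y hy]
  set π : E → (ℝ ∙ ν)ᗮ := fun x => (Ψ.symm x).1 with hπ
  have hπlip : LipschitzWith 1 π := by
    refine LipschitzWith.of_dist_le_mul fun x x' => ?_
    have e1 := hΨ (Ψ.symm x)
    have e2 := hΨ (Ψ.symm x')
    rw [Homeomorph.apply_symm_apply] at e1 e2
    have e3 : x - x' = (((π x - π x' : (ℝ ∙ ν)ᗮ) : E)) +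
        ((Ψ.symm x).2 - (Ψ.symm x').2) • ν := by
      conv_lhs => rw [e1, e2]
      rw [Submodule.coe_sub, sub_smul]; simp only [hπ]; abel
    rw [NNReal.coe_one, one_mul, dist_eq_norm, dist_eq_norm, e3]
    exact norm_le_norm_add_smul_of_orthogonal hν _ _
  have hπΓ : ∀ y ∈ B, π (Γ y) = y := by
    intro y _
    have : Γ y = Ψ (y, h y) := by rw [hΨ]
    rw [this, hπ]; simp
  have hfinY : Module.finrank ℝ (ℝ ∙ ν)ᗮ = m := by
    have h1 : Module.finrank ℝ (ℝ ∙ ν) = 1 := finrank_span_singleton (by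
      rintro rfl; simp at hν)
    have := (ℝ ∙ ν).finrank_add_finrank_orthogonal
    omega
  have hsub : Γ '' B ⊆ V ∩ {x | u x = T} := by
    rintro _ ⟨y, hy, rfl⟩
    have hy' := (hBmem y).1 hy
    exact ⟨hball (hinball y _ hy' (hhR2 y hy').le), (hh y hy').2.1⟩
  have hsup : ∀ x ∈ ball x₀ (R / 4), u x = T → x ∈ Γ '' B := by
    intro x hx hxT
    set p := Ψ.symm x with hp
    have e1 := hΨ p
    rw [hp, Homeomorph.apply_symm_apply, ← hp] at e1
    have hn : ‖(p.1 : E) + p.2 • ν‖ < R / 4 := by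
      rw [mem_ball, dist_eq_norm] at hx
      rwa [e1, add_sub_cancel_left] at hx
    have hy : ‖p.1‖ < R / 4 := (norm_le_norm_add_smul_of_orthogonal hν _ _).trans_lt hn
    have hs : |p.2| ≤ R / 2 := by
      linarith [abs_le_norm_add_smul_of_orthogonal hν p.1 p.2]
    have h1 := (hh p.1 hy).2.2 p.2 hs
    rw [← e1, hxT, sub_self] at h1
    have hpos : 0 < a * (1 - τ) := by positivity
    have h2 : p.2 = h p.1 := by
      rcases le_total (h p.1) p.2 with h3 | h3
      · have := h1.1 h3; nlinarith
      · have := h1.2 h3; nlinarith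
    refine ⟨p.1, (hBmem _).2 hy, ?_⟩
    rw [hΓ]; simp only; rw [← h2, ← e1]
  have hSmeas : MeasurableSet (V ∩ {x | u x = T}) :=
    measurableSet_inter_level hV hu.continuousOn T
  refine ⟨R / 4, by positivity, (ball_subset_ball (by linarith)).trans hball, ?_⟩
  intro ψ hψ hψ0 hψs
  have hψc : HasCompactSupport ψ :=
    Metric.isCompact_of_isClosed_isBounded (isClosed_tsupport ψ) (isBounded_ball.subset hψs)
  have hψzero : ∀ x, x ∉ ball x₀ (R / 4) → ψ x = 0 := fun x hx =>
    image_eq_zero_of_notMem_tsupport fun hx' => hx (hψs hx')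
  obtain ⟨hi1, hi2, hi3, hi4⟩ := integral_graph_compare hfinY (measurableSet_ball (x := 0) (ε := R / 4))
    measure_ball_lt_top.ne hΓlip hπlip hπΓ hψ hψc hψ0
  have hvanish : ∀ x ∈ (V ∩ {x | u x = T}) \ (Γ '' B), ψ x = 0 := fun x hx =>
    hψzero x fun hxb => hx.2 (hsup x hxb hx.1.2)
  have hSeq : ∫ x in V ∩ {x | u x = T}, ψ x ∂μHE[m] = ∫ x in Γ '' B, ψ x ∂μHE[m] :=
    setIntegral_eq_of_subset_of_forall_sdiff_eq_zero hSmeas hsub hvanish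
  have hSint : IntegrableOn ψ (V ∩ {x | u x = T}) μHE[m] :=
    hi1.of_forall_sdiff_eq_zero hSmeas hvanish
  refine ⟨hSint, fun e he => ?_⟩
  rw [hSeq]
  set S := ∫ x in Γ '' B, ψ x ∂μHE[m] with hSdef
  set ρ := ∫ y in B, ψ (Γ y) with hρdef
  have hρ0 : 0 ≤ ρ := integral_nonneg fun y => hψ0 _
  set w := (volume B).toReal with hw
  have hw0 : 0 ≤ w := ENNReal.toReal_nonneg
  set e1 := e / (2 * (w + 1)) with he1
  have he10 : 0 < e1 := by positivity
  have he1w : e1 * w ≤ e / 2 := by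
    rw [he1, div_mul_eq_mul_div, div_le_div_iff₀ (by positivity) (by norm_num)]
    nlinarith
  obtain ⟨δ, hδ, hδψ⟩ := Metric.uniformContinuous_iff.1
    (hψc.uniformContinuous_of_continuous hψ) e1 he10
  have haτ : 0 < a * (1 - τ) := by positivity
  filter_upwards [self_mem_nhdsWithin, mem_nhdsWithin_of_mem_nhds
    (Iio_mem_nhds (show 0 < a * R / 16 by positivity)), mem_nhdsWithin_of_mem_nhds
    (Iio_mem_nhds (show 0 < δ * (a * (1 - τ)) / 2 by positivity))] with ε hε0 hε1 hε2
  simp only [mem_Ioi, mem_Iio] at hε0 hε1 hε2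
  set F : E → ℝ := fun x => kern T ε (u x) * ψ x * fderiv ℝ u x ν with hF
  have hfdc : ContinuousOn (fun x => fderiv ℝ u x ν) V :=
    (hu.continuousOn_fderiv_of_isOpen hV (by simp)).clm_apply continuousOn_const
  have hkc : ContinuousOn (fun x => kern T ε (u x)) V :=
    (kern_continuous T ε).comp_continuousOn hu.continuousOn
  have hψV : tsupport ψ ⊆ V := hψs.trans ((ball_subset_ball (by linarith)).trans hball)
  have hFint : Integrable F := by
    have h1 := continuous_mul_of_tsupport_subset hV (hkc.mul hfdc) hψ hψV
    have h2 : F = fun x => (kern T ε (u x) * fderiv ℝ u x ν) * ψ x := by ext x; simp only [hF]; ring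
    rw [h2]
    exact h1.integrable_of_hasCompactSupport hψc.mul_left
  have hIint : Integrable (fun x => kern T ε (u x) * ψ x * ‖gradient u x‖) := by
    have h1 := continuous_mul_of_tsupport_subset hV
      (hkc.mul (continuousOn_gradient hV hu).norm) hψ hψV
    have h2 : (fun x => kern T ε (u x) * ψ x * ‖gradient u x‖) =
        fun x => (kern T ε (u x) * ‖gradient u x‖) * ψ x := by ext x; ring
    rw [h2]
    exact h1.integrable_of_hasCompactSupport hψc.mul_left
  have hkψ : ∀ x, 0 ≤ kern T ε (u x) * ψ x := fun x => mul_nonneg (kern_nonneg hε0 _) (hψ0 x)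
  have hJI : ∫ x, F x ≤ ∫ x, kern T ε (u x) * ψ x * ‖gradient u x‖ := by
    refine integral_mono hFint hIint fun x => mul_le_mul_of_nonneg_left ?_ (hkψ x)
    rw [← inner_gradient_left]
    simpa [hν] using real_inner_le_norm (gradient u x) ν
  have hIJ : ∫ x, kern T ε (u x) * ψ x * ‖gradient u x‖ ≤ (1 + τ) / (1 - τ) * ∫ x, F x := by
    rw [← integral_const_mul]
    refine integral_mono hIint (hFint.const_mul _) fun x => ?_
    by_cases hx : x ∈ ball x₀ (R / 4)
    · obtain ⟨h1, h2⟩ := hder x (ball_subset_ball (by linarith) hx)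
      have h3 : ‖gradient u x‖ ≤ (1 + τ) / (1 - τ) * fderiv ℝ u x ν := by
        refine h2.trans ?_
        rw [div_mul_eq_mul_div, le_div_iff₀ hτ3]
        nlinarith
      calc _ ≤ kern T ε (u x) * ψ x * ((1 + τ) / (1 - τ) * fderiv ℝ u x ν) :=
            mul_le_mul_of_nonneg_left h3 (hkψ x)
        _ = _ := by simp only [hF]; ring
    · simp [hF, hψzero x hx]
  have hJprod : ∫ x, F x = ∫ y, ∫ s, F (Ψ (y, s)) := by
    rw [← hΨm.integral_comp Ψ.measurableEmbedding, integral_prod]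
    exact (hΨm.integrable_comp_emb Ψ.measurableEmbedding).2 hFint
  have hinnint : Integrable fun y => ∫ s, F (Ψ (y, s)) :=
    ((hΨm.integrable_comp_emb Ψ.measurableEmbedding).2 hFint).integral_prod_left
  have hJB : ∫ x, F x = ∫ y in B, ∫ s, F (Ψ (y, s)) := by
    rw [hJprod, setIntegral_eq_integral_of_forall_compl_eq_zero]
    intro y hy
    rw [hBmem, not_lt] at hy
    have : ∀ s, F (Ψ (y, s)) = 0 := by
      intro s
      have h0 : ψ (Ψ (y, s)) = 0 := by
        refine hψzero _ fun hb => ?_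
        rw [hΨ, mem_ball, dist_eq_norm, add_sub_cancel_left] at hb
        have := norm_le_norm_add_smul_of_orthogonal hν y s
        simp only at hb
        linarith
      simp [hF, h0]
    simp [this]
  have hinner : ∀ y ∈ B, |(∫ s, F (Ψ (y, s))) - ψ (Γ y)| ≤ e1 := by
    intro y hy
    have hy' := (hBmem y).1 hy
    have hsupp : Function.support (fun s => F (Ψ (y, s))) ⊆ Ioc (-(R / 2)) (R / 2) := by
      intro s hs
      by_contra hcon
      apply hs
      have h0 : ψ (Ψ (y, s)) = 0 := by
        refine hψzero _ fun hb => hcon ?_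
        rw [hΨ, mem_ball, dist_eq_norm, add_sub_cancel_left] at hb
        have := abs_le_norm_add_smul_of_orthogonal hν y s
        have h2 := abs_lt.1 (this.trans_lt hb)
        constructor <;> linarith [h2.1, h2.2]
      simp [hF, h0]
    rw [← intervalIntegral.integral_eq_integral_of_support_subset hsupp]
    have hmap : MapsTo (fun s : ℝ => x₀ + ((y : E) + s • ν)) (Icc (-(R / 2)) (R / 2)) V :=
      fun s hs => hball (hinball y s hy' (abs_le.2 hs))
    have hcp : Continuous (fun s : ℝ => x₀ + ((y : E) + s • ν)) := by fun_prop
    simp only [hF, hΨ]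
    refine abs_integral_kern_sub_le (g := fun s => u (x₀ + ((y : E) + s • ν)))
      (g' := fun s => fderiv ℝ u (x₀ + ((y : E) + s • ν)) ν)
      (ρ := fun s => ψ (x₀ + ((y : E) + s • ν))) (by positivity) hε0 ?_ ?_ ?_ ?_ ?_ ?_ ?_
    · intro s hs
      have h1 : DifferentiableAt ℝ u (x₀ + ((y : E) + s • ν)) :=
        (hu.contDiffAt (hV.mem_nhds (hmap hs))).differentiableAt (by simp)
      have h2 : HasDerivAt (fun s : ℝ => x₀ + ((y : E) + s • ν)) ν s := by
        simpa using (((hasDerivAt_id s).smul_const ν).const_add (y : E)).const_add x₀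
      exact h1.hasFDerivAt.comp_hasDerivAt s h2
    · exact hfdc.comp hcp.continuousOn hmap
    · exact (hψ.comp hcp).continuousOn
    · intro s hs
      have := (hder _ (hinball y s hy' (abs_le.2 hs))).1
      exact le_trans (by positivity) this
    · have h1 := (hh y hy').2.2 (-(R / 2)) (by rw [abs_neg, abs_of_pos (by positivity)])
      have h2 := abs_lt.1 (hhR2 y hy')
      have h3 := h1.2 h2.1.le
      have : a * (1 - τ) * (-(R / 2) - h y) ≤ 0 :=
        mul_nonpos_of_nonneg_of_nonpos haτ.le (by linarith [h2.1])
      linarith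
    · have h1 := (hh y hy').2.2 (R / 2) (by rw [abs_of_pos (by positivity)])
      have h2 := abs_lt.1 (hhR2 y hy')
      have h3 := h1.1 h2.2.le
      have h4 := (abs_le.1 (hhR y hy')).2
      have h5 : a * (3 / 4) * (R / 6) ≤ a * (1 - τ) * (R / 2 - h y) := by
        gcongr <;> linarith
      linarith
    · intro s hs hsl hsr
      have h1 := (hh y hy').2.2 s (abs_le.2 hs)
      have h2 : h y < s := by
        by_contra hcon
        have h3 := h1.2 (not_lt.1 hcon)
        have : a * (1 - τ) * (s - h y) ≤ 0 :=
          mul_nonpos_of_nonneg_of_nonpos haτ.le (by linarith)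
        linarith
      have h3 := h1.1 h2.le
      have h4 : s - h y < δ := by
        by_contra hcon
        have := mul_le_mul_of_nonneg_left (not_lt.1 hcon) haτ.le
        linarith
      have h5 : dist (x₀ + ((y : E) + s • ν)) (Γ y) < δ := by
        rw [dist_eq_norm, hΓ]
        simp only [add_sub_add_left_eq_sub]
        rw [← sub_smul, norm_smul, hν, mul_one, Real.norm_of_nonneg (by linarith)]
        exact h4
      exact (hδψ h5).le
  have hJρ : |(∫ x, F x) - ρ| ≤ e / 2 := by
    rw [hJB, hρdef, ← integral_sub hinnint.integrableOn hi2]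
    have := norm_setIntegral_le_of_norm_le_const (μ := volume) (s := B)
      (f := fun y => (∫ s, F (Ψ (y, s))) - ψ (Γ y)) (C := e1) measure_ball_lt_top hinner
    exact this.trans he1w
  have hq : (1 + τ) / (1 - τ) ≤ 1 + γ := by
    rw [div_le_iff₀ hτ3]
    have h1 : 0 ≤ τ * m := by positivity
    have h2 : 3 / 4 * γ ≤ (1 - τ) * γ := by gcongr; linarith
    linarith
  have hq2 : (1 + τ) / (1 - τ) ≤ 2 := by
    rw [div_le_iff₀ hτ3]; linarith
  have hq0 : 0 ≤ (1 + τ) / (1 - τ) := by positivity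
  have hpow : 1 - γ ≤ (1 - τ) ^ m := by
    have h1 := one_add_mul_le_pow (a := -τ) (by linarith) m
    rw [← sub_eq_add_neg] at h1
    linarith
  have hSρ : (1 - γ) * S ≤ ρ := by
    have hS0 : 0 ≤ S := hρ0.trans hi3
    calc (1 - γ) * S ≤ (1 - τ) ^ m * S := by gcongr
      _ ≤ (1 - τ) ^ m * (((1 - τ)⁻¹) ^ m * ρ) := by gcongr; exact hi4
      _ = ρ := by rw [← mul_assoc, ← mul_pow, mul_inv_cancel₀ hτ3.ne', one_pow, one_mul]
  have hS0 : 0 ≤ S := hρ0.trans hi3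
  obtain ⟨hJ1, hJ2⟩ := abs_le.1 hJρ
  rw [abs_le]
  constructor
  · linarith
  · have h1 : (1 + τ) / (1 - τ) * ∫ x, F x ≤ (1 + τ) / (1 - τ) * (ρ + e / 2) := by
      gcongr; linarith
    have h2 : (1 + τ) / (1 - τ) * ρ ≤ (1 + γ) * S := by gcongr
    have h3 : (1 + τ) / (1 - τ) * (e / 2) ≤ 2 * (e / 2) := by gcongr
    linarith

end Surface

section Surface

variable {E : Type*} [NormedAddCommGroup E] [InnerProductSpace ℝ E] [FiniteDimensional ℝ E]
  [MeasurableSpace E] [BorelSpace E]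

lemma integrable_kern_mul {V : Set E} (hV : IsOpen V) {u : E → ℝ} (hu : ContDiffOn ℝ 1 u V)
    {ψ : E → ℝ} (hψ : Continuous ψ) (hψc : HasCompactSupport ψ) (hψV : tsupport ψ ⊆ V)
    (T ε : ℝ) : Integrable (fun x => kern T ε (u x) * ψ x * ‖gradient u x‖) := by
  have h1 := continuous_mul_of_tsupport_subset hV
    (((kern_continuous T ε).comp_continuousOn hu.continuousOn).mul
      (continuousOn_gradient hV hu).norm) hψ hψV
  have h2 : (fun x => kern T ε (u x) * ψ x * ‖gradient u x‖) =
      fun x => (kern T ε (u x) * ‖gradient u x‖) * ψ x := by ext x; ring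
  rw [h2]
  exact h1.integrable_of_hasCompactSupport hψc.mul_left

/-- Local coarea estimate at a point which is either regular or off the level set. -/
lemma exists_local_coarea' {V : Set E} (hV : IsOpen V) {u : E → ℝ} (hu : ContDiffOn ℝ 1 u V)
    {m : ℕ} (hm : Module.finrank ℝ E = m + 1) {T : ℝ} {x₀ : E} (hx₀ : x₀ ∈ V)
    (hg : u x₀ = T → gradient u x₀ ≠ 0) {γ : ℝ} (hγ : 0 < γ) :
    ∃ r > 0, ball x₀ r ⊆ V ∧ ∀ ψ : E → ℝ, Continuous ψ → (∀ x, 0 ≤ ψ x) →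
      tsupport ψ ⊆ ball x₀ r → IntegrableOn ψ (V ∩ {x | u x = T}) μHE[m] ∧
        ∀ e > 0, ∀ᶠ ε in 𝓝[>] (0 : ℝ),
          |(∫ x, kern T ε (u x) * ψ x * ‖gradient u x‖) -
            ∫ x in V ∩ {x | u x = T}, ψ x ∂μHE[m]| ≤
            γ * (∫ x in V ∩ {x | u x = T}, ψ x ∂μHE[m]) + e := by
  by_cases hT : u x₀ = T
  · subst hT
    exact exists_local_coarea hV hu hm hx₀ (hg rfl) hγ
  set η := |u x₀ - T| with hη
  have hη0 : 0 < η := abs_pos.2 (sub_ne_zero.2 hT)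
  have huc : ContinuousAt u x₀ := hu.continuousOn.continuousAt (hV.mem_nhds hx₀)
  have hnear : ∀ᶠ x in 𝓝 x₀, |u x - u x₀| < η / 2 := by
    simpa [Real.dist_eq] using Metric.tendsto_nhds.1 huc (η / 2) (by positivity)
  obtain ⟨r, hr, hball⟩ := Metric.eventually_nhds_iff_ball.1 (hnear.and (hV.mem_nhds hx₀))
  have hfar : ∀ x ∈ ball x₀ r, η / 2 < |u x - T| := by
    intro x hx
    have h1 := (hball x hx).1
    have h2 := abs_sub_abs_le_abs_sub (u x₀ - T) (u x - T)
    have h3 : u x₀ - T - (u x - T) = -(u x - u x₀) := by ring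
    rw [h3, abs_neg, ← hη] at h2
    linarith
  refine ⟨r, hr, fun x hx => (hball x hx).2, fun ψ hψ hψ0 hψs => ?_⟩
  have hψzero : ∀ x, x ∉ ball x₀ r → ψ x = 0 := fun x hx =>
    image_eq_zero_of_notMem_tsupport fun hx' => hx (hψs hx')
  have hz : ∀ x ∈ V ∩ {x | u x = T}, ψ x = 0 := by
    intro x hx
    refine hψzero x fun hb => ?_
    have := hfar x hb
    rw [hx.2, sub_self, abs_zero] at this
    linarith
  have hS : ∫ x in V ∩ {x | u x = T}, ψ x ∂μHE[m] = 0 := by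
    rw [setIntegral_congr_fun (measurableSet_inter_level hV hu.continuousOn T)
      (g := fun _ => (0 : ℝ)) hz]
    simp
  refine ⟨?_, fun e he => ?_⟩
  · refine (integrableOn_zero (s := V ∩ {x | u x = T})).congr_fun (fun x hx => (hz x hx).symm)
      (measurableSet_inter_level hV hu.continuousOn T)
  · filter_upwards [self_mem_nhdsWithin, mem_nhdsWithin_of_mem_nhds
      (Iio_mem_nhds (show 0 < η / 4 by positivity))] with ε hε0 hε1
    simp only [mem_Ioi, mem_Iio] at hε0 hε1
    have : ∀ x, kern T ε (u x) * ψ x * ‖gradient u x‖ = 0 := by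
      intro x
      by_cases hb : x ∈ ball x₀ r
      · have h1 := hfar x hb
        rcases lt_abs.1 h1 with h2 | h2
        · rw [kern_right hε0 (by linarith)]; simp
        · rw [kern_left hε0 (by linarith)]; simp
      · rw [hψzero x hb]; simp
    simp only [this, integral_zero, hS]
    simpa using he.le

lemma tendsto_coarea_of_nonneg {V : Set E} (hV : IsOpen V) {u : E → ℝ}
    (hu : ContDiffOn ℝ 1 u V) {m : ℕ} (hm : Module.finrank ℝ E = m + 1) {T : ℝ} {ψ : E → ℝ}
    (hψ : Continuous ψ) (hψc : HasCompactSupport ψ) (hψV : tsupport ψ ⊆ V) (hψ0 : ∀ x, 0 ≤ ψ x)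
    (hreg : ∀ x ∈ tsupport ψ, u x = T → gradient u x ≠ 0) :
    IntegrableOn ψ (V ∩ {x | u x = T}) μHE[m] ∧
      Tendsto (fun ε => ∫ x, kern T ε (u x) * ψ x * ‖gradient u x‖) (𝓝[>] (0 : ℝ))
        (𝓝 (∫ x in V ∩ {x | u x = T}, ψ x ∂μHE[m])) := by
  have key : ∀ γ > 0, IntegrableOn ψ (V ∩ {x | u x = T}) μHE[m] ∧
      ∀ e > 0, ∀ᶠ ε in 𝓝[>] (0 : ℝ),
        |(∫ x, kern T ε (u x) * ψ x * ‖gradient u x‖) -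
          ∫ x in V ∩ {x | u x = T}, ψ x ∂μHE[m]| ≤
          γ * (∫ x in V ∩ {x | u x = T}, ψ x ∂μHE[m]) + e := by
    intro γ hγ
    choose! r hr hrV hloc using fun x (hx : x ∈ tsupport ψ) =>
      exists_local_coarea' hV hu hm (hψV hx) (hreg x hx) hγ
    obtain ⟨t, ht, hcov⟩ := IsCompact.elim_nhds_subcover hψc (fun x => ball x (r x))
      (fun x hx => ball_mem_nhds x (hr x hx))
    obtain ⟨f, hfs, hfsum, hf01, hfc⟩ := exists_continuous_sum_one_of_isOpen_isCompact
      (s := fun i : Fin t.card => ball (t.equivFin.symm i : E) (r (t.equivFin.symm i)))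
      (fun i => isOpen_ball) hψc (by
        intro x hx
        obtain ⟨y, hy, hxy⟩ := mem_iUnion₂.1 (hcov hx)
        exact mem_iUnion.2 ⟨t.equivFin ⟨y, hy⟩, by simpa using hxy⟩)
    have hsum : ∀ x, ψ x = ∑ i, f i x * ψ x := by
      intro x
      rw [← Finset.sum_mul]
      by_cases hx : x ∈ tsupport ψ
      · have := hfsum hx
        simp only [Finset.sum_apply, Pi.one_apply] at this
        rw [this, one_mul]
      · rw [image_eq_zero_of_notMem_tsupport hx, mul_zero]
    have hfi := fun i : Fin t.card => hloc _ (ht _ (t.equivFin.symm i).2)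
      (fun x => f i x * ψ x) ((f i).continuous.mul hψ)
      (fun x => mul_nonneg (hf01 i x).1 (hψ0 x))
      ((closure_mono (Function.support_mul_subset_left _ _)).trans (hfs i))
    have hfiV : ∀ i, tsupport (fun x => f i x * ψ x) ⊆ V := fun i =>
      (closure_mono (Function.support_mul_subset_right _ _)).trans hψV
    have hfiI : ∀ i ε, Integrable
        (fun x => kern T ε (u x) * (f i x * ψ x) * ‖gradient u x‖) := fun i ε =>
      integrable_kern_mul hV hu ((f i).continuous.mul hψ) hψc.mul_left (hfiV i) T ε
    have hint : IntegrableOn ψ (V ∩ {x | u x = T}) μHE[m] := by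
      have : ψ = fun x => ∑ i, f i x * ψ x := funext hsum
      rw [this]
      exact integrable_finsetSum _ fun i _ => (hfi i).1
    have hS : ∫ x in V ∩ {x | u x = T}, ψ x ∂μHE[m] =
        ∑ i, ∫ x in V ∩ {x | u x = T}, f i x * ψ x ∂μHE[m] := by
      rw [← integral_finsetSum _ fun i _ => (hfi i).1]
      exact integral_congr_ae (ae_of_all _ hsum)
    have hI : ∀ ε, ∫ x, kern T ε (u x) * ψ x * ‖gradient u x‖ =
        ∑ i, ∫ x, kern T ε (u x) * (f i x * ψ x) * ‖gradient u x‖ := by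
      intro ε
      rw [← integral_finsetSum _ fun i _ => hfiI i ε]
      refine integral_congr_ae (ae_of_all _ fun x => ?_)
      simp only
      rw [← Finset.sum_mul, ← Finset.mul_sum, ← hsum]
    refine ⟨hint, fun e he => ?_⟩
    have hN : (0 : ℝ) < t.card + 1 := Nat.cast_add_one_pos _
    have hev : ∀ᶠ ε in 𝓝[>] (0 : ℝ), ∀ i : Fin t.card, _ :=
      eventually_all.2 fun i => (hfi i).2 (e / (t.card + 1)) (div_pos he hN)
    filter_upwards [hev] with ε hε
    rw [hI, hS, ← Finset.sum_sub_distrib, Finset.mul_sum]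
    refine (Finset.abs_sum_le_sum_abs _ _).trans ((Finset.sum_le_sum fun i _ => hε i).trans ?_)
    rw [Finset.sum_add_distrib]
    simp only [Finset.sum_const, Finset.card_univ, Fintype.card_fin, nsmul_eq_mul]
    gcongr
    rw [mul_div_assoc', div_le_iff₀ hN]
    nlinarith
  refine ⟨(key 1 one_pos).1, ?_⟩
  set S := ∫ x in V ∩ {x | u x = T}, ψ x ∂μHE[m] with hS
  have hS0 : 0 ≤ S := integral_nonneg hψ0
  refine Metric.tendsto_nhds.2 fun e he => ?_
  filter_upwards [(key (e / (4 * (S + 1))) (by positivity)).2 (e / 4) (by positivity)] with ε hε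
  rw [Real.dist_eq]
  refine hε.trans_lt ?_
  have : e / (4 * (S + 1)) * S ≤ e / 4 := by
    rw [div_mul_eq_mul_div, div_le_div_iff₀ (by positivity) (by norm_num)]
    nlinarith
  linarith

/-- The coarea formula at a regular level, as a limit of integrals over thin layers. -/
lemma tendsto_coarea {V : Set E} (hV : IsOpen V) {u : E → ℝ}
    (hu : ContDiffOn ℝ 1 u V) {m : ℕ} (hm : Module.finrank ℝ E = m + 1) {T : ℝ} {ψ : E → ℝ}
    (hψ : Continuous ψ) (hψc : HasCompactSupport ψ) (hψV : tsupport ψ ⊆ V)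
    (hreg : ∀ x ∈ tsupport ψ, u x = T → gradient u x ≠ 0) :
    IntegrableOn ψ (V ∩ {x | u x = T}) μHE[m] ∧
      Tendsto (fun ε => ∫ x, kern T ε (u x) * ψ x * ‖gradient u x‖) (𝓝[>] (0 : ℝ))
        (𝓝 (∫ x in V ∩ {x | u x = T}, ψ x ∂μHE[m])) := by
  have hsubp : Function.support (fun x => max (ψ x) 0) ⊆ Function.support ψ := by
    intro x hx h0; simp [h0] at hx
  have hsubm : Function.support (fun x => max (-ψ x) 0) ⊆ Function.support ψ := by
    intro x hx h0; simp [h0] at hx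
  have hcp : Continuous fun x => max (ψ x) 0 := hψ.max continuous_const
  have hcm : Continuous fun x => max (-ψ x) 0 := hψ.neg.max continuous_const
  have hsp : HasCompactSupport fun x => max (ψ x) 0 := hψc.mono hsubp
  have hsm : HasCompactSupport fun x => max (-ψ x) 0 := hψc.mono hsubm
  have hVp := (closure_mono hsubp).trans hψV
  have hVm := (closure_mono hsubm).trans hψV
  obtain ⟨ip, tp⟩ := tendsto_coarea_of_nonneg hV hu hm hcp hsp hVp (fun x => le_max_right _ _)
    (fun x hx => hreg x (closure_mono hsubp hx))
  obtain ⟨im, tm⟩ := tendsto_coarea_of_nonneg hV hu hm hcm hsm hVm (fun x => le_max_right _ _)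
    (fun x hx => hreg x (closure_mono hsubm hx))
  have hdec : ∀ x, ψ x = max (ψ x) 0 - max (-ψ x) 0 := fun x => by
    rcases le_total 0 (ψ x) with h | h
    · rw [max_eq_left h, max_eq_right (by linarith), sub_zero]
    · rw [max_eq_right h, max_eq_left (by linarith)]; ring
  have hint : IntegrableOn ψ (V ∩ {x | u x = T}) μHE[m] := by
    rw [show ψ = fun x => max (ψ x) 0 - max (-ψ x) 0 from funext hdec]
    exact ip.sub im
  refine ⟨hint, ?_⟩
  have hS : ∫ x in V ∩ {x | u x = T}, ψ x ∂μHE[m] =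
      (∫ x in V ∩ {x | u x = T}, max (ψ x) 0 ∂μHE[m]) -
        ∫ x in V ∩ {x | u x = T}, max (-ψ x) 0 ∂μHE[m] := by
    rw [← integral_sub ip im]
    exact integral_congr_ae (ae_of_all _ hdec)
  rw [hS]
  refine (tp.sub tm).congr fun ε => ?_
  rw [← integral_sub (integrable_kern_mul hV hu hcp hsp hVp T ε)
    (integrable_kern_mul hV hu hcm hsm hVm T ε)]
  refine integral_congr_ae (ae_of_all _ fun x => ?_)
  simp only
  conv_rhs => rw [hdec x]
  ring

end Surface

section FluxIdentity

variable {E : Type*} [NormedAddCommGroup E] [InnerProductSpace ℝ E]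

lemma contDiff_indicator_of_isCompact {O K : Set E} (hO : IsOpen O) (hK : IsCompact K)
    (hKO : K ⊆ O) {f : E → ℝ} (hf : ContDiffOn ℝ 1 f O) (h0 : ∀ x ∈ O, x ∉ K → f x = 0) :
    ContDiff ℝ 1 (O.indicator f) := by
  have hz : ∀ x ∉ K, O.indicator f x = 0 := fun x hx => by
    by_cases hxO : x ∈ O
    · rw [indicator_of_mem hxO, h0 x hxO hx]
    · exact indicator_of_notMem hxO f
  refine contDiff_iff_contDiffAt.2 fun x => ?_
  by_cases hxO : x ∈ O
  · refine (hf.contDiffAt (hO.mem_nhds hxO)).congr_of_eventuallyEq ?_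
    filter_upwards [hO.mem_nhds hxO] with y hy using indicator_of_mem hy f
  · refine (contDiffAt_const (c := (0 : ℝ))).congr_of_eventuallyEq ?_
    filter_upwards [hK.isClosed.isOpen_compl.mem_nhds fun h => hxO (hKO h)] with y hy using hz y hy

variable [FiniteDimensional ℝ E] [MeasurableSpace E] [BorelSpace E]

lemma integral_fderiv_eq_zero_of_isCompact {O K : Set E} (hO : IsOpen O) (hK : IsCompact K)
    (hKO : K ⊆ O) {f : E → ℝ} (hf : ContDiffOn ℝ 1 f O) (h0 : ∀ x ∈ O, x ∉ K → f x = 0) (v : E) :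
    IntegrableOn (fun x => fderiv ℝ f x v) O ∧ ∫ x in O, fderiv ℝ f x v = 0 := by
  have hF := contDiff_indicator_of_isCompact hO hK hKO hf h0
  set F := O.indicator f
  have hz : ∀ x ∉ K, F x = 0 := fun x hx => by
    by_cases hxO : x ∈ O
    · exact (indicator_of_mem hxO f).trans (h0 x hxO hx)
    · exact indicator_of_notMem hxO f
  have hFc : HasCompactSupport F := HasCompactSupport.intro hK hz
  have hd : ∀ x ∈ O, fderiv ℝ F x v = fderiv ℝ f x v := fun x hx => by
    have : F =ᶠ[𝓝 x] f := by
      filter_upwards [hO.mem_nhds hx] with y hy using indicator_of_mem hy f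
    rw [this.fderiv_eq]
  have hd0 : ∀ x ∉ O, fderiv ℝ F x v = 0 := fun x hx => by
    have : F =ᶠ[𝓝 x] fun _ => (0 : ℝ) := by
      filter_upwards [hK.isClosed.isOpen_compl.mem_nhds fun h => hx (hKO h)] with y hy
        using hz y hy
    rw [this.fderiv_eq]; simp
  have hi : Integrable (fun x => fderiv ℝ F x v) := by
    refine Continuous.integrable_of_hasCompactSupport ?_ ?_
    · exact (hF.continuous_fderiv one_ne_zero).clm_apply continuous_const
    · exact hFc.fderiv_apply ℝ v
  refine ⟨hi.integrableOn.congr_fun hd hO.measurableSet, ?_⟩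
  rw [← setIntegral_congr_fun hO.measurableSet hd,
    setIntegral_eq_integral_of_forall_compl_eq_zero hd0]
  have := integral_mul_fderiv_eq_neg_fderiv_mul_of_integrable (𝕜 := ℝ) (μ := (volume : Measure E))
    (f := fun _ : E => (1 : ℝ)) (g := F) (v := v) (by simp) (by simpa using hi)
    (by simpa using hF.continuous.integrable_of_hasCompactSupport hFc)
    (fun x _ => differentiableAt_const (1 : ℝ))
    (fun x _ => hF.differentiable one_ne_zero x)
  simpa using this

lemma integrableOn_weight_mul {O : Set E} (hO : IsOpen O) {u : E → ℝ} (hu : ContinuousOn u O)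
    {w : ℝ → ℝ} (hw : Continuous w) {K : Set E} (hK : IsCompact K) (hKO : K ⊆ O)
    (h0 : ∀ x ∈ O, x ∉ K → w (u x) = 0) {G : E → ℝ} (hG : ContinuousOn G O) :
    IntegrableOn (fun x => w (u x) * G x) O := by
  have h1 : IntegrableOn (fun x => w (u x) * G x) K :=
    ContinuousOn.integrableOn_compact hK ((hw.comp_continuousOn (hu.mono hKO)).mul (hG.mono hKO))
  refine h1.of_forall_sdiff_eq_zero hO.measurableSet fun x hx => ?_
  rw [h0 x hx.1 hx.2, zero_mul]

/-- Integration by parts of a weighted divergence. -/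
lemma integral_weight_mul_divergence {ι : Type*} [Fintype ι] {O : Set E} (hO : IsOpen O)
    {u : E → ℝ} (hu : ContDiffOn ℝ 1 u O) {w w' : ℝ → ℝ} (hw : ContDiff ℝ 1 w)
    (hw' : ∀ t, HasDerivAt w (w' t) t)
    {K : Set E} (hK : IsCompact K) (hKO : K ⊆ O) (h0 : ∀ x ∈ O, x ∉ K → w (u x) = 0)
    (e : ι → E) {F : ι → E → ℝ} (hF : ∀ j, ContDiffOn ℝ 1 (F j) O) :
    ∫ x in O, w (u x) * ∑ j, fderiv ℝ (F j) x (e j) =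
      -∫ x in O, w' (u x) * ∑ j, F j x * fderiv ℝ u x (e j) := by
  have hdu : ∀ x ∈ O, DifferentiableAt ℝ u x := fun x hx =>
    (hu.contDiffAt (hO.mem_nhds hx)).differentiableAt one_ne_zero
  have hdF : ∀ j, ∀ x ∈ O, DifferentiableAt ℝ (F j) x := fun j x hx =>
    ((hF j).contDiffAt (hO.mem_nhds hx)).differentiableAt one_ne_zero
  have hwu : ContDiffOn ℝ 1 (fun x => w (u x)) O := hw.comp_contDiffOn hu
  have hfd : ∀ j, ∀ x ∈ O, fderiv ℝ (fun x => w (u x) * F j x) x (e j) =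
      w (u x) * fderiv ℝ (F j) x (e j) + w' (u x) * (F j x * fderiv ℝ u x (e j)) := by
    intro j x hx
    have h1 := (hw' (u x)).comp_hasFDerivAt x (hdu x hx).hasFDerivAt
    have h2 := h1.mul (hdF j x hx).hasFDerivAt
    have h3 := h2.fderiv
    simp only [Function.comp_def] at h3
    rw [show (fun x => w (u x) * F j x) = ((fun x => w (u x)) * F j) from rfl, h3]
    simp; ring
  have hib := fun j => integral_fderiv_eq_zero_of_isCompact hO hK hKO (hwu.mul (hF j))
    (fun x hx hxK => by simp [h0 x hx hxK]) (e j)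
  have hw'c : Continuous w' := by
    have : w' = deriv w := funext fun t => (hw' t).deriv.symm
    rw [this]; exact hw.continuous_deriv le_rfl
  have hdivc : ContinuousOn (fun x => ∑ j, fderiv ℝ (F j) x (e j)) O :=
    continuousOn_finsetSum _ fun j _ =>
      ((hF j).continuousOn_fderiv_of_isOpen hO le_rfl).clm_apply continuousOn_const
  have i1 := integrableOn_weight_mul hO hu.continuousOn hw.continuous hK hKO h0 hdivc
  have hsum : ∀ x ∈ O, ∑ j, fderiv ℝ (fun x => w (u x) * F j x) x (e j) =
      w (u x) * ∑ j, fderiv ℝ (F j) x (e j) + w' (u x) * ∑ j, F j x * fderiv ℝ u x (e j) := by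
    intro x hx
    rw [Finset.mul_sum, Finset.mul_sum, ← Finset.sum_add_distrib]
    exact Finset.sum_congr rfl fun j _ => hfd j x hx
  have i3 : IntegrableOn (fun x => ∑ j, fderiv ℝ (fun x => w (u x) * F j x) x (e j)) O :=
    integrable_finsetSum _ fun j _ => (hib j).1
  have i2 : IntegrableOn (fun x => w' (u x) * ∑ j, F j x * fderiv ℝ u x (e j)) O := by
    refine (i3.sub i1).congr_fun (fun x hx => ?_) hO.measurableSet
    simp only [Pi.sub_apply, hsum x hx]; ring
  have hz : ∫ x in O, ∑ j, fderiv ℝ (fun x => w (u x) * F j x) x (e j) = 0 := by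
    rw [integral_finsetSum _ fun j _ => (hib j).1]
    exact Finset.sum_eq_zero fun j _ => (hib j).2
  rw [setIntegral_congr_fun hO.measurableSet hsum, integral_add i1 i2] at hz
  linarith

end FluxIdentity

section RegularBoundary

variable {E : Type*} [NormedAddCommGroup E] [InnerProductSpace ℝ E]

lemma exists_eq_add_smul_of_norm_eq_one {ν : E} (hν : ‖ν‖ = 1) (z : E) :
    ∃ (y : (ℝ ∙ ν)ᗮ) (s : ℝ), z = y + s • ν ∧ ‖y‖ ≤ ‖z‖ ∧ |s| ≤ ‖z‖ := by
  have hmem : z - ⟪ν, z⟫_ℝ • ν ∈ (ℝ ∙ ν)ᗮ := by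
    rw [Submodule.mem_orthogonal_singleton_iff_inner_right, inner_sub_right, inner_smul_right,
      real_inner_self_eq_norm_sq, hν]
    ring
  have h : z = ((⟨_, hmem⟩ : (ℝ ∙ ν)ᗮ) : E) + ⟪ν, z⟫_ℝ • ν := by simp
  refine ⟨⟨_, hmem⟩, ⟪ν, z⟫_ℝ, h, ?_, ?_⟩
  · conv_rhs => rw [h]
    exact norm_le_norm_add_smul_of_orthogonal hν _ _
  · conv_rhs => rw [h]
    exact abs_le_norm_add_smul_of_orthogonal hν _ _

/-- Near a regular boundary point, an open set on which `u ≥ T` and whose boundary lies in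
`{u = T}` coincides with `{u > T}`. -/
lemma eventually_mem_iff_of_regular_frontier [FiniteDimensional ℝ E] {Ω V : Set E}
    (hΩ : IsOpen Ω) (hV : IsOpen V) {u : E → ℝ} (hu : ContDiffOn ℝ 1 u V) {T : ℝ}
    (hfr : ∀ x ∈ frontier Ω, u x = T) (hge : ∀ x ∈ Ω ∩ V, T ≤ u x) {x₀ : E} (hx₀ : x₀ ∈ V)
    (hx₀' : x₀ ∈ frontier Ω) (hg : gradient u x₀ ≠ 0) :
    ∀ᶠ y in 𝓝 x₀, (y ∈ Ω ↔ T < u y) ∧ (y ∈ frontier Ω ↔ u y = T) := by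
  obtain ⟨ν, R, a, h, hν, hR, ha, hRV, -, hgr, -⟩ :=
    exists_local_graph hV hu hx₀ hg (τ := 1 / 4) (by norm_num) le_rfl
  rw [hfr x₀ hx₀'] at hgr
  have hup : ∀ (y : (ℝ ∙ ν)ᗮ) (s : ℝ), ‖y‖ < R / 4 → |s| ≤ R / 2 → h y < s →
      T < u (x₀ + (y + s • ν)) := fun y s hy hs hlt => by
    have h1 := ((hgr y hy).2.2 s hs).1 hlt.le
    nlinarith [mul_pos ha (sub_pos.2 hlt)]
  have hdn : ∀ (y : (ℝ ∙ ν)ᗮ) (s : ℝ), ‖y‖ < R / 4 → |s| ≤ R / 2 → s < h y →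
      u (x₀ + (y + s • ν)) < T := fun y s hy hs hlt => by
    have h1 := ((hgr y hy).2.2 s hs).2 hlt.le
    nlinarith [mul_pos ha (sub_pos.2 hlt)]
  have hinV : ∀ (y : (ℝ ∙ ν)ᗮ) (s : ℝ), ‖y‖ < R / 4 → |s| ≤ R / 2 →
      x₀ + (y + s • ν) ∈ V := fun y s hy hs => by
    refine hRV ?_
    rw [mem_ball_iff_norm, add_sub_cancel_left]
    calc ‖(y : E) + s • ν‖ ≤ ‖(y : E)‖ + ‖s • ν‖ := norm_add_le _ _
      _ = ‖y‖ + |s| := by rw [norm_smul, hν, mul_one, Real.norm_eq_abs]; rfl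
      _ < R := by linarith
  set Up : Set E := {x | ∃ (y : (ℝ ∙ ν)ᗮ) (s : ℝ), ‖y‖ < R / 4 ∧ h y < s ∧ s ≤ R / 2 ∧
    x = x₀ + (y + s • ν)} with hUp
  have hlow : ∀ (y : (ℝ ∙ ν)ᗮ) (s : ℝ), ‖y‖ < R / 4 → h y < s → s ≤ R / 2 → |s| ≤ R / 2 :=
    fun y s hy h1 h2 => abs_le.2 ⟨by linarith [neg_le_of_abs_le (hgr y hy).1], h2⟩
  have h0R : ‖(0 : (ℝ ∙ ν)ᗮ)‖ < R / 4 := by simpa using hR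
  have hhR : ∀ y : (ℝ ∙ ν)ᗮ, ‖y‖ < R / 4 → h y < R / 2 := fun y hy => by
    linarith [le_of_abs_le (hgr y hy).1]
  have hUpc : IsPreconnected Up := by
    refine isPreconnected_of_forall (x₀ + ((0 : (ℝ ∙ ν)ᗮ) + (R / 2) • ν)) ?_
    rintro _ ⟨y, s, hy, hs1, hs2, rfl⟩
    let t1 : Set E := (fun t : ℝ => x₀ + (y + t • ν)) '' Icc s (R / 2)
    let t2 : Set E := (fun y' : (ℝ ∙ ν)ᗮ => x₀ + ((y' : E) + (R / 2) • ν)) '' ball 0 (R / 4)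
    have c1 : IsPreconnected t1 := isPreconnected_Icc.image _ (by fun_prop)
    have c2 : IsPreconnected t2 :=
      (convex_ball _ _).isPreconnected.image _ (by fun_prop)
    have hy' : y ∈ ball (0 : (ℝ ∙ ν)ᗮ) (R / 4) := by simpa using hy
    have h0' : (0 : (ℝ ∙ ν)ᗮ) ∈ ball (0 : (ℝ ∙ ν)ᗮ) (R / 4) := by simpa using hR
    refine ⟨t1 ∪ t2, union_subset ?_ ?_, Or.inr ⟨0, h0', rfl⟩,
      Or.inl ⟨s, ⟨le_rfl, hs2⟩, rfl⟩, IsPreconnected.union (x₀ + (y + (R / 2) • ν))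
        ⟨R / 2, ⟨hs2, le_rfl⟩, rfl⟩ ⟨y, hy', rfl⟩ c1 c2⟩
    · rintro _ ⟨t, ht, rfl⟩
      exact ⟨y, t, hy, hs1.trans_le ht.1, ht.2, rfl⟩
    · rintro _ ⟨y', hy', rfl⟩
      have : ‖y'‖ < R / 4 := by simpa using hy'
      exact ⟨y', R / 2, this, hhR y' this, le_rfl, rfl⟩
  have hnfr : ∀ x, u x ≠ T → x ∉ frontier Ω := fun x hx h1 => hx (hfr x h1)
  have hUpT : ∀ x ∈ Up, T < u x := by
    rintro _ ⟨y, s, hy, hs1, hs2, rfl⟩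
    exact hup y s hy (hlow y s hy hs1 hs2) hs1
  have hcov : Up ⊆ Ω ∪ (closure Ω)ᶜ := fun x hx => by
    by_cases hxc : x ∈ closure Ω
    · by_contra hxo
      refine hnfr x (hUpT x hx).ne' ?_
      rw [hΩ.frontier_eq]
      exact ⟨hxc, fun h' => hxo (Or.inl h')⟩
    · exact Or.inr hxc
  have hline : ∀ (y : (ℝ ∙ ν)ᗮ), Continuous fun t : ℝ => x₀ + ((y : E) + t • ν) := fun y => by
    fun_prop
  have hne : (Up ∩ Ω).Nonempty := by
    have hcl : x₀ ∈ closure Ω := frontier_subset_closure hx₀'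
    obtain ⟨z, hzΩ, hz⟩ := Metric.mem_closure_iff.1 hcl (R / 4) (by positivity)
    obtain ⟨y, s, hys, hy, hs⟩ := exists_eq_add_smul_of_norm_eq_one hν (z - x₀)
    rw [dist_comm, dist_eq_norm] at hz
    have hy4 : ‖y‖ < R / 4 := hy.trans_lt hz
    have hs4 : |s| < R / 4 := hs.trans_lt hz
    have hz' : z = x₀ + (y + s • ν) := by rw [← hys]; abel
    have hle : h y ≤ s := by
      by_contra hlt
      push Not at hlt
      have := hdn y s hy4 (by linarith) hlt
      rw [← hz'] at this
      exact this.not_ge (hge z ⟨hzΩ, hz' ▸ hinV y s hy4 (by linarith)⟩)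
    have hev : ∀ᶠ t in 𝓝[>] s, x₀ + ((y : E) + t • ν) ∈ Ω :=
      ((hline y).continuousAt.eventually (hΩ.mem_nhds (show x₀ + ((y : E) + s • ν) ∈ Ω from hz' ▸ hzΩ))).filter_mono
        nhdsWithin_le_nhds
    have hev2 : ∀ᶠ t in 𝓝[>] s, t < R / 2 :=
      (gt_mem_nhds (by linarith [le_of_abs_le hs4.le])).filter_mono nhdsWithin_le_nhds
    obtain ⟨t, ht1, ht2, ht3⟩ := (hev.and (hev2.and self_mem_nhdsWithin)).exists
    exact ⟨_, ⟨y, t, hy4, hle.trans_lt ht3, ht2.le, rfl⟩, ht1⟩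
  have hUpΩ : Up ⊆ Ω := hUpc.subset_left_of_subset_union hΩ isClosed_closure.isOpen_compl
    (disjoint_compl_right.mono_left subset_closure) hcov hne
  filter_upwards [Metric.ball_mem_nhds x₀ (show 0 < R / 4 by positivity)] with z hz
  rw [mem_ball_iff_norm] at hz
  obtain ⟨y, s, hys, hy, hs⟩ := exists_eq_add_smul_of_norm_eq_one hν (z - x₀)
  have hy4 : ‖y‖ < R / 4 := hy.trans_lt hz
  have hs4 : |s| < R / 4 := hs.trans_lt hz
  have hz' : z = x₀ + (y + s • ν) := by rw [← hys]; abel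
  rcases lt_trichotomy s (h y) with hlt | heq | hgt
  · have h1 := hdn y s hy4 (by linarith) hlt
    have hV' := hinV y s hy4 (by linarith)
    rw [← hz'] at h1 hV'
    refine ⟨⟨fun h2 => ?_, fun h2 => absurd h2 h1.not_gt⟩,
      ⟨fun h2 => hfr z h2, fun h2 => absurd h2 h1.ne⟩⟩
    exact absurd (hge z ⟨h2, hV'⟩) h1.not_ge
  · have h1 := (hgr y hy4).2.1
    rw [← heq, ← hz'] at h1
    have hcl : z ∈ closure Ω := by
      have ht : Tendsto (fun t : ℝ => x₀ + ((y : E) + t • ν)) (𝓝[>] s) (𝓝 z) := by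
        rw [hz']; exact (hline y).continuousAt.mono_left nhdsWithin_le_nhds
      refine mem_closure_of_tendsto ht ?_
      have hev2 : ∀ᶠ t in 𝓝[>] s, t < R / 2 :=
        (gt_mem_nhds (by linarith [le_of_abs_le hs4.le])).filter_mono nhdsWithin_le_nhds
      filter_upwards [hev2, self_mem_nhdsWithin] with t ht1 ht2
      exact hUpΩ ⟨y, t, hy4, heq ▸ ht2, ht1.le, rfl⟩
    have hno : z ∉ Ω := by
      intro hzΩ
      have hev : ∀ᶠ t in 𝓝[<] s, x₀ + ((y : E) + t • ν) ∈ Ω :=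
        ((hline y).continuousAt.eventually (hΩ.mem_nhds (show x₀ + ((y : E) + s • ν) ∈ Ω from hz' ▸ hzΩ))).filter_mono
          nhdsWithin_le_nhds
      have hev2 : ∀ᶠ t in 𝓝[<] s, -(R / 2) < t :=
        (lt_mem_nhds (by linarith [neg_le_of_abs_le hs4.le])).filter_mono nhdsWithin_le_nhds
      obtain ⟨t, ht1, ht2, ht3⟩ := (hev.and (hev2.and self_mem_nhdsWithin)).exists
      have ht3' : t < s := ht3
      have htR : |t| ≤ R / 2 := abs_le.2 ⟨ht2.le, by linarith [le_of_abs_le hs4.le]⟩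
      exact (hdn y t hy4 htR (heq ▸ ht3')).not_ge (hge _ ⟨ht1, hinV y t hy4 htR⟩)
    refine ⟨⟨fun h2 => absurd h2 hno, fun h2 => absurd h1 h2.ne'⟩,
      ⟨fun _ => h1, fun _ => ?_⟩⟩
    rw [hΩ.frontier_eq]
    exact ⟨hcl, hno⟩
  · have hmem : z ∈ Up := ⟨y, s, hy4, hgt, by linarith [le_of_abs_le hs4.le], hz'⟩
    have h1 := hUpT z hmem
    exact ⟨⟨fun _ => h1, fun _ => hUpΩ hmem⟩, ⟨fun h2 => absurd (hfr z h2) h1.ne',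
      fun h2 => absurd h2 h1.ne'⟩⟩

end RegularBoundary

section PolarPotential

variable {E : Type*} [NormedAddCommGroup E] [InnerProductSpace ℝ E]

/-- A function smooth on a neighbourhood `V` of `closure Ω \ {0}`, minimal with value `c` on the
boundary of the bounded open set `Ω`, and blowing up at the origin. -/
structure PolarPotential (Ω V : Set E) (u : E → ℝ) (c : ℝ) : Prop where
  isOpen : IsOpen Ω
  isBounded : Bornology.IsBounded Ω
  zero_mem : (0 : E) ∈ Ω
  isOpen_nhd : IsOpen V
  zero_notMem : (0 : E) ∉ V
  closure_subset : closure Ω \ {0} ⊆ V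
  contDiffOn : ContDiffOn ℝ (⊤ : ℕ∞) u V
  eq_of_mem_frontier : ∀ x ∈ frontier Ω, u x = c
  le_of_mem : ∀ x ∈ Ω \ {0}, c ≤ u x
  tendsto_zero : Tendsto u (𝓝[≠] 0) atTop

namespace PolarPotential

variable {Ω V : Set E} {u : E → ℝ} {c : ℝ} (hP : PolarPotential Ω V u c)
include hP

lemma isOpen_punctured : IsOpen (Ω \ {0}) := hP.isOpen.sdiff isClosed_singleton

lemma punctured_subset : Ω \ {0} ⊆ V :=
  (sdiff_subset_sdiff_left subset_closure).trans hP.closure_subset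

lemma frontier_subset : frontier Ω ⊆ closure Ω \ {0} := fun x hx => by
  rw [hP.isOpen.frontier_eq] at hx
  refine ⟨hx.1, ?_⟩
  rintro rfl
  exact hx.2 hP.zero_mem

lemma mem_of_lt {x : E} (hx : x ∈ closure Ω \ {0}) (h : c < u x) : x ∈ Ω := by
  by_contra hno
  refine h.ne' (hP.eq_of_mem_frontier x ?_)
  rw [hP.isOpen.frontier_eq]
  exact ⟨hx.1, hno⟩

lemma contDiffOn_one : ContDiffOn ℝ 1 u V := hP.contDiffOn.of_le (by simp)

lemma gradient_eq_zero [CompleteSpace E] {x : E} (hx : x ∈ Ω \ {0}) (h : u x = c) :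
    gradient u x = 0 := by
  have hmin : IsLocalMin u x := by
    filter_upwards [hP.isOpen_punctured.mem_nhds hx] with y hy
    rw [h]; exact hP.le_of_mem y hy
  simp [gradient, hmin.fderiv_eq_zero]

lemma isCompact_level [FiniteDimensional ℝ E] (s M : ℝ) :
    IsCompact {x | x ∈ closure Ω \ {0} ∧ s ≤ u x ∧ u x ≤ M} := by
  have hev : ∀ᶠ x in 𝓝[≠] (0 : E), M < u x := hP.tendsto_zero.eventually (eventually_gt_atTop M)
  obtain ⟨r, hr, hrM⟩ := Metric.mem_nhdsWithin_iff.1 hev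
  have hset : {x | x ∈ closure Ω \ {0} ∧ s ≤ u x ∧ u x ≤ M} =
      (closure Ω \ ball 0 r) ∩ u ⁻¹' Icc s M := by
    ext x
    constructor
    · rintro ⟨hx, h1, h2⟩
      exact ⟨⟨hx.1, fun hb => (hrM ⟨hb, hx.2⟩ : M < u x).not_ge h2⟩, h1, h2⟩
    · rintro ⟨⟨hx, hb⟩, h1, h2⟩
      refine ⟨⟨hx, ?_⟩, h1, h2⟩
      rintro rfl
      exact hb (mem_ball_self hr)
  rw [hset]
  have hsub : closure Ω \ ball 0 r ⊆ V := fun x hx => hP.closure_subset ⟨hx.1, by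
    rintro rfl
    exact hx.2 (mem_ball_self hr)⟩
  have hcl : IsClosed (closure Ω \ ball 0 r) := isClosed_closure.sdiff isOpen_ball
  have h1 : IsClosed ((closure Ω \ ball 0 r) ∩ u ⁻¹' Icc s M) :=
    (hP.contDiffOn.continuousOn.mono hsub).preimage_isClosed_of_isClosed hcl isClosed_Icc
  exact hP.isBounded.isCompact_closure.of_isClosed_subset h1 fun x hx => hx.1.1

lemma level_subset {s M : ℝ} (hs : c < s) :
    {x | x ∈ closure Ω \ {0} ∧ s ≤ u x ∧ u x ≤ M} ⊆ Ω \ {0} := fun _ hx =>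
  ⟨hP.mem_of_lt hx.1 (hs.trans_le hx.2.1), hx.1.2⟩

variable [MeasurableSpace E] [BorelSpace E]

lemma measurableSet_level (T : ℝ) : MeasurableSet {x | x ∈ closure Ω \ {0} ∧ u x = T} := by
  have : {x | x ∈ closure Ω \ {0} ∧ u x = T} = closure Ω ∩ (V ∩ {x | u x = T}) := by
    ext x
    constructor
    · rintro ⟨hx, h⟩
      exact ⟨hx.1, hP.closure_subset hx, h⟩
    · rintro ⟨hx, hV, h⟩
      refine ⟨⟨hx, ?_⟩, h⟩
      rintro rfl
      exact hP.zero_notMem hV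
  rw [this]
  exact isClosed_closure.measurableSet.inter
    (measurableSet_inter_level hP.isOpen_nhd hP.contDiffOn.continuousOn T)

/-- The integral over a thin layer above the level `T` converges to the surface integral, for
integrands vanishing near the critical points. -/
lemma tendsto_layer [FiniteDimensional ℝ E] {m : ℕ} (hm : Module.finrank ℝ E = m + 1) {T : ℝ} (hT : c ≤ T) {δ : ℝ}
    (hδ : 0 < δ) {G : E → ℝ} (hG : ContinuousOn G V)
    (hG0 : ∀ x ∈ V, ‖gradient u x‖ ≤ δ → G x = 0) :
    IntegrableOn (fun x => G x / ‖gradient u x‖) {x | x ∈ closure Ω \ {0} ∧ u x = T} μHE[m] ∧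
      Tendsto (fun ε => ∫ x in Ω \ {0}, kern T ε (u x) * G x) (𝓝[>] (0 : ℝ))
        (𝓝 (∫ x in {x | x ∈ closure Ω \ {0} ∧ u x = T}, G x / ‖gradient u x‖ ∂μHE[m])) := by
  have hVo := hP.isOpen_nhd
  have hgc : ContinuousOn (gradient u) V := continuousOn_gradient hVo hP.contDiffOn_one
  set V' : Set E := {x | x ∈ V ∧ ∀ᶠ y in 𝓝 x, (y ∈ Ω ↔ c < u y) ∧ (y ∈ frontier Ω ↔ u y = c)}
    with hV'
  have hV'o : IsOpen V' := by
    refine isOpen_iff_mem_nhds.2 fun x hx => ?_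
    filter_upwards [hVo.mem_nhds hx.1, eventually_eventually_nhds.2 hx.2] with y h1 h2
      using ⟨h1, h2⟩
  have hV'V : V' ⊆ V := fun x hx => hx.1
  set K : Set E := {x | x ∈ closure Ω \ {0} ∧ T ≤ u x ∧ u x ≤ T + 1} ∩
    (fun x => ‖gradient u x‖) ⁻¹' Ici δ with hK
  have hKc : IsCompact K := by
    have h1 := hP.isCompact_level T (T + 1)
    have h2 : IsClosed K := ContinuousOn.preimage_isClosed_of_isClosed
      (hgc.norm.mono fun x hx => hP.closure_subset hx.1) h1.isClosed isClosed_Ici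
    exact h1.of_isClosed_subset h2 inter_subset_left
  have hKV' : K ⊆ V' := by
    rintro x ⟨⟨hx, h1, h2⟩, h3⟩
    have h3' : δ ≤ ‖gradient u x‖ := h3
    have hxV := hP.closure_subset hx
    have hg0 : gradient u x ≠ 0 := norm_pos_iff.1 (hδ.trans_le h3')
    refine ⟨hxV, ?_⟩
    by_cases hxΩ : x ∈ Ω
    · have hlt : c < u x := lt_of_le_of_ne (hP.le_of_mem x ⟨hxΩ, hx.2⟩) fun h =>
        hg0 (hP.gradient_eq_zero ⟨hxΩ, hx.2⟩ h.symm)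
      have hcu : ContinuousAt u x :=
        (hP.contDiffOn.continuousOn).continuousAt (hVo.mem_nhds hxV)
      filter_upwards [hP.isOpen.mem_nhds hxΩ, hcu.eventually (lt_mem_nhds hlt)] with y hy hy'
      refine ⟨⟨fun _ => hy', fun _ => hy⟩, ⟨fun hf => ?_, fun h => absurd h hy'.ne'⟩⟩
      rw [hP.isOpen.frontier_eq] at hf
      exact absurd hy hf.2
    · refine eventually_mem_iff_of_regular_frontier hP.isOpen hVo hP.contDiffOn_one
        hP.eq_of_mem_frontier (fun y hy => hP.le_of_mem y ⟨hy.1, ?_⟩) hxV ?_ hg0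
      · rintro rfl
        exact hP.zero_notMem hy.2
      · rw [hP.isOpen.frontier_eq]
        exact ⟨hx.1, hxΩ⟩
  obtain ⟨K', hK'c, hKK', hK'V⟩ := exists_compact_between hKc hV'o hKV'
  obtain ⟨cut, hcut1, hcut0, hcutc, hcutI⟩ := exists_continuous_one_zero_of_isCompact hKc
    isOpen_interior.isClosed_compl (disjoint_compl_right_iff_subset.2 hKK')
  have hcuts : tsupport cut ⊆ V' := by
    refine (closure_minimal (fun x hx => ?_) hK'c.isClosed).trans hK'V
    by_contra hxK
    exact hx (hcut0 fun h => hxK (interior_subset h))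
  set f : E → ℝ := fun x => G x / max ‖gradient u x‖ δ with hf
  have hfc : ContinuousOn f V :=
    hG.div (hgc.norm.sup continuousOn_const) fun x _ => (lt_max_of_lt_right hδ).ne'
  have hfG : ∀ x ∈ V, f x = G x / ‖gradient u x‖ := fun x hx => by
    by_cases h : ‖gradient u x‖ ≤ δ
    · simp [hf, hG0 x hx h]
    · simp only [hf, max_eq_left (not_le.1 h).le]
  set ψ : E → ℝ := fun x => f x * cut x with hψ
  have hψc : Continuous ψ :=
    continuous_mul_of_tsupport_subset hV'o (hfc.mono hV'V) cut.continuous hcuts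
  have hψcs : HasCompactSupport ψ := hcutc.mul_left
  have hψs : tsupport ψ ⊆ V' := (tsupport_mul_subset_right).trans hcuts
  have hreg : ∀ x ∈ tsupport ψ, u x = T → gradient u x ≠ 0 := by
    intro x hx _ h0
    have hxV := hV'V (hψs hx)
    have hev : ∀ᶠ y in 𝓝 x, ‖gradient u y‖ < δ :=
      (hgc.norm.continuousAt (hVo.mem_nhds hxV)).eventually (gt_mem_nhds (by simpa [h0] using hδ))
    have : ∀ᶠ y in 𝓝 x, ψ y = 0 := by
      filter_upwards [hev, hVo.mem_nhds hxV] with y hy hyV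
      simp [hψ, hf, hG0 y hyV hy.le]
    exact (notMem_tsupport_iff_eventuallyEq.2 this) hx
  obtain ⟨hint, hlim⟩ := tendsto_coarea hV'o (hP.contDiffOn_one.mono hV'V) hm hψc hψcs hψs hreg
  have hGK : ∀ x ∈ closure Ω \ {0}, T ≤ u x → u x ≤ T + 1 → G x ≠ 0 → x ∈ K := by
    intro x hx h1 h2 h3
    refine ⟨⟨hx, h1, h2⟩, ?_⟩
    by_contra h
    exact h3 (hG0 x (hP.closure_subset hx) (not_le.1 h).le)
  have hV'u : ∀ x ∈ V', T ≤ u x → x ∈ closure Ω \ {0} := fun x hx hxT => by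
    have h := hx.2.self_of_nhds
    have h0 : x ≠ 0 := fun h => hP.zero_notMem (h ▸ hx.1)
    rcases (hT.trans hxT).lt_or_eq with hlt | heq
    · exact ⟨subset_closure (h.1.2 hlt), h0⟩
    · exact ⟨frontier_subset_closure (h.2.2 heq.symm), h0⟩
  have hψeq : ∀ x ∈ closure Ω \ {0}, T ≤ u x → u x ≤ T + 1 → ψ x = G x / ‖gradient u x‖ := by
    intro x hx h1 h2
    by_cases h3 : G x = 0
    · simp [hψ, hf, h3]
    · simp only [hψ, hcut1 (hGK x hx h1 h2 h3), Pi.one_apply, mul_one,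
        hfG x (hP.closure_subset hx)]
  set L : Set E := {x | x ∈ closure Ω \ {0} ∧ u x = T} with hL
  have hLm : MeasurableSet L := hP.measurableSet_level T
  have hsub : V' ∩ {x | u x = T} ⊆ L := fun x hx =>
    ⟨hV'u x hx.1 (le_of_eq hx.2.symm), hx.2⟩
  have hdiff : ∀ x ∈ L \ (V' ∩ {x | u x = T}), G x / ‖gradient u x‖ = 0 := by
    rintro x ⟨⟨hx, hxT⟩, hno⟩
    by_cases h3 : G x = 0
    · simp [h3]
    · exact absurd ⟨hKV' (hGK x hx hxT.ge (by linarith) h3), hxT⟩ hno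
  have hmeas' : MeasurableSet (V' ∩ {x | u x = T}) :=
    measurableSet_inter_level hV'o (hP.contDiffOn.continuousOn.mono hV'V) T
  have hcongr : ∀ x ∈ V' ∩ {x | u x = T}, ψ x = G x / ‖gradient u x‖ := fun x hx => by
    have hxT : u x = T := hx.2
    exact hψeq x (hsub hx).1 hxT.ge (by linarith)
  refine ⟨(hint.congr_fun hcongr hmeas').of_forall_sdiff_eq_zero hLm hdiff, ?_⟩
  rw [setIntegral_eq_of_subset_of_forall_sdiff_eq_zero hLm hsub hdiff,
    ← setIntegral_congr_fun hmeas' hcongr]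
  refine hlim.congr' ?_
  have hε1 : ∀ᶠ ε in 𝓝[>] (0 : ℝ), ε < 1 / 2 :=
    (gt_mem_nhds (by norm_num)).filter_mono nhdsWithin_le_nhds
  filter_upwards [hε1, self_mem_nhdsWithin] with ε hε hε0
  have hε0 : 0 < ε := hε0
  have hzero : ∀ x, kern T ε (u x) ≠ 0 → T + ε ≤ u x ∧ u x ≤ T + 2 * ε := fun x hx => by
    constructor
    · by_contra h
      exact hx (kern_left hε0 (not_le.1 h).le)
    · by_contra h
      exact hx (kern_right hε0 (not_le.1 h).le)
  have hout : ∀ x ∉ Ω \ {0}, kern T ε (u x) * ψ x * ‖gradient u x‖ = 0 := by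
    intro x hx
    by_contra h
    have hk : kern T ε (u x) ≠ 0 := fun h' => h (by simp [h'])
    have hxψ : ψ x ≠ 0 := fun h' => h (by simp [h'])
    have hxV' := hψs (subset_tsupport _ hxψ)
    have h1 := (hzero x hk).1
    have hcl := hV'u x hxV' (by linarith)
    exact hx ⟨hP.mem_of_lt hcl (by linarith), hcl.2⟩
  rw [← setIntegral_eq_integral_of_forall_compl_eq_zero hout]
  refine setIntegral_congr_fun hP.isOpen_punctured.measurableSet fun x hx => ?_
  by_cases hk : kern T ε (u x) = 0
  · simp [hk]
  · obtain ⟨h1, h2⟩ := hzero x hk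
    have hxc : x ∈ closure Ω \ {0} := ⟨subset_closure hx.1, hx.2⟩
    by_cases h0 : ‖gradient u x‖ = 0
    · have := hG0 x (hP.closure_subset hxc) (by rw [h0]; exact hδ.le)
      simp [h0, this]
    · simp only [hψeq x hxc (by linarith) (by linarith)]
      field_simp

end PolarPotential

end PolarPotential

section PartialDerivatives

variable {n : ℕ}

/-- The `i`-th partial derivative. -/
def pd (i : Fin n) (f : EuclideanSpace ℝ (Fin n) → ℝ) (x : EuclideanSpace ℝ (Fin n)) : ℝ :=
  fderiv ℝ f x (EuclideanSpace.single i 1)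

lemma pd_congr {i : Fin n} {f g : EuclideanSpace ℝ (Fin n) → ℝ} {x : EuclideanSpace ℝ (Fin n)}
    (h : f =ᶠ[𝓝 x] g) : pd i f x = pd i g x := by rw [pd, pd, h.fderiv_eq]

lemma pd_congr_of_eqOn {i : Fin n} {f g : EuclideanSpace ℝ (Fin n) → ℝ}
    {V : Set (EuclideanSpace ℝ (Fin n))} (hV : IsOpen V) (h : EqOn f g V)
    {x : EuclideanSpace ℝ (Fin n)} (hx : x ∈ V) : pd i f x = pd i g x :=
  pd_congr (h.eventuallyEq_of_mem (hV.mem_nhds hx))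

@[simp] lemma pd_const (i : Fin n) (a : ℝ) (x : EuclideanSpace ℝ (Fin n)) :
    pd i (fun _ => a) x = 0 := by simp [pd]

lemma pd_add {i : Fin n} {f g : EuclideanSpace ℝ (Fin n) → ℝ} {x : EuclideanSpace ℝ (Fin n)}
    (hf : DifferentiableAt ℝ f x) (hg : DifferentiableAt ℝ g x) :
    pd i (fun y => f y + g y) x = pd i f x + pd i g x := by
  simp [pd, fderiv_fun_add hf hg]

lemma pd_sub {i : Fin n} {f g : EuclideanSpace ℝ (Fin n) → ℝ} {x : EuclideanSpace ℝ (Fin n)}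
    (hf : DifferentiableAt ℝ f x) (hg : DifferentiableAt ℝ g x) :
    pd i (fun y => f y - g y) x = pd i f x - pd i g x := by
  simp [pd, fderiv_fun_sub hf hg]

lemma pd_mul {i : Fin n} {f g : EuclideanSpace ℝ (Fin n) → ℝ} {x : EuclideanSpace ℝ (Fin n)}
    (hf : DifferentiableAt ℝ f x) (hg : DifferentiableAt ℝ g x) :
    pd i (fun y => f y * g y) x = pd i f x * g x + f x * pd i g x := by
  simp [pd, fderiv_fun_mul hf hg]; ring

lemma pd_const_mul {i : Fin n} {f : EuclideanSpace ℝ (Fin n) → ℝ} {x : EuclideanSpace ℝ (Fin n)}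
    (a : ℝ) (hf : DifferentiableAt ℝ f x) :
    pd i (fun y => a * f y) x = a * pd i f x := by
  simp [pd, fderiv_const_mul hf]

lemma pd_sum {ι : Type*} {s : Finset ι} {i : Fin n} {f : ι → EuclideanSpace ℝ (Fin n) → ℝ}
    {x : EuclideanSpace ℝ (Fin n)} (hf : ∀ j ∈ s, DifferentiableAt ℝ (f j) x) :
    pd i (fun y => ∑ j ∈ s, f j y) x = ∑ j ∈ s, pd i (f j) x := by
  simp [pd, fderiv_fun_sum hf]

lemma pd_comp {i : Fin n} {φ : ℝ → ℝ} {φ' : ℝ} {f : EuclideanSpace ℝ (Fin n) → ℝ}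
    {x : EuclideanSpace ℝ (Fin n)} (hφ : HasDerivAt φ φ' (f x)) (hf : DifferentiableAt ℝ f x) :
    pd i (fun y => φ (f y)) x = φ' * pd i f x := by
  have h := (hφ.comp_hasFDerivAt x hf.hasFDerivAt).fderiv
  simp only [Function.comp_def] at h
  simp [pd, h]

lemma pd_coord (i j : Fin n) (x : EuclideanSpace ℝ (Fin n)) :
    pd i (fun y => y j) x = if i = j then 1 else 0 := by
  let L : EuclideanSpace ℝ (Fin n) →L[ℝ] ℝ := EuclideanSpace.proj j
  have h : HasFDerivAt (fun y : EuclideanSpace ℝ (Fin n) => y j) L x := L.hasFDerivAt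
  rw [pd, h.fderiv]
  simp [L, eq_comm]

lemma fderiv_apply_eq_sum (f : EuclideanSpace ℝ (Fin n) → ℝ) (x v : EuclideanSpace ℝ (Fin n)) :
    fderiv ℝ f x v = ∑ i, v i * pd i f x := by
  conv_lhs => rw [← (EuclideanSpace.basisFun (Fin n) ℝ).sum_repr v]
  simp [pd]

lemma contDiffOn_pd {V : Set (EuclideanSpace ℝ (Fin n))} (hV : IsOpen V)
    {f : EuclideanSpace ℝ (Fin n) → ℝ} (hf : ContDiffOn ℝ (⊤ : ℕ∞) f V) (i : Fin n) :
    ContDiffOn ℝ (⊤ : ℕ∞) (pd i f) V :=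
  (hf.fderiv_of_isOpen hV (by simp)).clm_apply contDiffOn_const

lemma pd_comm {V : Set (EuclideanSpace ℝ (Fin n))} (hV : IsOpen V)
    {f : EuclideanSpace ℝ (Fin n) → ℝ} (hf : ContDiffOn ℝ (⊤ : ℕ∞) f V)
    {x : EuclideanSpace ℝ (Fin n)} (hx : x ∈ V) (i j : Fin n) :
    pd i (pd j f) x = pd j (pd i f) x := by
  have hcd : ContDiffAt ℝ (⊤ : ℕ∞) f x := hf.contDiffAt (hV.mem_nhds hx)
  have hd : DifferentiableAt ℝ (fderiv ℝ f) x :=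
    (hcd.fderiv_right (m := 1) (by norm_cast)).differentiableAt one_ne_zero
  have h : ∀ i j : Fin n, pd i (pd j f) x =
      fderiv ℝ (fderiv ℝ f) x (EuclideanSpace.single i 1) (EuclideanSpace.single j 1) := by
    intro i j
    have := (hd.hasFDerivAt.clm_apply
      (hasFDerivAt_const (EuclideanSpace.single j (1 : ℝ)) x)).fderiv
    rw [pd, show pd j f = fun y => fderiv ℝ f y (EuclideanSpace.single j 1) from rfl, this]
    simp
  rw [h, h]
  exact (hcd.isSymmSndFDerivAt (by simp; exact WithTop.coe_le_coe.2 le_top)).eq _ _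

lemma hess2_eq_sum {V : Set (EuclideanSpace ℝ (Fin n))} (hV : IsOpen V)
    {f : EuclideanSpace ℝ (Fin n) → ℝ} (hf : ContDiffOn ℝ (⊤ : ℕ∞) f V)
    {x : EuclideanSpace ℝ (Fin n)} (hx : x ∈ V) (v w : EuclideanSpace ℝ (Fin n)) :
    hess2 f x v w = ∑ i, ∑ j, v i * w j * pd i (pd j f) x := by
  have hcd : ContDiffAt ℝ (⊤ : ℕ∞) f x := hf.contDiffAt (hV.mem_nhds hx)
  have hd : DifferentiableAt ℝ (fderiv ℝ f) x :=
    (hcd.fderiv_right (m := 1) (by norm_cast)).differentiableAt one_ne_zero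
  have h1 : hess2 f x v w = fderiv ℝ (fun y => fderiv ℝ f y w) x v := by
    have := (hd.hasFDerivAt.clm_apply (hasFDerivAt_const w x)).fderiv
    rw [this, hess2, iteratedFDeriv_two_apply]
    simp
  have h2 : (fun y => fderiv ℝ f y w) = fun y => ∑ j, w j * pd j f y := by
    ext y; exact fderiv_apply_eq_sum f y w
  have hpd : ∀ j, DifferentiableAt ℝ (pd j f) x := fun j =>
    ((contDiffOn_pd hV hf j).contDiffAt (hV.mem_nhds hx)).differentiableAt (by simp)
  rw [h1, h2, fderiv_apply_eq_sum]
  refine Finset.sum_congr rfl fun i _ => ?_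
  rw [pd_sum fun j _ => (hpd j).const_mul (w j), Finset.mul_sum]
  refine Finset.sum_congr rfl fun j _ => ?_
  rw [pd_const_mul _ (hpd j)]; ring

lemma lap_eq_sum {V : Set (EuclideanSpace ℝ (Fin n))} (hV : IsOpen V)
    {f : EuclideanSpace ℝ (Fin n) → ℝ} (hf : ContDiffOn ℝ (⊤ : ℕ∞) f V)
    {x : EuclideanSpace ℝ (Fin n)} (hx : x ∈ V) : lap f x = ∑ i, pd i (pd i f) x := by
  refine Finset.sum_congr rfl fun i _ => ?_
  rw [hess2_eq_sum hV hf hx]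
  simp

lemma inner_gradient_eq_sum (f : EuclideanSpace ℝ (Fin n) → ℝ) (x v : EuclideanSpace ℝ (Fin n)) :
    ⟪gradient f x, v⟫_ℝ = ∑ i, v i * pd i f x := by
  rw [← fderiv_apply_eq_sum]
  simp [gradient]

lemma gradient_apply (f : EuclideanSpace ℝ (Fin n) → ℝ) (x : EuclideanSpace ℝ (Fin n))
    (i : Fin n) : gradient f x i = pd i f x := by
  have := inner_gradient_eq_sum f x (EuclideanSpace.single i 1)
  rw [EuclideanSpace.inner_single_right] at this
  simpa using this

lemma norm_gradient_sq (f : EuclideanSpace ℝ (Fin n) → ℝ) (x : EuclideanSpace ℝ (Fin n)) :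
    ‖gradient f x‖ ^ 2 = ∑ i, pd i f x ^ 2 := by
  rw [EuclideanSpace.norm_sq_eq]
  simp [gradient_apply]

end PartialDerivatives

section Bochner

variable {n : ℕ}

/-- `|Du|²` in coordinates. -/
def gsq (u : EuclideanSpace ℝ (Fin n) → ℝ) (x : EuclideanSpace ℝ (Fin n)) : ℝ :=
  ∑ i, pd i u x ^ 2

/-- Half of `∂ⱼ |Du|²`. -/
def hgrad (u : EuclideanSpace ℝ (Fin n) → ℝ) (j : Fin n) (x : EuclideanSpace ℝ (Fin n)) : ℝ :=
  ∑ i, pd i u x * pd j (pd i u) x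

/-- `|Du|² u⁻ˢ`. -/
def qfun (s : ℝ) (u : EuclideanSpace ℝ (Fin n) → ℝ) (x : EuclideanSpace ℝ (Fin n)) : ℝ :=
  gsq u x * u x ^ (-s)

/-- `D²u - (n/(n-2)) Du⊗Du/u + |Du|²/((n-2)u) Id` in coordinates. -/
def defect (u : EuclideanSpace ℝ (Fin n) → ℝ) (i j : Fin n) (x : EuclideanSpace ℝ (Fin n)) : ℝ :=
  pd i (pd j u) x - n / ((n : ℝ) - 2) * (pd i u x * pd j u x) / u x +
    gsq u x / (((n : ℝ) - 2) * u x) * (if i = j then 1 else 0)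

lemma gsq_eq_norm_sq (u : EuclideanSpace ℝ (Fin n) → ℝ) (x : EuclideanSpace ℝ (Fin n)) :
    gsq u x = ‖gradient u x‖ ^ 2 := (norm_gradient_sq u x).symm

lemma gsq_nonneg (u : EuclideanSpace ℝ (Fin n) → ℝ) (x : EuclideanSpace ℝ (Fin n)) :
    0 ≤ gsq u x := Finset.sum_nonneg fun _ _ => sq_nonneg _

lemma sum_sq_defect {p : Fin n → ℝ} {h : Fin n → Fin n → ℝ} {z : ℝ} (hn : 3 ≤ n) (hz : z ≠ 0)
    (htr : ∑ i, h i i = 0) :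
    ∑ i, ∑ j, (h i j - n / ((n : ℝ) - 2) * (p i * p j) / z +
      (∑ k, p k ^ 2) / (((n : ℝ) - 2) * z) * (if i = j then 1 else 0)) ^ 2 =
      (∑ i, ∑ j, h i j ^ 2) - 2 * (n / ((n : ℝ) - 2)) / z * (∑ i, ∑ j, h i j * (p i * p j)) +
        (n / ((n : ℝ) - 2)) * (n / ((n : ℝ) - 2) + 1) / 2 / z ^ 2 * (∑ k, p k ^ 2) ^ 2 := by
  have hn2 : (n : ℝ) - 2 ≠ 0 := by
    have : (3 : ℝ) ≤ n := by exact_mod_cast hn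
    linarith
  set b : ℝ := n / ((n : ℝ) - 2) with hb
  set C : ℝ := ∑ k, p k ^ 2 with hC
  set e : ℝ := C / (((n : ℝ) - 2) * z) with he
  have key : ∀ i j, (h i j - b * (p i * p j) / z + e * (if i = j then 1 else 0)) ^ 2 =
      h i j ^ 2 - 2 * b / z * (h i j * (p i * p j)) + b ^ 2 / z ^ 2 * (p i ^ 2 * p j ^ 2) +
        (if i = j then 2 * e * h i j - 2 * b * e / z * (p i * p j) + e ^ 2 else 0) := by
    intro i j
    split_ifs <;> ring
  simp only [key, Finset.sum_add_distrib, Finset.sum_sub_distrib, Finset.sum_ite_eq,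
    Finset.mem_univ, if_true]
  simp only [← Finset.mul_sum, htr]
  have h1 : ∑ i, ∑ j, p i ^ 2 * p j ^ 2 = C ^ 2 := by
    rw [hC, sq, Finset.sum_mul_sum]
  have h1' : ∑ i, p i ^ 2 * C = C ^ 2 := by
    rw [← Finset.sum_mul, ← hC, sq]
  have h2 : ∑ i, p i * p i = C := by simp [hC, sq]
  simp only [← hC, h1', h2, Finset.sum_const, Finset.card_univ, Fintype.card_fin, nsmul_eq_mul]
  rw [he, hb]
  field_simp
  ring

variable {V : Set (EuclideanSpace ℝ (Fin n))} (hV : IsOpen V)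
  {u : EuclideanSpace ℝ (Fin n) → ℝ} (hu : ContDiffOn ℝ (⊤ : ℕ∞) u V)
include hV hu

lemma differentiableAt_of_contDiffOn {x : EuclideanSpace ℝ (Fin n)} (hx : x ∈ V) :
    DifferentiableAt ℝ u x :=
  (hu.contDiffAt (hV.mem_nhds hx)).differentiableAt (by simp)

lemma contDiffOn_gsq : ContDiffOn ℝ (⊤ : ℕ∞) (gsq u) V :=
  ContDiffOn.sum fun i _ => (contDiffOn_pd hV hu i).pow 2

lemma contDiffOn_hgrad (j : Fin n) : ContDiffOn ℝ (⊤ : ℕ∞) (hgrad u j) V :=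
  ContDiffOn.sum fun i _ => (contDiffOn_pd hV hu i).mul
    (contDiffOn_pd hV (contDiffOn_pd hV hu i) j)

lemma pd_gsq {x : EuclideanSpace ℝ (Fin n)} (hx : x ∈ V) (j : Fin n) :
    pd j (gsq u) x = 2 * hgrad u j x := by
  have hd : ∀ i, DifferentiableAt ℝ (pd i u) x := fun i =>
    differentiableAt_of_contDiffOn hV (contDiffOn_pd hV hu i) hx
  have h : gsq u = fun y => ∑ i, pd i u y * pd i u y := by
    ext y; simp [gsq, sq]
  rw [h, pd_sum (f := fun i y => pd i u y * pd i u y) fun i _ => (hd i).mul (hd i), hgrad, Finset.mul_sum]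
  refine Finset.sum_congr rfl fun i _ => ?_
  rw [pd_mul (hd i) (hd i)]; ring

lemma pd_hgrad {x : EuclideanSpace ℝ (Fin n)} (hx : x ∈ V) (j : Fin n) :
    pd j (hgrad u j) x =
      ∑ i, (pd j (pd i u) x ^ 2 + pd i u x * pd i (pd j (pd j u)) x) := by
  have hd : ∀ i, DifferentiableAt ℝ (pd i u) x := fun i =>
    differentiableAt_of_contDiffOn hV (contDiffOn_pd hV hu i) hx
  have hd2 : ∀ i, DifferentiableAt ℝ (pd j (pd i u)) x := fun i =>
    differentiableAt_of_contDiffOn hV (contDiffOn_pd hV (contDiffOn_pd hV hu i) j) hx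
  have h : hgrad u j = fun y => ∑ i, pd i u y * pd j (pd i u) y := rfl
  rw [h, pd_sum (f := fun i y => pd i u y * pd j (pd i u) y) fun i _ => (hd i).mul (hd2 i)]
  refine Finset.sum_congr rfl fun i _ => ?_
  have h3 : pd j (pd j (pd i u)) x = pd i (pd j (pd j u)) x := by
    rw [pd_congr_of_eqOn hV (fun y hy => pd_comm hV hu hy j i) hx,
      pd_comm hV (contDiffOn_pd hV hu j) hx]
  rw [pd_mul (hd i) (hd2 i), h3]; ring

variable (hpos : ∀ x ∈ V, 0 < u x)
include hpos

omit hV in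
lemma contDiffOn_rpow (s : ℝ) : ContDiffOn ℝ (⊤ : ℕ∞) (fun x => u x ^ s) V :=
  hu.rpow_const_of_ne fun x hx => (hpos x hx).ne'

lemma pd_rpow (s : ℝ) {x : EuclideanSpace ℝ (Fin n)} (hx : x ∈ V) (j : Fin n) :
    pd j (fun y => u y ^ s) x = s * u x ^ (s - 1) * pd j u x :=
  pd_comp (φ := fun t => t ^ s) (Real.hasDerivAt_rpow_const (Or.inl (hpos x hx).ne'))
    (differentiableAt_of_contDiffOn hV hu hx)

lemma contDiffOn_qfun (s : ℝ) : ContDiffOn ℝ (⊤ : ℕ∞) (qfun s u) V :=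
  (contDiffOn_gsq hV hu).mul (contDiffOn_rpow hu hpos (-s))

lemma pd_qfun (s : ℝ) {x : EuclideanSpace ℝ (Fin n)} (hx : x ∈ V) (j : Fin n) :
    pd j (qfun s u) x =
      2 * (hgrad u j x * u x ^ (-s)) - s * (gsq u x * (u x ^ (-s - 1) * pd j u x)) := by
  have h : qfun s u = fun y => gsq u y * u y ^ (-s) := rfl
  rw [h, pd_mul (differentiableAt_of_contDiffOn hV (contDiffOn_gsq hV hu) hx)
    (differentiableAt_of_contDiffOn hV (contDiffOn_rpow hu hpos (-s)) hx),
    pd_gsq hV hu hx, pd_rpow hV hu hpos (-s) hx]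
  ring

lemma sum_pd_pd_qfun (hn : 3 ≤ n) {O : Set (EuclideanSpace ℝ (Fin n))} (hO : IsOpen O)
    (hOV : O ⊆ V) (hharm : ∀ x ∈ O, lap u x = 0) {x : EuclideanSpace ℝ (Fin n)} (hx : x ∈ O) :
    ∑ j, pd j (pd j (qfun (n / ((n : ℝ) - 2)) u)) x =
      2 * u x ^ (-(n / ((n : ℝ) - 2) : ℝ)) * ∑ i, ∑ j, defect u i j x ^ 2 := by
  have hxV := hOV hx
  set b : ℝ := n / ((n : ℝ) - 2) with hb
  have htr : ∀ y ∈ O, ∑ i, pd i (pd i u) y = 0 := fun y hy => by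
    rw [← lap_eq_sum hV hu (hOV hy), hharm y hy]
  have hd1 : ∀ i, DifferentiableAt ℝ (pd i u) x := fun i =>
    differentiableAt_of_contDiffOn hV (contDiffOn_pd hV hu i) hxV
  have hd2 : ∀ i j, DifferentiableAt ℝ (pd i (pd j u)) x := fun i j =>
    differentiableAt_of_contDiffOn hV (contDiffOn_pd hV (contDiffOn_pd hV hu j) i) hxV
  have hdh : ∀ j, DifferentiableAt ℝ (hgrad u j) x := fun j =>
    differentiableAt_of_contDiffOn hV (contDiffOn_hgrad hV hu j) hxV
  have hdg := differentiableAt_of_contDiffOn hV (contDiffOn_gsq hV hu) hxV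
  have hdr : ∀ s : ℝ, DifferentiableAt ℝ (fun y => u y ^ s) x := fun s =>
    differentiableAt_of_contDiffOn hV (contDiffOn_rpow hu hpos s) hxV
  have htr3 : ∀ i, ∑ j, pd i (pd j (pd j u)) x = 0 := fun i => by
    rw [← pd_sum fun j _ => hd2 j j, pd_congr_of_eqOn hO htr hx, pd_const]
  have hz := hpos x hxV
  have hstep : ∀ j, pd j (pd j (qfun b u)) x =
      u x ^ (-b) * (2 * ∑ i, (pd j (pd i u) x ^ 2 + pd i u x * pd i (pd j (pd j u)) x) -
        4 * b / u x * (hgrad u j x * pd j u x) +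
        b * (b + 1) / u x ^ 2 * gsq u x * pd j u x ^ 2 -
        b / u x * gsq u x * pd j (pd j u) x) := by
    intro j
    rw [pd_congr_of_eqOn hV (fun y hy => pd_qfun hV hu hpos b hy j) hxV]
    have e1 : DifferentiableAt ℝ (fun y => hgrad u j y * u y ^ (-b)) x := (hdh j).mul (hdr _)
    have e2 : DifferentiableAt ℝ (fun y => u y ^ (-b - 1) * pd j u y) x := (hdr _).mul (hd1 j)
    have e3 : DifferentiableAt ℝ (fun y => gsq u y * (u y ^ (-b - 1) * pd j u y)) x := hdg.mul e2
    rw [pd_sub (e1.const_mul 2) (e3.const_mul b), pd_const_mul 2 e1, pd_const_mul b e3,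
      pd_mul (hdh j) (hdr _), pd_mul hdg e2, pd_mul (hdr _) (hd1 j),
      pd_hgrad hV hu hxV, pd_rpow hV hu hpos _ hxV, pd_rpow hV hu hpos _ hxV, pd_gsq hV hu hxV]
    have r1 : u x ^ (-b - 1) = u x ^ (-b) / u x := by
      rw [Real.rpow_sub hz, Real.rpow_one]
    have r2 : u x ^ (-b - 1 - 1) = u x ^ (-b) / u x ^ 2 := by
      rw [Real.rpow_sub hz, r1, Real.rpow_one]; field_simp
    rw [r1, r2]
    field_simp
    ring
  have hcross : ∑ j, hgrad u j x * pd j u x =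
      ∑ i, ∑ j, pd i (pd j u) x * (pd i u x * pd j u x) := by
    refine Finset.sum_congr rfl fun j _ => ?_
    rw [hgrad, Finset.sum_mul]
    exact Finset.sum_congr rfl fun i _ => by ring
  have h3 : ∑ j, ∑ i, (pd j (pd i u) x ^ 2 + pd i u x * pd i (pd j (pd j u)) x) =
      ∑ i, ∑ j, pd i (pd j u) x ^ 2 := by
    simp only [Finset.sum_add_distrib]
    rw [Finset.sum_comm (f := fun j i => pd i u x * pd i (pd j (pd j u)) x)]
    simp only [← Finset.mul_sum, htr3]
    simp
  have hW := sum_sq_defect (p := fun i => pd i u x) (h := fun i j => pd i (pd j u) x) hn hz.ne'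
    (htr x hx)
  simp only [defect, gsq]
  rw [hW, Finset.sum_congr rfl fun j _ => hstep j, ← Finset.mul_sum]
  simp only [Finset.sum_add_distrib, Finset.sum_sub_distrib, ← Finset.mul_sum] at h3 ⊢
  rw [hcross, htr x hx, ← hb]
  simp only [gsq]
  linear_combination (2 * u x ^ (-b)) * h3

omit hpos in
lemma hessId_of_defect_eq_zero (hn : 3 ≤ n) {x : EuclideanSpace ℝ (Fin n)} (hx : x ∈ V)
    (hz : u x ≠ 0) (h : ∀ i j, defect u i j x = 0) : HessId u x := by
  intro v w
  have hn2 : (n : ℝ) - 2 ≠ 0 := by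
    have : (3 : ℝ) ≤ n := by exact_mod_cast hn
    linarith
  have hij : ∀ i j, u x * pd i (pd j u) x = n / ((n : ℝ) - 2) * (pd i u x * pd j u x) -
      gsq u x / ((n : ℝ) - 2) * (if i = j then 1 else 0) := fun i j => by
    have := h i j
    rw [defect] at this
    have h1 : pd i (pd j u) x = n / ((n : ℝ) - 2) * (pd i u x * pd j u x) / u x -
      gsq u x / (((n : ℝ) - 2) * u x) * (if i = j then 1 else 0) := by linarith
    rw [h1]
    field_simp
  have hvw : ⟪v, w⟫_ℝ = ∑ i, v i * w i := by
    simp [PiLp.inner_apply, mul_comm]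
  rw [hess2_eq_sum hV hu hx, inner_gradient_eq_sum, inner_gradient_eq_sum, ← gsq_eq_norm_sq, hvw,
    Finset.sum_mul_sum, Finset.mul_sum, Finset.mul_sum, Finset.mul_sum, ← Finset.sum_sub_distrib]
  refine Finset.sum_congr rfl fun i _ => ?_
  rw [Finset.mul_sum, Finset.mul_sum]
  have : ∀ j, u x * (v i * w j * pd i (pd j u) x) =
      n / ((n : ℝ) - 2) * (v i * pd i u x * (w j * pd j u x)) -
        if i = j then gsq u x / ((n : ℝ) - 2) * (v i * w j) else 0 := fun j => by
    have := hij i j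
    split_ifs with hh
    · rw [if_pos hh] at this
      linear_combination (v i * w j) * this
    · rw [if_neg hh] at this
      linear_combination (v i * w j) * this
  simp only [this, Finset.sum_sub_distrib, Finset.sum_ite_eq, Finset.mem_univ, if_true]

lemma pd_qfun_eq_zero_of_defect (hn : 3 ≤ n) {x : EuclideanSpace ℝ (Fin n)} (hx : x ∈ V)
    (h : ∀ i j, defect u i j x = 0) (j : Fin n) :
    pd j (qfun (2 * ((n : ℝ) - 1) / ((n : ℝ) - 2)) u) x = 0 := by
  have hn2 : (n : ℝ) - 2 ≠ 0 := by
    have : (3 : ℝ) ≤ n := by exact_mod_cast hn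
    linarith
  have hz := hpos x hx
  rw [pd_qfun hV hu hpos _ hx]
  have hS : hgrad u j x = ((n : ℝ) - 1) / ((n : ℝ) - 2) * gsq u x / u x * pd j u x := by
    have h1 : ∀ i, pd i u x * pd j (pd i u) x =
        n / ((n : ℝ) - 2) / u x * pd j u x * (pd i u x ^ 2) -
          if j = i then gsq u x / (((n : ℝ) - 2) * u x) * pd i u x else 0 := fun i => by
      have := h j i
      rw [defect] at this
      split_ifs with hh
      · rw [if_pos hh] at this
        linear_combination (pd i u x) * this
      · rw [if_neg hh] at this
        linear_combination (pd i u x) * this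
    rw [hgrad]
    simp only [h1, Finset.sum_sub_distrib, ← Finset.mul_sum, Finset.sum_ite_eq, Finset.mem_univ,
      if_true]
    rw [← gsq]
    field_simp
  have r1 : ∀ s : ℝ, u x ^ (-s - 1) = u x ^ (-s) / u x := fun s => by
    rw [Real.rpow_sub hz, Real.rpow_one]
  rw [hS, r1]
  field_simp
  ring

end Bochner

section MaximumPrinciple

variable {n : ℕ}

lemma hasDerivAt_comp_line {g : EuclideanSpace ℝ (Fin n) → ℝ} {x : EuclideanSpace ℝ (Fin n)}
    {i : Fin n} {t : ℝ} (hg : DifferentiableAt ℝ g (x + t • EuclideanSpace.single i (1 : ℝ))) :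
    HasDerivAt (fun t : ℝ => g (x + t • EuclideanSpace.single i (1 : ℝ)))
      (pd i g (x + t • EuclideanSpace.single i (1 : ℝ))) t := by
  have h1 : HasDerivAt (fun t : ℝ => x + t • EuclideanSpace.single i (1 : ℝ))
      (EuclideanSpace.single i (1 : ℝ)) t := by
    simpa using ((hasDerivAt_id t).smul_const (EuclideanSpace.single i (1 : ℝ))).const_add x
  exact hg.hasFDerivAt.comp_hasDerivAt t h1

lemma pd_pd_nonneg_of_isLocalMin {V : Set (EuclideanSpace ℝ (Fin n))} (hV : IsOpen V)
    {g : EuclideanSpace ℝ (Fin n) → ℝ} (hg : ContDiffOn ℝ (⊤ : ℕ∞) g V)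
    {x : EuclideanSpace ℝ (Fin n)} (hx : x ∈ V) (hmin : IsLocalMin g x) (i : Fin n) :
    0 ≤ pd i (pd i g) x := by
  set γ : ℝ → EuclideanSpace ℝ (Fin n) := fun t => x + t • EuclideanSpace.single i (1 : ℝ) with hγ
  have hγc : Continuous γ := by fun_prop
  have hγ0 : γ 0 = x := by simp [hγ]
  have hγt : Tendsto γ (𝓝 0) (𝓝 x) := by rw [← hγ0]; exact hγc.continuousAt
  have hVt : ∀ᶠ t in 𝓝 (0 : ℝ), γ t ∈ V := hγt.eventually (hV.mem_nhds hx)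
  set φ : ℝ → ℝ := fun t => g (γ t) with hφ
  have hd1 : ∀ᶠ t in 𝓝 (0 : ℝ), deriv φ t = pd i g (γ t) := by
    filter_upwards [hVt] with t ht
    exact (hasDerivAt_comp_line (differentiableAt_of_contDiffOn hV hg ht)).deriv
  have hd2 : deriv (deriv φ) 0 = pd i (pd i g) x := by
    have hd1' : deriv φ =ᶠ[𝓝 0] fun t => pd i g (γ t) := hd1
    rw [hd1'.deriv_eq]
    have := hasDerivAt_comp_line (g := pd i g) (x := x) (i := i) (t := 0)
      (differentiableAt_of_contDiffOn hV (contDiffOn_pd hV hg i) (by simpa using hx))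
    simpa [hγ] using this.deriv
  have hmin' : IsLocalMin φ 0 := by
    have : ∀ᶠ t in 𝓝 (0 : ℝ), g x ≤ g (γ t) := hγt.eventually hmin
    filter_upwards [this] with t ht
    simpa [hφ, hγ0] using ht
  have hca : ContinuousAt φ 0 := by
    have := (hasDerivAt_comp_line (g := g) (x := x) (i := i) (t := 0)
      (differentiableAt_of_contDiffOn hV hg (by simpa using hx))).continuousAt
    exact this
  by_contra hneg
  have hmax := isLocalMax_of_deriv_deriv_neg (f := φ) (x₀ := 0) (by rw [hd2]; exact not_le.1 hneg)
    hmin'.deriv_eq_zero hca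
  have hconst : φ =ᶠ[𝓝 0] fun _ => φ 0 := by
    filter_upwards [hmin', hmax] with t h1 h2 using le_antisymm h2 h1
  have h0 : deriv φ =ᶠ[𝓝 0] fun _ => (0 : ℝ) := by
    filter_upwards [hconst.eventuallyEq_nhds] with t ht
    rw [ht.deriv_eq]; simp
  rw [← hd2, h0.deriv_eq] at hneg
  simp at hneg

/-- Weak maximum principle for harmonic functions. -/
lemma le_of_harmonic_of_le_frontier (hn : 0 < n) {D : Set (EuclideanSpace ℝ (Fin n))}
    (hD : IsOpen D) (hb : Bornology.IsBounded D) {w : EuclideanSpace ℝ (Fin n) → ℝ} {c : ℝ}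
    (hwc : ContinuousOn w (closure D)) (hw : ContDiffOn ℝ (⊤ : ℕ∞) w D)
    (hlap : ∀ x ∈ D, lap w x = 0) (hfr : ∀ x ∈ frontier D, c ≤ w x) :
    ∀ x ∈ D, c ≤ w x := by
  intro x₁ hx₁
  by_contra hlt
  push Not at hlt
  obtain ⟨R, hR⟩ := hb.closure.exists_norm_le
  set δ : ℝ := (c - w x₁) / (2 * (R ^ 2 + 1)) with hδ
  have hδ0 : 0 < δ := div_pos (by linarith) (by positivity)
  have hδR : δ * R ^ 2 < c - w x₁ := by
    rw [hδ, div_mul_eq_mul_div, div_lt_iff₀ (by positivity)]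
    nlinarith [sq_nonneg R]
  set g : EuclideanSpace ℝ (Fin n) → ℝ := fun y => w y - δ * ∑ k, y k * y k with hg
  have hnorm : ∀ y : EuclideanSpace ℝ (Fin n), ∑ k, y k * y k = ‖y‖ ^ 2 := fun y => by
    rw [EuclideanSpace.norm_sq_eq]
    simp [sq]
  have hsqc : ContDiff ℝ (⊤ : ℕ∞) fun y : EuclideanSpace ℝ (Fin n) => ∑ k, y k * y k := by
    simp only [hnorm]
    exact contDiff_norm_sq ℝ
  have hgc : ContinuousOn g (closure D) :=
    hwc.sub (continuousOn_const.mul hsqc.continuous.continuousOn)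
  obtain ⟨x₂, hx₂, hmin⟩ := hb.isCompact_closure.exists_isMinOn ⟨x₁, subset_closure hx₁⟩ hgc
  have hgx : g x₂ ≤ w x₁ := by
    refine (hmin (subset_closure hx₁)).trans ?_
    simp only [hg, hnorm]
    nlinarith [sq_nonneg ‖x₁‖]
  have hx₂D : x₂ ∈ D := by
    by_contra hno
    have h1 := hfr x₂ (by rw [hD.frontier_eq]; exact ⟨hx₂, hno⟩)
    have h2 := hR x₂ hx₂
    simp only [hg, hnorm] at hgx
    have h3 : ‖x₂‖ ^ 2 ≤ R ^ 2 := by gcongr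
    nlinarith
  have hgs : ContDiffOn ℝ (⊤ : ℕ∞) g D := hw.sub (contDiffOn_const.mul hsqc.contDiffOn)
  have hloc : IsLocalMin g x₂ := hmin.isLocalMin (mem_of_superset (hD.mem_nhds hx₂D) subset_closure)
  have hcd : ∀ (k : Fin n) (y : EuclideanSpace ℝ (Fin n)),
      DifferentiableAt ℝ (fun y : EuclideanSpace ℝ (Fin n) => y k) y := fun k y => by fun_prop
  have hpd1 : ∀ i, ∀ y ∈ D, pd i g y = pd i w y - (2 * δ) * y i := by
    intro i y hy
    have e1 : DifferentiableAt ℝ (fun y : EuclideanSpace ℝ (Fin n) => ∑ k, y k * y k) y :=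
      hsqc.contDiffAt.differentiableAt (by simp)
    rw [hg, pd_sub (differentiableAt_of_contDiffOn hD hw hy) (e1.const_mul δ), pd_const_mul δ e1,
      pd_sum (f := fun k (y : EuclideanSpace ℝ (Fin n)) => y k * y k)
        fun k _ => (hcd k y).mul (hcd k y)]
    simp only [pd_mul (hcd _ y) (hcd _ y), pd_coord, ite_mul, mul_ite, one_mul, mul_one, zero_mul,
      mul_zero, Finset.sum_add_distrib, Finset.sum_ite_eq, Finset.mem_univ, if_true]
    ring
  have hpd2 : ∀ i, pd i (pd i g) x₂ = pd i (pd i w) x₂ - 2 * δ := by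
    intro i
    rw [pd_congr_of_eqOn hD (hpd1 i) hx₂D,
      pd_sub (differentiableAt_of_contDiffOn hD (contDiffOn_pd hD hw i) hx₂D)
        ((hcd i x₂).const_mul _), pd_const_mul _ (hcd i x₂), pd_coord]
    simp
  have hsum : 0 ≤ ∑ i, pd i (pd i g) x₂ :=
    Finset.sum_nonneg fun i _ => pd_pd_nonneg_of_isLocalMin hD hgs hx₂D hloc i
  rw [Finset.sum_congr rfl fun i _ => hpd2 i, Finset.sum_sub_distrib, ← lap_eq_sum hD hw hx₂D,
    hlap x₂ hx₂D] at hsum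
  simp at hsum
  have : (0 : ℝ) < n := by exact_mod_cast hn
  nlinarith

end MaximumPrinciple

section FundamentalSolution

variable {n : ℕ}

lemma pd_norm_rpow (s : ℝ) {x : EuclideanSpace ℝ (Fin n)} (hx : x ≠ 0) (i : Fin n) :
    pd i (fun y => ‖y‖ ^ s) x = s * ‖x‖ ^ (s - 2) * x i := by
  have hx0 : 0 < ‖x‖ := norm_pos_iff.2 hx
  have hcd : ∀ (k : Fin n) (y : EuclideanSpace ℝ (Fin n)),
      DifferentiableAt ℝ (fun y : EuclideanSpace ℝ (Fin n) => y k) y := fun k y => by fun_prop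
  have hnorm : ∀ y : EuclideanSpace ℝ (Fin n), ∑ k, y k * y k = ‖y‖ ^ 2 := fun y => by
    rw [EuclideanSpace.norm_sq_eq]
    simp [sq]
  have h : (fun y : EuclideanSpace ℝ (Fin n) => ‖y‖ ^ s) =
      fun y => (∑ k, y k * y k) ^ (s / 2) := by
    ext y
    rw [hnorm, ← Real.rpow_natCast, ← Real.rpow_mul (norm_nonneg _)]
    congr 1
    push_cast; ring
  have hd : DifferentiableAt ℝ (fun y : EuclideanSpace ℝ (Fin n) => ∑ k, y k * y k) x :=
    DifferentiableAt.fun_sum fun k _ => (hcd k x).mul (hcd k x)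
  have hne : (∑ k, x k * x k) ≠ 0 := by rw [hnorm]; positivity
  rw [h, pd_comp (φ := fun t => t ^ (s / 2)) (Real.hasDerivAt_rpow_const (Or.inl hne)) hd,
    pd_sum (f := fun k (y : EuclideanSpace ℝ (Fin n)) => y k * y k)
      fun k _ => (hcd k x).mul (hcd k x), hnorm, ← Real.rpow_natCast,
    ← Real.rpow_mul (norm_nonneg _)]
  simp only [pd_mul (hcd _ x) (hcd _ x), pd_coord, ite_mul, mul_ite, one_mul, mul_one, zero_mul,
    mul_zero, Finset.sum_add_distrib, Finset.sum_ite_eq, Finset.mem_univ, if_true]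
  have : ((2 : ℕ) : ℝ) * (s / 2 - 1) = s - 2 := by push_cast; ring
  rw [this]
  ring

lemma pd_pd_norm_rpow (s : ℝ) {x : EuclideanSpace ℝ (Fin n)} (hx : x ≠ 0) (i j : Fin n) :
    pd i (pd j fun y => ‖y‖ ^ s) x =
      s * (s - 2) * ‖x‖ ^ (s - 4) * x i * x j + s * ‖x‖ ^ (s - 2) * (if i = j then 1 else 0) := by
  have hO : IsOpen {x : EuclideanSpace ℝ (Fin n) | x ≠ 0} := isOpen_ne
  have hd1 : DifferentiableAt ℝ (fun y : EuclideanSpace ℝ (Fin n) => ‖y‖ ^ (s - 2)) x :=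
    ((contDiffAt_norm ℝ hx).rpow_const_of_ne (norm_ne_zero_iff.2 hx)).differentiableAt
      (one_ne_zero)
  have hd2 : DifferentiableAt ℝ (fun y : EuclideanSpace ℝ (Fin n) => y j) x := by fun_prop
  rw [pd_congr_of_eqOn hO (fun y hy => pd_norm_rpow s hy j) hx]
  have : (fun y : EuclideanSpace ℝ (Fin n) => s * ‖y‖ ^ (s - 2) * y j) =
      fun y => s * (‖y‖ ^ (s - 2) * y j) := by ext y; ring
  have e : DifferentiableAt ℝ (fun y : EuclideanSpace ℝ (Fin n) => ‖y‖ ^ (s - 2) * y j) x :=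
    hd1.mul hd2
  rw [this, pd_const_mul _ e, pd_mul hd1 hd2, pd_norm_rpow _ hx, pd_coord]
  rw [show s - 2 - 2 = s - 4 by ring]
  ring

lemma tendsto_of_eq_on_compact {X Y ι : Type*} [TopologicalSpace X] [TopologicalSpace Y]
    {Φ : X × Y → ℝ} {K : Set X} (hK : IsCompact K) {y₀ : Y} {L : ℝ}
    (hΦ : ∀ θ ∈ K, ContinuousAt Φ (θ, y₀)) (hL : ∀ θ ∈ K, Φ (θ, y₀) = L) {l : Filter ι}
    {θ : ι → X} {y : ι → Y} (hθ : ∀ᶠ i in l, θ i ∈ K) (hy : Tendsto y l (𝓝 y₀)) :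
    Tendsto (fun i => Φ (θ i, y i)) l (𝓝 L) := by
  refine tendsto_def.2 fun s hs => ?_
  have h : ∀ᶠ y in 𝓝 y₀, ∀ θ ∈ K, Φ (θ, y) ∈ s := by
    refine hK.eventually_forall_of_forall_eventually fun θ hθK => ?_
    have h1 : Tendsto (fun z : Y × X => Φ (z.2, z.1)) (𝓝 (y₀, θ)) (𝓝 L) := by
      rw [← hL θ hθK]
      exact (hΦ θ hθK).tendsto.comp (continuous_swap.tendsto (y₀, θ))
    exact h1 hs
  filter_upwards [hθ, hy h] with i h1 h2 using h2 _ h1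

end FundamentalSolution

section Asymptotics

variable {n : ℕ}

lemma tendsto_polar_model (hn : 3 ≤ n) {k : ℝ} (hk : 0 < k) {ι : Type*} {l : Filter ι}
    {θ : ι → EuclideanSpace ℝ (Fin n)} (hθ : ∀ᶠ i in l, ‖θ i‖ = 1) {μ : ι → ℝ}
    {α : ι → Fin n → ℝ} {β : ι → Fin n → Fin n → ℝ} (hμ : Tendsto μ l (𝓝 0))
    (hα : Tendsto α l (𝓝 0)) (hβ : Tendsto β l (𝓝 0)) (a : ℝ) :
    Tendsto (fun x => (∑ i, (α x i - ((n : ℝ) - 2) * k * θ x i) ^ 2) * (k + μ x) ^ (-a)) l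
      (𝓝 ((((n : ℝ) - 2) * k) ^ 2 * k ^ (-a))) ∧
    Tendsto (fun x => 2 * (k + μ x) ^ (-(n / ((n : ℝ) - 2))) *
        (∑ j, (∑ i, (α x i - ((n : ℝ) - 2) * k * θ x i) *
          (β x j i + ((n : ℝ) - 2) * k * (n * (θ x j * θ x i) - if j = i then 1 else 0))) *
            (α x j - ((n : ℝ) - 2) * k * θ x j)) /
        (∑ i, (α x i - ((n : ℝ) - 2) * k * θ x i) ^ 2) -
        n / ((n : ℝ) - 2) * (k + μ x) ^ (-(n / ((n : ℝ) - 2)) - 1) *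
          ∑ i, (α x i - ((n : ℝ) - 2) * k * θ x i) ^ 2) l
      (𝓝 (((n : ℝ) - 2) ^ 2 * k ^ (1 - n / ((n : ℝ) - 2)))) := by
  have hN : (0 : ℝ) < (n : ℝ) - 2 := by
    have : (3 : ℝ) ≤ n := by exact_mod_cast hn
    linarith
  have hK : IsCompact (sphere (0 : EuclideanSpace ℝ (Fin n)) 1) := isCompact_sphere _ _
  have hθ' : ∀ᶠ i in l, θ i ∈ sphere (0 : EuclideanSpace ℝ (Fin n)) 1 := by simpa using hθ
  have hy : Tendsto (fun i => (μ i, α i, β i)) l (𝓝 (0, 0, 0)) :=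
    hμ.prodMk_nhds (hα.prodMk_nhds hβ)
  have hsq : ∀ ϑ ∈ sphere (0 : EuclideanSpace ℝ (Fin n)) 1, ∑ i, ϑ i * ϑ i = 1 := by
    intro ϑ hϑ
    have := EuclideanSpace.norm_sq_eq ϑ
    rw [mem_sphere_zero_iff_norm.1 hϑ] at this
    simpa [← sq] using this.symm
  have hS : ∀ ϑ ∈ sphere (0 : EuclideanSpace ℝ (Fin n)) 1,
      ∑ i, ((0 : Fin n → ℝ) i - ((n : ℝ) - 2) * k * ϑ i) ^ 2 = (((n : ℝ) - 2) * k) ^ 2 := by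
    intro ϑ hϑ
    have : ∀ i, ((0 : Fin n → ℝ) i - ((n : ℝ) - 2) * k * ϑ i) ^ 2 =
        (((n : ℝ) - 2) * k) ^ 2 * (ϑ i * ϑ i) := fun i => by simp; ring
    simp only [this, ← Finset.mul_sum, hsq ϑ hϑ, mul_one]
  have hpc : ∀ (s : ℝ) (ϑ : EuclideanSpace ℝ (Fin n)), ContinuousAt
      (fun z : EuclideanSpace ℝ (Fin n) × ℝ × (Fin n → ℝ) × (Fin n → Fin n → ℝ) =>
        (k + z.2.1) ^ s) (ϑ, 0, 0, 0) := fun s ϑ =>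
    ContinuousAt.rpow_const (by fun_prop) (Or.inl (by simpa using hk.ne'))
  have hSc : Continuous
      (fun z : EuclideanSpace ℝ (Fin n) × ℝ × (Fin n → ℝ) × (Fin n → Fin n → ℝ) =>
        ∑ i, (z.2.2.1 i - ((n : ℝ) - 2) * k * z.1 i) ^ 2) := by fun_prop
  have hBc : Continuous
      (fun z : EuclideanSpace ℝ (Fin n) × ℝ × (Fin n → ℝ) × (Fin n → Fin n → ℝ) =>
        ∑ j, (∑ i, (z.2.2.1 i - ((n : ℝ) - 2) * k * z.1 i) *
          (z.2.2.2 j i + ((n : ℝ) - 2) * k * (n * (z.1 j * z.1 i) - if j = i then 1 else 0))) *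
            (z.2.2.1 j - ((n : ℝ) - 2) * k * z.1 j)) := by fun_prop
  constructor
  · have h := tendsto_of_eq_on_compact (Φ := fun z : EuclideanSpace ℝ (Fin n) × ℝ × (Fin n → ℝ) × (Fin n → Fin n → ℝ) =>
        (∑ i, (z.2.2.1 i - ((n : ℝ) - 2) * k * z.1 i) ^ 2)
      * (k + z.2.1) ^ (-a)) hK (fun ϑ _ => hSc.continuousAt.mul (hpc _ ϑ))
      (fun ϑ hϑ => by simp only [hS ϑ hϑ, add_zero]; rfl) hθ' hy
    exact h
  · have h := tendsto_of_eq_on_compact (Φ := fun z : EuclideanSpace ℝ (Fin n) × ℝ × (Fin n → ℝ) × (Fin n → Fin n → ℝ) =>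
        2 * (k + z.2.1) ^ (-(n / ((n : ℝ) - 2))) *
        (∑ j, (∑ i, (z.2.2.1 i - ((n : ℝ) - 2) * k * z.1 i) *
          (z.2.2.2 j i + ((n : ℝ) - 2) * k * (n * (z.1 j * z.1 i) - if j = i then 1 else 0))) *
            (z.2.2.1 j - ((n : ℝ) - 2) * k * z.1 j)) /
        (∑ i, (z.2.2.1 i - ((n : ℝ) - 2) * k * z.1 i) ^ 2) -
        n / ((n : ℝ) - 2) * (k + z.2.1) ^ (-(n / ((n : ℝ) - 2)) - 1) *
          ∑ i, (z.2.2.1 i - ((n : ℝ) - 2) * k * z.1 i) ^ 2) hK (L := ((n : ℝ) - 2) ^ 2 * k ^ (1 - n / ((n : ℝ) - 2))) (fun ϑ hϑ => ?_)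
      (fun ϑ hϑ => ?_) hθ' hy
    · exact h
    · refine (((continuousAt_const.mul (hpc _ ϑ)).mul hBc.continuousAt).div hSc.continuousAt ?_).sub
        ((continuousAt_const.mul (hpc _ ϑ)).mul hSc.continuousAt)
      simp only [hS ϑ hϑ]
      positivity
    · have hB : ∑ j, (∑ i, ((0 : Fin n → ℝ) i - ((n : ℝ) - 2) * k * ϑ i) *
          ((0 : Fin n → Fin n → ℝ) j i +
            ((n : ℝ) - 2) * k * (n * (ϑ j * ϑ i) - if j = i then 1 else 0))) *
            ((0 : Fin n → ℝ) j - ((n : ℝ) - 2) * k * ϑ j) =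
          (((n : ℝ) - 2) * k) ^ 3 * (n - 1) := by
        have h1 : ∀ j i, ((0 : Fin n → ℝ) i - ((n : ℝ) - 2) * k * ϑ i) *
          ((0 : Fin n → Fin n → ℝ) j i +
            ((n : ℝ) - 2) * k * (n * (ϑ j * ϑ i) - if j = i then 1 else 0)) =
            (((n : ℝ) - 2) * k) ^ 2 * (if j = i then ϑ i else 0) -
              (((n : ℝ) - 2) * k) ^ 2 * n * ϑ j * (ϑ i * ϑ i) := by
          intro j i
          split_ifs <;> simp <;> ring
        have h2 : ∀ j, (∑ i, ((0 : Fin n → ℝ) i - ((n : ℝ) - 2) * k * ϑ i) *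
          ((0 : Fin n → Fin n → ℝ) j i +
            ((n : ℝ) - 2) * k * (n * (ϑ j * ϑ i) - if j = i then 1 else 0))) =
            (((n : ℝ) - 2) * k) ^ 2 * (1 - n) * ϑ j := by
          intro j
          simp only [h1, Finset.sum_sub_distrib, ← Finset.mul_sum, hsq ϑ hϑ, Finset.sum_ite_eq,
            Finset.mem_univ, if_true]
          ring
        have h3 : ∀ j, (((n : ℝ) - 2) * k) ^ 2 * (1 - n) * ϑ j *
            ((0 : Fin n → ℝ) j - ((n : ℝ) - 2) * k * ϑ j) =
            (((n : ℝ) - 2) * k) ^ 3 * (n - 1) * (ϑ j * ϑ j) := fun j => by simp; ring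
        simp only [h2, h3, ← Finset.mul_sum, hsq ϑ hϑ, mul_one]
      simp only [hB, hS ϑ hϑ, add_zero]
      rw [sub_eq_add_neg 1 ((n : ℝ) / (n - 2)), Real.rpow_add hk, Real.rpow_one,
        Real.rpow_sub hk, Real.rpow_one]
      field_simp
      ring

lemma tendsto_norm_rpow_mul {f : EuclideanSpace ℝ (Fin n) → ℝ} (hf : ContinuousAt f 0) {s : ℝ}
    (hs : 0 < s) : Tendsto (fun x => ‖x‖ ^ s * f x) (𝓝[≠] 0) (𝓝 0) := by
  have h1 : ContinuousAt (fun x : EuclideanSpace ℝ (Fin n) => ‖x‖ ^ s * f x) 0 :=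
    (continuous_norm.continuousAt.rpow_const (Or.inr hs.le)).mul hf
  have h2 := h1.tendsto
  simp only [norm_zero, Real.zero_rpow hs.ne', zero_mul] at h2
  exact h2.mono_left nhdsWithin_le_nhds

lemma sum_pd_qfun_mul {V : Set (EuclideanSpace ℝ (Fin n))} (hV : IsOpen V)
    {u : EuclideanSpace ℝ (Fin n) → ℝ} (hu : ContDiffOn ℝ (⊤ : ℕ∞) u V)
    (hpos : ∀ x ∈ V, 0 < u x) (s : ℝ) {x : EuclideanSpace ℝ (Fin n)} (hx : x ∈ V) :
    ∑ j, pd j (qfun s u) x * pd j u x = 2 * u x ^ (-s) * (∑ j, hgrad u j x * pd j u x) -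
      s * u x ^ (-s - 1) * gsq u x ^ 2 := by
  have h : ∀ j, pd j (qfun s u) x * pd j u x = 2 * u x ^ (-s) * (hgrad u j x * pd j u x) -
      s * u x ^ (-s - 1) * gsq u x * (pd j u x ^ 2) := fun j => by
    rw [pd_qfun hV hu hpos s hx]; ring
  simp only [h, Finset.sum_sub_distrib, ← Finset.mul_sum]
  rw [← gsq]
  ring

lemma tendsto_atTop_of_pole (hn : 3 ≤ n) {Ω : Set (EuclideanSpace ℝ (Fin n))} (hΩ : IsOpen Ω)
    (h0 : 0 ∈ Ω) {u v : EuclideanSpace ℝ (Fin n) → ℝ} {k : ℝ} (hk : 0 < k)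
    (hv : ContDiffOn ℝ (⊤ : ℕ∞) v Ω) (huv : ∀ x ∈ Ω \ {0}, u x = k * ‖x‖ ^ ((2 : ℝ) - n) + v x) :
    Tendsto u (𝓝[≠] 0) atTop := by
  have hN : (2 : ℝ) - n < 0 := by
    have : (3 : ℝ) ≤ n := by exact_mod_cast hn
    linarith
  have h1 : Tendsto (fun x : EuclideanSpace ℝ (Fin n) => k * ‖x‖ ^ ((2 : ℝ) - n)) (𝓝[≠] 0) atTop :=
    ((tendsto_rpow_neg_nhdsGT_zero hN).comp (tendsto_norm_nhdsNE_zero)).const_mul_atTop hk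
  have h2 : Tendsto v (𝓝[≠] 0) (𝓝 (v 0)) :=
    ((hv.continuousOn.continuousAt (hΩ.mem_nhds h0)).tendsto).mono_left nhdsWithin_le_nhds
  refine (h1.atTop_add h2).congr' ?_
  filter_upwards [mem_nhdsWithin_of_mem_nhds (hΩ.mem_nhds h0), self_mem_nhdsWithin] with x h1 h2
  exact (huv x ⟨h1, h2⟩).symm

lemma pole_asymptotics (hn : 3 ≤ n) {Ω : Set (EuclideanSpace ℝ (Fin n))} (hΩ : IsOpen Ω)
    (h0 : 0 ∈ Ω) {u v : EuclideanSpace ℝ (Fin n) → ℝ} {k : ℝ} (hk : 0 < k)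
    (hv : ContDiffOn ℝ (⊤ : ℕ∞) v Ω) (huv : ∀ x ∈ Ω \ {0}, u x = k * ‖x‖ ^ ((2 : ℝ) - n) + v x) :
    ∃ P₀ : ℝ, 0 < P₀ ∧
      Tendsto (qfun (2 * ((n : ℝ) - 1) / ((n : ℝ) - 2)) u) (𝓝[≠] 0) (𝓝 P₀) ∧
      Tendsto (fun x => (∑ j, pd j (qfun (n / ((n : ℝ) - 2)) u) x * pd j u x) / gsq u x)
        (𝓝[≠] 0) (𝓝 P₀) ∧
      Tendsto (gsq u) (𝓝[≠] 0) atTop := by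
  have hn3 : (3 : ℝ) ≤ n := by exact_mod_cast hn
  have hN : (0 : ℝ) < (n : ℝ) - 2 := by linarith
  have hOo : IsOpen (Ω \ {0}) := hΩ.sdiff isClosed_singleton
  have hev : ∀ᶠ x in 𝓝[≠] (0 : EuclideanSpace ℝ (Fin n)), x ∈ Ω \ {0} := by
    filter_upwards [mem_nhdsWithin_of_mem_nhds (hΩ.mem_nhds h0), self_mem_nhdsWithin] with x h1 h2
    exact ⟨h1, h2⟩
  have hvO : ContDiffOn ℝ (⊤ : ℕ∞) v (Ω \ {0}) := hv.mono sdiff_subset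
  have hrs : ContDiffOn ℝ (⊤ : ℕ∞) (fun x : EuclideanSpace ℝ (Fin n) => ‖x‖ ^ ((2 : ℝ) - n))
      (Ω \ {0}) := fun x hx => ((contDiffAt_norm ℝ hx.2).rpow_const_of_ne
        (norm_ne_zero_iff.2 hx.2)).contDiffWithinAt
  have hkrs : ContDiffOn ℝ (⊤ : ℕ∞)
      (fun x : EuclideanSpace ℝ (Fin n) => k * ‖x‖ ^ ((2 : ℝ) - n)) (Ω \ {0}) :=
    contDiffOn_const.mul hrs
  have hu : ContDiffOn ℝ (⊤ : ℕ∞) u (Ω \ {0}) :=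
    (hkrs.add hvO).congr huv
  have hd1 : ∀ j, ∀ x ∈ Ω \ {0},
      pd j u x = k * (((2 : ℝ) - n) * ‖x‖ ^ ((2 : ℝ) - n - 2) * x j) + pd j v x := by
    intro j x hx
    rw [pd_congr_of_eqOn hOo huv hx, pd_add (differentiableAt_of_contDiffOn hOo hkrs hx)
      (differentiableAt_of_contDiffOn hOo hvO hx),
      pd_const_mul _ (differentiableAt_of_contDiffOn hOo hrs hx), pd_norm_rpow _ hx.2]
  have hd2 : ∀ i j, ∀ x ∈ Ω \ {0}, pd i (pd j u) x =
      k * (((2 : ℝ) - n) * ((2 : ℝ) - n - 2) * ‖x‖ ^ ((2 : ℝ) - n - 4) * x i * x j +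
        ((2 : ℝ) - n) * ‖x‖ ^ ((2 : ℝ) - n - 2) * (if i = j then 1 else 0)) + pd i (pd j v) x := by
    intro i j x hx
    have e1 : EqOn (pd j u) (fun y => k * pd j (fun z => ‖z‖ ^ ((2 : ℝ) - n)) y + pd j v y)
        (Ω \ {0}) := fun y hy => by
      simp only [hd1 j y hy, pd_norm_rpow _ hy.2]
    have e2 := contDiffOn_pd hOo hrs j
    have e3 := contDiffOn_pd hOo hvO j
    have e4 : ContDiffOn ℝ (⊤ : ℕ∞) (fun y => k * pd j (fun z => ‖z‖ ^ ((2 : ℝ) - n)) y)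
      (Ω \ {0}) := contDiffOn_const.mul e2
    rw [pd_congr_of_eqOn hOo e1 hx, pd_add (differentiableAt_of_contDiffOn hOo e4 hx)
      (differentiableAt_of_contDiffOn hOo e3 hx),
      pd_const_mul _ (differentiableAt_of_contDiffOn hOo e2 hx), pd_pd_norm_rpow _ hx.2]
  have hcont : ∀ {f : EuclideanSpace ℝ (Fin n) → ℝ}, ContDiffOn ℝ (⊤ : ℕ∞) f Ω →
      ContinuousAt f 0 := fun hf => hf.continuousOn.continuousAt (hΩ.mem_nhds h0)
  have htop := tendsto_atTop_of_pole hn hΩ h0 hk hv huv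
  have hposev : ∀ᶠ x in 𝓝[≠] (0 : EuclideanSpace ℝ (Fin n)), 0 < u x :=
    htop.eventually (eventually_gt_atTop 0)
  set μ : EuclideanSpace ℝ (Fin n) → ℝ := fun x => ‖x‖ ^ ((n : ℝ) - 2) * v x with hμ
  set α : EuclideanSpace ℝ (Fin n) → Fin n → ℝ := fun x i => ‖x‖ ^ ((n : ℝ) - 1) * pd i v x with hα
  set β : EuclideanSpace ℝ (Fin n) → Fin n → Fin n → ℝ :=
    fun x i j => ‖x‖ ^ (n : ℝ) * pd i (pd j v) x with hβ
  set θ : EuclideanSpace ℝ (Fin n) → EuclideanSpace ℝ (Fin n) := fun x => ‖x‖⁻¹ • x with hθ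
  have hθ1 : ∀ᶠ x in 𝓝[≠] (0 : EuclideanSpace ℝ (Fin n)), ‖θ x‖ = 1 := by
    filter_upwards [self_mem_nhdsWithin] with x hx
    rw [hθ, norm_smul, norm_inv, norm_norm, inv_mul_cancel₀ (norm_ne_zero_iff.2 hx)]
  have hμ0 : Tendsto μ (𝓝[≠] 0) (𝓝 0) := tendsto_norm_rpow_mul (hcont hv) hN
  have hα0 : Tendsto α (𝓝[≠] 0) (𝓝 0) := tendsto_pi_nhds.2 fun i =>
    tendsto_norm_rpow_mul (hcont (contDiffOn_pd hΩ hv i)) (by linarith)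
  have hβ0 : Tendsto β (𝓝[≠] 0) (𝓝 0) := tendsto_pi_nhds.2 fun i => tendsto_pi_nhds.2 fun j =>
    tendsto_norm_rpow_mul (hcont (contDiffOn_pd hΩ (contDiffOn_pd hΩ hv j) i)) (by linarith)
  have ez : ∀ x ∈ Ω \ {0}, k + μ x = ‖x‖ ^ ((n : ℝ) - 2) * u x := by
    intro x hx
    have hr : 0 < ‖x‖ := norm_pos_iff.2 hx.2
    have e : ‖x‖ ^ ((n : ℝ) - 2) * ‖x‖ ^ ((2 : ℝ) - n) = 1 := by
      rw [← Real.rpow_add hr]; simp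
    rw [huv x hx, hμ]
    linear_combination (-k) * e
  have ep : ∀ x ∈ Ω \ {0}, ∀ i, α x i - ((n : ℝ) - 2) * k * θ x i =
      ‖x‖ ^ ((n : ℝ) - 1) * pd i u x := by
    intro x hx i
    have hr : 0 < ‖x‖ := norm_pos_iff.2 hx.2
    have e : ‖x‖ ^ ((n : ℝ) - 1) * ‖x‖ ^ ((2 : ℝ) - n - 2) = ‖x‖⁻¹ := by
      rw [← Real.rpow_add hr, ← Real.rpow_neg_one]; congr 1; ring
    rw [hd1 i x hx, hα, hθ]
    simp only [PiLp.smul_apply, smul_eq_mul]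
    linear_combination (-k * (2 - n) * x i) * e
  have eh : ∀ x ∈ Ω \ {0}, ∀ i j,
      β x i j + ((n : ℝ) - 2) * k * (n * (θ x i * θ x j) - if i = j then 1 else 0) =
      ‖x‖ ^ (n : ℝ) * pd i (pd j u) x := by
    intro x hx i j
    have hr : 0 < ‖x‖ := norm_pos_iff.2 hx.2
    have e1 : ‖x‖ ^ (n : ℝ) * ‖x‖ ^ ((2 : ℝ) - n - 2) = 1 := by
      rw [← Real.rpow_add hr, ← Real.rpow_zero ‖x‖]; congr 1; ring
    have e2 : ‖x‖ ^ (n : ℝ) * ‖x‖ ^ ((2 : ℝ) - n - 4) = ‖x‖⁻¹ * ‖x‖⁻¹ := by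
      rw [← Real.rpow_add hr, ← Real.rpow_neg_one, ← Real.rpow_add hr]; congr 1; ring
    rw [hd2 i j x hx, hβ, hθ]
    simp only [PiLp.smul_apply, smul_eq_mul]
    linear_combination (-k * (2 - n) * (if i = j then 1 else 0)) * e1 +
      (-k * (2 - n) * (2 - n - 2) * x i * x j) * e2
  have hS : ∀ x ∈ Ω \ {0}, ∑ i, (α x i - ((n : ℝ) - 2) * k * θ x i) ^ 2 =
      ‖x‖ ^ (2 * ((n : ℝ) - 1)) * gsq u x := by
    intro x hx
    have hr : 0 < ‖x‖ := norm_pos_iff.2 hx.2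
    have e : ‖x‖ ^ (2 * ((n : ℝ) - 1)) = (‖x‖ ^ ((n : ℝ) - 1)) ^ 2 := by
      rw [sq, ← Real.rpow_add hr]; congr 1; ring
    simp only [ep x hx, mul_pow, ← Finset.mul_sum, e, gsq]
  have hB : ∀ x ∈ Ω \ {0}, ∑ j, (∑ i, (α x i - ((n : ℝ) - 2) * k * θ x i) *
          (β x j i + ((n : ℝ) - 2) * k * (n * (θ x j * θ x i) - if j = i then 1 else 0))) *
            (α x j - ((n : ℝ) - 2) * k * θ x j) =
      ‖x‖ ^ (2 * ((n : ℝ) - 1) + n) * ∑ j, hgrad u j x * pd j u x := by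
    intro x hx
    have hr : 0 < ‖x‖ := norm_pos_iff.2 hx.2
    have e : ‖x‖ ^ (2 * ((n : ℝ) - 1) + n) =
        ‖x‖ ^ ((n : ℝ) - 1) * ‖x‖ ^ (n : ℝ) * ‖x‖ ^ ((n : ℝ) - 1) := by
      rw [← Real.rpow_add hr, ← Real.rpow_add hr]; congr 1; ring
    simp only [ep x hx, eh x hx, hgrad]
    rw [Finset.mul_sum]
    refine Finset.sum_congr rfl fun j _ => ?_
    rw [e, Finset.sum_mul, Finset.sum_mul, Finset.mul_sum]
    exact Finset.sum_congr rfl fun i _ => by ring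
  have hzp : ∀ x ∈ Ω \ {0}, 0 < u x → ∀ s : ℝ,
      (k + μ x) ^ s = ‖x‖ ^ (((n : ℝ) - 2) * s) * u x ^ s := by
    intro x hx hux s
    rw [ez x hx, Real.mul_rpow (by positivity) hux.le, ← Real.rpow_mul (norm_nonneg _)]
  refine ⟨((n : ℝ) - 2) ^ 2 * k ^ (1 - n / ((n : ℝ) - 2)), by positivity, ?_, ?_, ?_⟩
  · have h1 := (tendsto_polar_model hn hk hθ1 hμ0 hα0 hβ0 (2 * ((n : ℝ) - 1) / ((n : ℝ) - 2))).1
    have e : (((n : ℝ) - 2) * k) ^ 2 * k ^ (-(2 * ((n : ℝ) - 1) / ((n : ℝ) - 2))) =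
        ((n : ℝ) - 2) ^ 2 * k ^ (1 - n / ((n : ℝ) - 2)) := by
      have : 1 - n / ((n : ℝ) - 2) = 2 + -(2 * ((n : ℝ) - 1) / ((n : ℝ) - 2)) := by
        field_simp; ring
      rw [this, Real.rpow_add hk, Real.rpow_two]; ring
    rw [e] at h1
    refine h1.congr' ?_
    filter_upwards [hev, hposev] with x hx hux
    have hr : 0 < ‖x‖ := norm_pos_iff.2 hx.2
    rw [hS x hx, hzp x hx hux, qfun]
    have e2 : ‖x‖ ^ (2 * ((n : ℝ) - 1)) *
        ‖x‖ ^ (((n : ℝ) - 2) * -(2 * ((n : ℝ) - 1) / ((n : ℝ) - 2))) = 1 := by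
      rw [← Real.rpow_add hr, ← Real.rpow_zero ‖x‖]; congr 1; field_simp; ring
    linear_combination (gsq u x * u x ^ (-(2 * ((n : ℝ) - 1) / ((n : ℝ) - 2)))) * e2
  · have h1 := (tendsto_polar_model hn hk hθ1 hμ0 hα0 hβ0 0).2
    refine h1.congr' ?_
    have hO' : ∀ᶠ x in 𝓝[≠] (0 : EuclideanSpace ℝ (Fin n)), gsq u x ≠ 0 := by
      have h2 := (tendsto_polar_model hn hk hθ1 hμ0 hα0 hβ0 0).1
      have h3 : (((n : ℝ) - 2) * k) ^ 2 * k ^ (-0 : ℝ) ≠ 0 := by positivity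
      filter_upwards [h2.eventually_ne h3, hev] with x hx hxO h4
      rw [hS x hxO, h4] at hx
      simp at hx
    have hopos : IsOpen ((Ω \ {0}) ∩ u ⁻¹' Ioi 0) := hu.continuousOn.isOpen_inter_preimage hOo isOpen_Ioi
    filter_upwards [hev, hposev, hO'] with x hx hux hg
    have hr : 0 < ‖x‖ := norm_pos_iff.2 hx.2
    rw [sum_pd_qfun_mul hopos (hu.mono inter_subset_left) (fun y hy => hy.2) _ ⟨hx, hux⟩,
      hS x hx, hB x hx, hzp x hx hux, hzp x hx hux]
    set b : ℝ := n / ((n : ℝ) - 2) with hb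
    have e1 : ((n : ℝ) - 2) * -b = -n := by rw [hb]; field_simp
    have e2 : ((n : ℝ) - 2) * (-b - 1) = -(2 * ((n : ℝ) - 1)) := by rw [hb]; field_simp; ring
    rw [e1, e2, Real.rpow_add hr, Real.rpow_neg hr.le, Real.rpow_neg hr.le]
    have h5 : (0:ℝ) < ‖x‖ ^ (n : ℝ) := by positivity
    have h6 : (0:ℝ) < ‖x‖ ^ (2 * ((n : ℝ) - 1)) := by positivity
    field_simp
  · have h2 := (tendsto_polar_model hn hk hθ1 hμ0 hα0 hβ0 0).1
    have h3 : 0 < (((n : ℝ) - 2) * k) ^ 2 * k ^ (-0 : ℝ) := by positivity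
    have h4 : Tendsto (fun x : EuclideanSpace ℝ (Fin n) => ‖x‖ ^ (-(2 * ((n : ℝ) - 1))))
        (𝓝[≠] 0) atTop :=
      (tendsto_rpow_neg_nhdsGT_zero (by linarith)).comp tendsto_norm_nhdsNE_zero
    refine (h4.atTop_mul_pos h3 h2).congr' ?_
    filter_upwards [hev] with x hx
    have hr : 0 < ‖x‖ := norm_pos_iff.2 hx.2
    rw [hS x hx, Real.rpow_neg hr.le]
    have h6 : (0:ℝ) < ‖x‖ ^ (2 * ((n : ℝ) - 1)) := by positivity
    simp only [neg_zero, Real.rpow_zero]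
    field_simp

end Asymptotics

section HarmonicPolar

variable {n : ℕ}

/-- `⟨D(|Du|² u^{-n/(n-2)}), Du⟩` in coordinates. -/
def qflux (u : EuclideanSpace ℝ (Fin n) → ℝ) (x : EuclideanSpace ℝ (Fin n)) : ℝ :=
  ∑ j, pd j (qfun (n / ((n : ℝ) - 2)) u) x * pd j u x

/-- A positive harmonic function with a pole at the origin, with the behaviour of the
fundamental solution there. -/
structure HarmonicPolar (Ω V : Set (EuclideanSpace ℝ (Fin n)))
    (u : EuclideanSpace ℝ (Fin n) → ℝ) (c P₀ : ℝ) : Prop extends PolarPotential Ω V u c where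
  three_le : 3 ≤ n
  pos : ∀ x ∈ V, 0 < u x
  harmonic : ∀ x ∈ Ω \ {0}, lap u x = 0
  limit_pos : 0 < P₀
  tendsto_qfun : Tendsto (qfun (2 * ((n : ℝ) - 1) / ((n : ℝ) - 2)) u) (𝓝[≠] 0) (𝓝 P₀)
  tendsto_qflux : Tendsto (fun x => qflux u x / gsq u x) (𝓝[≠] 0) (𝓝 P₀)
  tendsto_gsq : Tendsto (gsq u) (𝓝[≠] 0) atTop

namespace PolarPotential

variable {Ω V : Set (EuclideanSpace ℝ (Fin n))} {u : EuclideanSpace ℝ (Fin n) → ℝ} {c : ℝ}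

lemma exists_forall_of_eventually (hP : PolarPotential Ω V u c)
    {p : EuclideanSpace ℝ (Fin n) → Prop}
    (h : ∀ᶠ x in 𝓝[≠] 0, p x) : ∃ T₀, ∀ x ∈ closure Ω \ {0}, T₀ ≤ u x → p x := by
  obtain ⟨r, hr, hrp⟩ := Metric.mem_nhdsWithin_iff.1 h
  have hK : IsCompact (closure Ω \ ball 0 r) := hP.isBounded.isCompact_closure.diff isOpen_ball
  have hsub : closure Ω \ ball 0 r ⊆ V := fun x hx => hP.closure_subset ⟨hx.1, by
    rintro rfl
    exact hx.2 (mem_ball_self hr)⟩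
  obtain ⟨M, hM⟩ := (hK.image_of_continuousOn (hP.contDiffOn.continuousOn.mono hsub)).bddAbove
  refine ⟨M + 1, fun x hx hT => hrp ⟨?_, hx.2⟩⟩
  by_contra hb
  have := hM ⟨x, ⟨hx.1, hb⟩, rfl⟩
  linarith

lemma integrableOn_weight (hP : PolarPotential Ω V u c) {w : ℝ → ℝ} (hw : Continuous w) {s M : ℝ}
    (hs : c < s) (h1 : ∀ t ≤ s, w t = 0) (h2 : ∀ t, M ≤ t → w t = 0)
    {G : EuclideanSpace ℝ (Fin n) → ℝ} (hG : ContinuousOn G (Ω \ {0})) :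
    IntegrableOn (fun x => w (u x) * G x) (Ω \ {0}) := by
  refine integrableOn_weight_mul hP.isOpen_punctured
    (hP.contDiffOn.continuousOn.mono hP.punctured_subset) hw (hP.isCompact_level s M)
    (hP.level_subset hs) (fun x hx hK => ?_) hG
  by_cases hs' : u x ≤ s
  · exact h1 _ hs'
  · refine h2 _ (le_of_not_ge fun hM => hK ⟨⟨subset_closure hx.1, hx.2⟩, (not_le.1 hs').le, hM⟩)

lemma integrableOn_kern (hP : PolarPotential Ω V u c) {T ε : ℝ} (hT : c ≤ T) (hε : 0 < ε)
    {G : EuclideanSpace ℝ (Fin n) → ℝ} (hG : ContinuousOn G (Ω \ {0})) :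
    IntegrableOn (fun x => kern T ε (u x) * G x) (Ω \ {0}) :=
  hP.integrableOn_weight (kern_continuous T ε) (s := T + ε) (by linarith)
    (fun _ h => kern_left hε h) (fun _ h => kern_right hε h) hG

lemma integral_ramp_sub_ramp (hP : PolarPotential Ω V u c) {T₀ T₁ ε₀ ε₁ : ℝ} (hT₀ : c ≤ T₀)
    (hT₁ : c ≤ T₁) (hε₀ : 0 < ε₀) (hε₁ : 0 < ε₁) {F : Fin n → EuclideanSpace ℝ (Fin n) → ℝ}
    (hF : ∀ j, ContDiffOn ℝ (⊤ : ℕ∞) (F j) V) :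
    IntegrableOn (fun x => (ramp T₀ ε₀ (u x) - ramp T₁ ε₁ (u x)) * ∑ j, pd j (F j) x) (Ω \ {0}) ∧
    ∫ x in Ω \ {0}, (ramp T₀ ε₀ (u x) - ramp T₁ ε₁ (u x)) * ∑ j, pd j (F j) x =
      (∫ x in Ω \ {0}, kern T₁ ε₁ (u x) * ∑ j, F j x * pd j u x) -
        ∫ x in Ω \ {0}, kern T₀ ε₀ (u x) * ∑ j, F j x * pd j u x := by
  set s := min (T₀ + ε₀) (T₁ + ε₁) with hs
  set M := max (T₀ + 2 * ε₀) (T₁ + 2 * ε₁) with hM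
  have hcs : c < s := lt_min (by linarith) (by linarith)
  have h1 : ∀ t ≤ s, ramp T₀ ε₀ t - ramp T₁ ε₁ t = 0 := fun t ht => by
    rw [ramp_zero hε₀ (ht.trans (min_le_left _ _)), ramp_zero hε₁ (ht.trans (min_le_right _ _)),
      sub_zero]
  have h2 : ∀ t, M ≤ t → ramp T₀ ε₀ t - ramp T₁ ε₁ t = 0 := fun t ht => by
    rw [ramp_one hε₀ ((le_max_left _ _).trans ht), ramp_one hε₁ ((le_max_right _ _).trans ht),
      sub_self]
  have hwc : ContDiff ℝ (⊤ : ℕ∞) fun t => ramp T₀ ε₀ t - ramp T₁ ε₁ t :=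
    (ramp_contDiff _ _).sub (ramp_contDiff _ _)
  have hGc : ContinuousOn (fun x => ∑ j, F j x * pd j u x) (Ω \ {0}) :=
    (continuousOn_finsetSum _ fun j _ => (hF j).continuousOn.mul
      (contDiffOn_pd hP.isOpen_nhd hP.contDiffOn j).continuousOn).mono hP.punctured_subset
  have hDc : ContinuousOn (fun x => ∑ j, pd j (F j) x) (Ω \ {0}) :=
    (continuousOn_finsetSum _ fun j _ =>
      (contDiffOn_pd hP.isOpen_nhd (hF j) j).continuousOn).mono hP.punctured_subset
  refine ⟨hP.integrableOn_weight hwc.continuous hcs h1 h2 hDc, ?_⟩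
  have h := integral_weight_mul_divergence hP.isOpen_punctured
    (hP.contDiffOn_one.mono hP.punctured_subset)
    (w := fun t => ramp T₀ ε₀ t - ramp T₁ ε₁ t) (w' := fun t => kern T₀ ε₀ t - kern T₁ ε₁ t)
    (hwc.of_le (by simp)) (fun t => (ramp_hasDerivAt _ _ t).sub (ramp_hasDerivAt _ _ t))
    (hP.isCompact_level s M) (hP.level_subset hcs)
    (fun x hx hK => by
      by_cases hs' : u x ≤ s
      · exact h1 _ hs'
      · exact h2 _ (le_of_not_ge fun hM =>
          hK ⟨⟨subset_closure hx.1, hx.2⟩, (not_le.1 hs').le, hM⟩))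
    (fun j : Fin n => EuclideanSpace.single j (1 : ℝ)) (F := F)
    (fun j => ((hF j).mono hP.punctured_subset).of_le (by simp))
  simp only [sub_mul (kern _ _ _)] at h
  refine h.trans ?_
  rw [← neg_sub, neg_inj]
  exact integral_sub (hP.integrableOn_kern hT₀ hε₀ hGc) (hP.integrableOn_kern hT₁ hε₁ hGc)

end PolarPotential

namespace HarmonicPolar

variable {Ω V : Set (EuclideanSpace ℝ (Fin n))} {u : EuclideanSpace ℝ (Fin n) → ℝ} {c P₀ : ℝ}

lemma continuousOn_gsq (hP : HarmonicPolar Ω V u c P₀) : ContinuousOn (gsq u) V :=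
  (contDiffOn_gsq hP.isOpen_nhd hP.contDiffOn).continuousOn

lemma contDiffOn_qfun' (hP : HarmonicPolar Ω V u c P₀) (s : ℝ) :
    ContDiffOn ℝ (⊤ : ℕ∞) (qfun s u) V :=
  contDiffOn_qfun hP.isOpen_nhd hP.contDiffOn hP.pos s

lemma continuousOn_qflux (hP : HarmonicPolar Ω V u c P₀) : ContinuousOn (qflux u) V :=
  continuousOn_finsetSum _ fun j _ =>
    (contDiffOn_pd hP.isOpen_nhd (hP.contDiffOn_qfun' _) j).continuousOn.mul
      (contDiffOn_pd hP.isOpen_nhd hP.contDiffOn j).continuousOn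

/-- The flux `∫_{u = t} |Du| dσ`, in smoothed form, does not depend on the level. -/
lemma exists_flux (hP : HarmonicPolar Ω V u c P₀) : ∃ J : ℝ, 0 ≤ J ∧
    ∀ T ε : ℝ, c ≤ T → 0 < ε → ∫ x in Ω \ {0}, kern T ε (u x) * gsq u x = J := by
  refine ⟨∫ x in Ω \ {0}, kern c 1 (u x) * gsq u x, setIntegral_nonneg
    hP.isOpen_punctured.measurableSet fun x _ =>
      mul_nonneg (kern_nonneg one_pos _) (gsq_nonneg _ _), fun T ε hT hε => ?_⟩
  have h := (hP.integral_ramp_sub_ramp le_rfl hT one_pos hε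
    (F := fun j => pd j u) fun j => contDiffOn_pd hP.isOpen_nhd hP.contDiffOn j).2
  have h0 : ∀ x ∈ Ω \ {0}, (ramp c 1 (u x) - ramp T ε (u x)) * ∑ j, pd j (pd j u) x = 0 := by
    intro x hx
    rw [← lap_eq_sum hP.isOpen_nhd hP.contDiffOn (hP.punctured_subset hx), hP.harmonic x hx,
      mul_zero]
  rw [setIntegral_congr_fun hP.isOpen_punctured.measurableSet h0] at h
  simp only [integral_zero, ← sq] at h
  simp only [gsq]
  linarith

lemma integral_kern_mul_mem_Icc (hP : HarmonicPolar Ω V u c P₀) {J : ℝ}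
    (hJ : ∀ T ε : ℝ, c ≤ T → 0 < ε → ∫ x in Ω \ {0}, kern T ε (u x) * gsq u x = J)
    {T ε a b : ℝ} (hT : c ≤ T) (hε : 0 < ε) {G : EuclideanSpace ℝ (Fin n) → ℝ}
    (hG : ContinuousOn G V)
    (h : ∀ x ∈ Ω \ {0}, T ≤ u x → a * gsq u x ≤ G x ∧ G x ≤ b * gsq u x) :
    a * J ≤ ∫ x in Ω \ {0}, kern T ε (u x) * G x ∧
      ∫ x in Ω \ {0}, kern T ε (u x) * G x ≤ b * J := by
  have hC := hP.continuousOn_gsq.mono hP.punctured_subset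
  have hi := hP.integrableOn_kern hT hε hC
  have hiG := hP.integrableOn_kern hT hε (hG.mono hP.punctured_subset)
  have hm := hP.isOpen_punctured.measurableSet
  rw [← hJ T ε hT hε, ← integral_const_mul, ← integral_const_mul]
  have key : ∀ x ∈ Ω \ {0}, a * (kern T ε (u x) * gsq u x) ≤ kern T ε (u x) * G x ∧
      kern T ε (u x) * G x ≤ b * (kern T ε (u x) * gsq u x) := by
    intro x hx
    by_cases hx' : T ≤ u x
    · have h0 := kern_nonneg (T := T) hε (u x)
      have h1 := mul_le_mul_of_nonneg_left (h x hx hx').1 h0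
      have h2 := mul_le_mul_of_nonneg_left (h x hx hx').2 h0
      constructor <;> linarith
    · rw [kern_left hε (by linarith)]; simp
  exact ⟨setIntegral_mono_on (hi.const_mul a) hiG hm fun x hx => (key x hx).1,
    setIntegral_mono_on hiG (hi.const_mul b) hm fun x hx => (key x hx).2⟩

lemma setIntegral_congr_level (hP : HarmonicPolar Ω V u c P₀)
    {μ : Measure (EuclideanSpace ℝ (Fin n))} {G : EuclideanSpace ℝ (Fin n) → ℝ}
    (hG : ∀ x ∈ Ω \ {0}, gradient u x = 0 → G x = 0) :
    ∫ x in {x | x ∈ closure Ω \ {0} ∧ u x = c}, G x ∂μ = ∫ x in frontier Ω, G x ∂μ := by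
  refine setIntegral_eq_of_subset_of_forall_sdiff_eq_zero (hP.measurableSet_level c)
    (fun x hx => ⟨hP.frontier_subset hx, hP.eq_of_mem_frontier x hx⟩) ?_
  rintro x ⟨⟨hx, hxc⟩, hxf⟩
  have hxΩ : x ∈ Ω := by
    by_contra hno
    exact hxf (by rw [hP.isOpen.frontier_eq]; exact ⟨hx.1, hno⟩)
  exact hG x ⟨hxΩ, hx.2⟩ (hP.gradient_eq_zero ⟨hxΩ, hx.2⟩ hxc)

/-- The surface integrals of `|Du|³ / u^{2(n-1)/(n-2)}` converge as the level tends to infinity. -/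
lemma tendsto_setIntegral_level (hP : HarmonicPolar Ω V u c P₀) {m : ℕ} (hm : n = m + 1) {J : ℝ}
    (hJ0 : 0 ≤ J)
    (hJ : ∀ T ε : ℝ, c ≤ T → 0 < ε → ∫ x in Ω \ {0}, kern T ε (u x) * gsq u x = J) :
    Tendsto (fun t => ∫ x in {x | x ∈ closure Ω \ {0} ∧ u x = t},
      ‖gradient u x‖ ^ 3 / u x ^ (2 * ((n : ℝ) - 1) / ((n : ℝ) - 2)) ∂μHE[m]) atTop
      (𝓝 (P₀ * J)) := by
  set a : ℝ := 2 * ((n : ℝ) - 1) / ((n : ℝ) - 2) with ha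
  set G : EuclideanSpace ℝ (Fin n) → ℝ := fun x => kstep (gsq u x) * (qfun a u x * gsq u x) with hG
  have hGc : ContinuousOn G V := (kstep_contDiff.continuous.comp_continuousOn hP.continuousOn_gsq).mul
    ((hP.contDiffOn_qfun' a).continuousOn.mul hP.continuousOn_gsq)
  have hG0 : ∀ x ∈ V, ‖gradient u x‖ ≤ 1 → G x = 0 := fun x _ hx => by
    have : gsq u x ≤ 1 := by
      rw [gsq_eq_norm_sq]; exact pow_le_one₀ (norm_nonneg _) hx
    rw [hG]
    simp only [kstep_zero this, zero_mul]
  obtain ⟨T₁, hT₁⟩ := hP.exists_forall_of_eventually (hP.tendsto_gsq.eventually_ge_atTop 2)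
  refine Metric.tendsto_atTop'.2 fun e he => ?_
  set e' : ℝ := e / (2 * (J + 1)) with he'
  have he0 : 0 < e' := by positivity
  have heJ : e' * J < e := by
    rw [he', div_mul_eq_mul_div, div_lt_iff₀ (by positivity)]
    nlinarith
  obtain ⟨T₂, hT₂⟩ := hP.exists_forall_of_eventually
    (hP.tendsto_qfun.eventually (Icc_mem_nhds (show P₀ - e' < P₀ by linarith)
      (show P₀ < P₀ + e' by linarith)))
  refine ⟨max c (max T₁ T₂), fun T hT => ?_⟩
  have hTc : c ≤ T := (le_max_left _ _).trans hT.le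
  have hT1 : T₁ ≤ T := (le_max_left _ _).trans ((le_max_right _ _).trans hT.le)
  have hT2 : T₂ ≤ T := (le_max_right _ _).trans ((le_max_right _ _).trans hT.le)
  have hlim := (hP.tendsto_layer (m := m) (by simp [hm]) hTc one_pos hGc hG0).2
  have hIcc : ∀ᶠ ε in 𝓝[>] (0 : ℝ), ∫ x in Ω \ {0}, kern T ε (u x) * G x ∈
      Icc ((P₀ - e') * J) ((P₀ + e') * J) := by
    filter_upwards [self_mem_nhdsWithin] with ε hε
    refine hP.integral_kern_mul_mem_Icc hJ hTc hε hGc fun x hx hux => ?_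
    have hx' : x ∈ closure Ω \ {0} := ⟨subset_closure hx.1, hx.2⟩
    have h1 := hT₁ x hx' (hT1.trans hux)
    have h2 := hT₂ x hx' (hT2.trans hux)
    have h3 := gsq_nonneg u x
    simp only [hG, kstep_one h1, one_mul]
    exact ⟨mul_le_mul_of_nonneg_right h2.1 h3, mul_le_mul_of_nonneg_right h2.2 h3⟩
  have hmem := isClosed_Icc.mem_of_tendsto hlim hIcc
  have heq : ∫ x in {x | x ∈ closure Ω \ {0} ∧ u x = T}, G x / ‖gradient u x‖ ∂μHE[m] =
      ∫ x in {x | x ∈ closure Ω \ {0} ∧ u x = T}, ‖gradient u x‖ ^ 3 / u x ^ a ∂μHE[m] := by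
    refine setIntegral_congr_fun (hP.measurableSet_level T) fun x hx => ?_
    have h1 := hT₁ x hx.1 (hT1.trans hx.2.ge)
    have hg : ‖gradient u x‖ ≠ 0 := by
      intro h0
      rw [gsq_eq_norm_sq, h0] at h1
      norm_num at h1
    simp only [hG, kstep_one h1, one_mul, qfun, Real.rpow_neg (hP.pos x (hP.closure_subset hx.1)).le]
    rw [gsq_eq_norm_sq]
    field_simp
  rw [heq] at hmem
  rw [Real.dist_eq, abs_lt]
  constructor <;> nlinarith [hmem.1, hmem.2]

end HarmonicPolar

end HarmonicPolar

section HarmonicPolarFlux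

variable {n : ℕ}

/-- The bump `t kstep'(t)`, supported in `[1, 2]`. -/
def kbump (t : ℝ) : ℝ := t * deriv kstep t

lemma kbump_continuous : Continuous kbump := continuous_id.mul kstep_deriv_continuous

lemma kbump_left {t : ℝ} (h : t ≤ 1) : kbump t = 0 := by rw [kbump, kstep_deriv_left h, mul_zero]

lemma kbump_right {t : ℝ} (h : 2 ≤ t) : kbump t = 0 := by rw [kbump, kstep_deriv_right h, mul_zero]

lemma kbump_bdd : ∃ B : ℝ, ∀ t, ‖kbump t‖ ≤ B := by
  obtain ⟨B, hB0, hB⟩ := kstep_deriv_bdd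
  refine ⟨2 * B, fun t => ?_⟩
  by_cases h1 : t ≤ 1
  · rw [kbump_left h1, norm_zero]; positivity
  by_cases h2 : 2 ≤ t
  · rw [kbump_right h2, norm_zero]; positivity
  push Not at h1 h2
  rw [kbump, norm_mul, Real.norm_of_nonneg (by linarith), Real.norm_of_nonneg (kstep_deriv_nonneg t)]
  exact mul_le_mul h2.le (hB t) (kstep_deriv_nonneg t) (by norm_num)

lemma abs_sum_hgrad_mul_le (u : EuclideanSpace ℝ (Fin n) → ℝ) (x : EuclideanSpace ℝ (Fin n)) :
    ∑ j, hgrad u j x ^ 2 ≤ gsq u x * ∑ j, ∑ i, pd j (pd i u) x ^ 2 ∧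
    |∑ j, hgrad u j x * pd j u x| ≤ gsq u x * (1 + ∑ j, ∑ i, pd j (pd i u) x ^ 2) := by
  have h1 : ∑ j, hgrad u j x ^ 2 ≤ gsq u x * ∑ j, ∑ i, pd j (pd i u) x ^ 2 := by
    rw [Finset.mul_sum]
    exact Finset.sum_le_sum fun j _ => Finset.sum_mul_sq_le_sq_mul_sq _ _ _
  refine ⟨h1, (Finset.abs_sum_le_sum_abs _ _).trans ?_⟩
  have h2 : ∑ j, |hgrad u j x * pd j u x| ≤ ∑ j, (hgrad u j x ^ 2 + pd j u x ^ 2) := by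
    refine Finset.sum_le_sum fun j _ => abs_le.2 ⟨?_, ?_⟩ <;>
      nlinarith [sq_nonneg (hgrad u j x + pd j u x), sq_nonneg (hgrad u j x - pd j u x),
        sq_nonneg (hgrad u j x), sq_nonneg (pd j u x)]
  rw [Finset.sum_add_distrib, ← gsq] at h2
  linarith

namespace HarmonicPolar

variable {Ω V : Set (EuclideanSpace ℝ (Fin n))} {u : EuclideanSpace ℝ (Fin n) → ℝ} {c P₀ : ℝ}

lemma exponent_pos (hP : HarmonicPolar Ω V u c P₀) : 0 < (n : ℝ) / ((n : ℝ) - 2) := by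
  have : (3 : ℝ) ≤ n := by exact_mod_cast hP.three_le
  exact div_pos (by linarith) (by linarith)

lemma exists_bound (hP : HarmonicPolar Ω V u c P₀) {K : Set (EuclideanSpace ℝ (Fin n))}
    (hK : IsCompact K) (hKV : K ⊆ V) : ∃ M : ℝ, 0 ≤ M ∧ ∀ x ∈ K,
      |∑ j, 2 * hgrad u j x * pd j (qfun (n / ((n : ℝ) - 2)) u) x| ≤ M * gsq u x ∧
      |qflux u x| ≤ M * gsq u x := by
  set b : ℝ := n / ((n : ℝ) - 2) with hb
  have hb0 : 0 < b := hP.exponent_pos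
  set H : EuclideanSpace ℝ (Fin n) → ℝ := fun x => ∑ j, ∑ i, pd j (pd i u) x ^ 2 with hH
  have hH0 : ∀ x, 0 ≤ H x := fun x => Finset.sum_nonneg fun _ _ => Finset.sum_nonneg fun _ _ =>
    sq_nonneg _
  have hHc : ContinuousOn H V := continuousOn_finsetSum _ fun j _ => continuousOn_finsetSum _
    fun i _ => ((contDiffOn_pd hP.isOpen_nhd (contDiffOn_pd hP.isOpen_nhd hP.contDiffOn i)
      j).continuousOn).pow 2
  set k : EuclideanSpace ℝ (Fin n) → ℝ := fun x =>
    4 * u x ^ (-b) * (1 + H x) + 2 * b * u x ^ (-b - 1) * gsq u x * (1 + H x) with hk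
  have hkc : ContinuousOn k V := by
    have h1 := (contDiffOn_rpow hP.contDiffOn hP.pos (-b)).continuousOn
    have h2 := (contDiffOn_rpow hP.contDiffOn hP.pos (-b - 1)).continuousOn
    exact ((continuousOn_const.mul h1).mul (continuousOn_const.add hHc)).add
      (((continuousOn_const.mul h2).mul hP.continuousOn_gsq).mul (continuousOn_const.add hHc))
  obtain ⟨M, hM⟩ := (hK.image_of_continuousOn (hkc.mono hKV)).bddAbove
  refine ⟨max M 0, le_max_right _ _, fun x hx => ?_⟩
  have hxV := hKV hx
  have hkM : k x ≤ max M 0 := (hM ⟨x, hx, rfl⟩).trans (le_max_left _ _)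
  have hC := gsq_nonneg u x
  have hp1 : 0 < u x ^ (-b) := Real.rpow_pos_of_pos (hP.pos x hxV) _
  have hp2 : 0 < u x ^ (-b - 1) := Real.rpow_pos_of_pos (hP.pos x hxV) _
  obtain ⟨h1, h2⟩ := abs_sum_hgrad_mul_le u x
  have hS0 : 0 ≤ ∑ j, hgrad u j x ^ 2 := Finset.sum_nonneg fun _ _ => sq_nonneg _
  have hHx := hH0 x
  have hkx : k x * gsq u x ≤ max M 0 * gsq u x := mul_le_mul_of_nonneg_right hkM hC
  constructor
  · refine le_trans ?_ hkx
    have e : ∑ j, 2 * hgrad u j x * pd j (qfun b u) x =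
        4 * u x ^ (-b) * (∑ j, hgrad u j x ^ 2) -
          2 * b * u x ^ (-b - 1) * gsq u x * ∑ j, hgrad u j x * pd j u x := by
      rw [Finset.mul_sum, Finset.mul_sum, ← Finset.sum_sub_distrib]
      refine Finset.sum_congr rfl fun j _ => ?_
      rw [pd_qfun hP.isOpen_nhd hP.contDiffOn hP.pos b hxV]
      ring
    rw [e]
    refine (abs_sub _ _).trans ?_
    rw [abs_mul (4 * u x ^ (-b)), abs_mul (2 * b * u x ^ (-b - 1) * gsq u x), abs_of_nonneg hS0,
      abs_of_pos (show 0 < 4 * u x ^ (-b) by positivity),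
      abs_of_nonneg (show 0 ≤ 2 * b * u x ^ (-b - 1) * gsq u x by positivity)]
    have h3 : 4 * u x ^ (-b) * (∑ j, hgrad u j x ^ 2) ≤ 4 * u x ^ (-b) * (gsq u x * (1 + H x)) :=
      mul_le_mul_of_nonneg_left (h1.trans (mul_le_mul_of_nonneg_left (by simp only [hH]; linarith) hC))
        (by positivity)
    have h4 := mul_le_mul_of_nonneg_left h2
      (show 0 ≤ 2 * b * u x ^ (-b - 1) * gsq u x by positivity)
    refine (add_le_add h3 h4).trans (le_of_eq ?_)
    simp only [hk, hH]
    ring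
  · refine le_trans ?_ hkx
    rw [qflux, sum_pd_qfun_mul hP.isOpen_nhd hP.contDiffOn hP.pos _ hxV]
    refine (abs_sub _ _).trans ?_
    rw [abs_mul, abs_of_pos (show 0 < 2 * u x ^ (-b) by positivity),
      abs_of_nonneg (show 0 ≤ b * u x ^ (-b - 1) * gsq u x ^ 2 by positivity)]
    have h3 := mul_le_mul_of_nonneg_left h2 (show 0 ≤ 2 * u x ^ (-b) by positivity)
    have h4 : 0 ≤ 2 * u x ^ (-b) * (gsq u x * (1 + H x)) := by positivity
    have h5 : 0 ≤ b * u x ^ (-b - 1) * gsq u x ^ 2 := by positivity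
    have h6 : 0 ≤ b * u x ^ (-b - 1) * gsq u x ^ 2 * H x := by positivity
    have e : k x * gsq u x = 2 * (2 * u x ^ (-b) * (gsq u x * (1 + H x))) +
        2 * (b * u x ^ (-b - 1) * gsq u x ^ 2) + 2 * (b * u x ^ (-b - 1) * gsq u x ^ 2 * H x) := by
      simp only [hk]; ring
    rw [e]
    change _ ≤ 2 * u x ^ (-b) * (gsq u x * (1 + H x)) at h3
    linarith

lemma contDiffOn_cutoff (hP : HarmonicPolar Ω V u c P₀) (δ : ℝ) :
    ContDiffOn ℝ (⊤ : ℕ∞) (fun x => kstep (gsq u x / δ ^ 2)) V :=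
  kstep_contDiff.comp_contDiffOn
    ((contDiffOn_gsq hP.isOpen_nhd hP.contDiffOn).div_const _)

lemma sum_pd_cutoff_mul (hP : HarmonicPolar Ω V u c P₀) (δ : ℝ) {x : EuclideanSpace ℝ (Fin n)}
    (hx : x ∈ Ω \ {0}) :
    ∑ j, pd j (fun y => kstep (gsq u y / δ ^ 2) * pd j (qfun (n / ((n : ℝ) - 2)) u) y) x =
      kstep (gsq u x / δ ^ 2) *
        (2 * u x ^ (-(n / ((n : ℝ) - 2) : ℝ)) * ∑ i, ∑ j, defect u i j x ^ 2) +
      deriv kstep (gsq u x / δ ^ 2) / δ ^ 2 *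
        ∑ j, 2 * hgrad u j x * pd j (qfun (n / ((n : ℝ) - 2)) u) x := by
  have hxV := hP.punctured_subset hx
  rw [← sum_pd_pd_qfun hP.isOpen_nhd hP.contDiffOn hP.pos hP.three_le hP.isOpen_punctured
    hP.punctured_subset hP.harmonic hx, Finset.mul_sum, Finset.mul_sum, ← Finset.sum_add_distrib]
  refine Finset.sum_congr rfl fun j _ => ?_
  have hφ : HasDerivAt (fun t => kstep (t / δ ^ 2))
      (deriv kstep (gsq u x / δ ^ 2) / δ ^ 2) (gsq u x) := by
    have h := (kstep_differentiable (gsq u x / δ ^ 2)).hasDerivAt.comp (gsq u x)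
      ((hasDerivAt_id (gsq u x)).div_const (δ ^ 2))
    refine h.congr_deriv ?_
    simp [div_eq_mul_inv]
  rw [pd_mul (differentiableAt_of_contDiffOn hP.isOpen_nhd (hP.contDiffOn_cutoff δ) hxV)
    (differentiableAt_of_contDiffOn hP.isOpen_nhd
      (contDiffOn_pd hP.isOpen_nhd (hP.contDiffOn_qfun' _) j) hxV),
    pd_comp hφ (differentiableAt_of_contDiffOn hP.isOpen_nhd
      (contDiffOn_gsq hP.isOpen_nhd hP.contDiffOn) hxV),
    pd_gsq hP.isOpen_nhd hP.contDiffOn hxV]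
  ring

lemma integrableOn_kbump (hP : HarmonicPolar Ω V u c P₀) (δ : ℝ) :
    IntegrableOn (fun x => kbump (gsq u x / δ ^ 2)) (Ω \ {0}) := by
  obtain ⟨B, hB⟩ := kbump_bdd
  have hfin : volume (Ω \ {0}) ≠ ⊤ :=
    ((measure_mono sdiff_subset).trans_lt hP.isBounded.measure_lt_top).ne
  have hc : ContinuousOn (fun x => kbump (gsq u x / δ ^ 2)) (Ω \ {0}) :=
    kbump_continuous.comp_continuousOn ((hP.continuousOn_gsq.mono hP.punctured_subset).div_const _)
  exact Integrable.mono' (integrableOn_const (C := B) hfin)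
    (hc.aestronglyMeasurable hP.isOpen_punctured.measurableSet) (ae_of_all _ fun x => hB _)

lemma tendsto_integral_kbump (hP : HarmonicPolar Ω V u c P₀) :
    Tendsto (fun k : ℕ => ∫ x in Ω \ {0}, kbump (gsq u x / (1 / ((k : ℝ) + 1)) ^ 2)) atTop
      (𝓝 0) := by
  obtain ⟨B, hB⟩ := kbump_bdd
  have hfin : volume (Ω \ {0}) ≠ ⊤ :=
    ((measure_mono sdiff_subset).trans_lt hP.isBounded.measure_lt_top).ne
  have h := tendsto_integral_of_dominated_convergence (μ := volume.restrict (Ω \ {0}))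
    (F := fun (k : ℕ) x => kbump (gsq u x / (1 / ((k : ℝ) + 1)) ^ 2)) (f := fun _ => (0 : ℝ))
    (fun _ => B) (fun k => (hP.integrableOn_kbump _).aestronglyMeasurable)
    (integrableOn_const hfin) (fun k => ae_of_all _ fun x => hB _) (ae_of_all _ fun x => ?_)
  · simpa using h
  · refine tendsto_const_nhds.congr' ?_
    rcases (gsq_nonneg u x).eq_or_lt with h0 | h0
    · exact Eventually.of_forall fun k => by
        simp only [← h0, zero_div]
        rw [kbump_left zero_le_one]
    · have h1 : Tendsto (fun k : ℕ => 2 * (1 / ((k : ℝ) + 1)) ^ 2) atTop (𝓝 (2 * 0 ^ 2)) :=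
        ((tendsto_one_div_add_atTop_nhds_zero_nat (𝕜 := ℝ)).pow 2).const_mul 2
      filter_upwards [h1.eventually_lt_const (u := gsq u x) (by simpa using h0)] with k hk
      rw [kbump_right]
      rw [le_div_iff₀ (by positivity)]
      exact hk.le

lemma volume_sub_le_integral_kern (hP : HarmonicPolar Ω V u c P₀)
    {B : Set (EuclideanSpace ℝ (Fin n))} (hB : MeasurableSet B) (hBO : B ⊆ Ω \ {0})
    {T ε δ K m₀ : ℝ} (hT : c ≤ T) (hε : 0 < ε) (hδ : 0 < δ) (hεT : c + 2 * ε ≤ T + 1)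
    (hK : ∀ x ∈ Ω \ {0}, u x ≤ T + 2 →
      |∑ j, 2 * hgrad u j x * pd j (qfun (n / ((n : ℝ) - 2)) u) x| ≤ K * gsq u x) (hK0 : 0 ≤ K)
    (hB1 : ∀ x ∈ B, c + 2 * ε ≤ u x) (hB2 : ∀ x ∈ B, u x ≤ T + 1)
    (hB3 : ∀ x ∈ B, 2 * δ ^ 2 ≤ gsq u x)
    (hB4 : ∀ x ∈ B, m₀ ≤ 2 * u x ^ (-(n / ((n : ℝ) - 2) : ℝ)) * ∑ i, ∑ j, defect u i j x ^ 2) :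
    m₀ * volume.real B - K * ∫ x in Ω \ {0}, kbump (gsq u x / δ ^ 2) ≤
      (∫ x in Ω \ {0}, kern T 1 (u x) * (kstep (gsq u x / δ ^ 2) * qflux u x)) -
        ∫ x in Ω \ {0}, kern c ε (u x) * (kstep (gsq u x / δ ^ 2) * qflux u x) := by
  obtain ⟨hi, he⟩ := hP.integral_ramp_sub_ramp le_rfl hT hε one_pos
    (F := fun j y => kstep (gsq u y / δ ^ 2) * pd j (qfun (n / ((n : ℝ) - 2)) u) y)
    fun j => (hP.contDiffOn_cutoff δ).mul (contDiffOn_pd hP.isOpen_nhd (hP.contDiffOn_qfun' _) j)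
  have hq : ∀ x, ∑ j, kstep (gsq u x / δ ^ 2) * pd j (qfun (n / ((n : ℝ) - 2)) u) x * pd j u x =
      kstep (gsq u x / δ ^ 2) * qflux u x := fun x => by
    rw [qflux, Finset.mul_sum]
    exact Finset.sum_congr rfl fun j _ => by ring
  simp only [hq] at he
  rw [← he]
  have hO := hP.isOpen_punctured.measurableSet
  have hfin : volume (Ω \ {0}) ≠ ⊤ :=
    ((measure_mono sdiff_subset).trans_lt hP.isBounded.measure_lt_top).ne
  have hiB : IntegrableOn (B.indicator fun _ => m₀) (Ω \ {0}) :=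
    (integrableOn_const hfin).indicator hB
  have hik := (hP.integrableOn_kbump δ).const_mul K
  have e1 : m₀ * volume.real B = ∫ x in Ω \ {0}, B.indicator (fun _ => m₀) x := by
    rw [setIntegral_indicator hB, inter_eq_self_of_subset_right hBO, setIntegral_const, smul_eq_mul,
      mul_comm]
  rw [e1, ← integral_const_mul, ← integral_sub hiB hik]
  refine setIntegral_mono_on (hiB.sub hik) hi hO fun x hx => ?_
  rw [hP.sum_pd_cutoff_mul δ hx]
  set D : ℝ := 2 * u x ^ (-(n / ((n : ℝ) - 2) : ℝ)) * ∑ i, ∑ j, defect u i j x ^ 2 with hD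
  set Λ : ℝ := ∑ j, 2 * hgrad u j x * pd j (qfun (n / ((n : ℝ) - 2)) u) x with hΛ
  have hD0 : 0 ≤ D := mul_nonneg (mul_nonneg zero_le_two
    (Real.rpow_nonneg (hP.pos x (hP.punctured_subset hx)).le _))
    (Finset.sum_nonneg fun _ _ => Finset.sum_nonneg fun _ _ => sq_nonneg _)
  set w : ℝ := ramp c ε (u x) - ramp T 1 (u x) with hw
  have hw0 : 0 ≤ w := by
    rcases le_total (u x) (T + 1) with h | h
    · rw [hw, ramp_zero one_pos h, sub_zero]; exact ramp_nonneg _ _ _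
    · rw [hw, ramp_one hε (hεT.trans h)]
      linarith [ramp_le_one T 1 (u x)]
  have hw1 : w ≤ 1 := by
    linarith [ramp_le_one c ε (u x), ramp_nonneg T 1 (u x)]
  set ζ := kstep (gsq u x / δ ^ 2) with hζ
  have hζ0 : 0 ≤ ζ := kstep_nonneg _
  have hζ' := kstep_deriv_nonneg (gsq u x / δ ^ 2)
  have hd2 : 0 < δ ^ 2 := by positivity
  have hmain : B.indicator (fun _ => m₀) x ≤ w * (ζ * D) := by
    by_cases hxB : x ∈ B
    · have hw' : w = 1 := by
        rw [hw, ramp_one hε (hB1 x hxB), ramp_zero one_pos (hB2 x hxB), sub_zero]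
      have hζ1 : ζ = 1 := kstep_one ((le_div_iff₀ hd2).2 (hB3 x hxB))
      rw [indicator_of_mem hxB, hw', hζ1, one_mul, one_mul]
      exact hB4 x hxB
    · rw [indicator_of_notMem hxB]
      positivity
  have hrem : -(K * kbump (gsq u x / δ ^ 2)) ≤
      w * (deriv kstep (gsq u x / δ ^ 2) / δ ^ 2 * Λ) := by
    have hbump : 0 ≤ K * kbump (gsq u x / δ ^ 2) :=
      mul_nonneg hK0 (mul_nonneg (div_nonneg (gsq_nonneg _ _) hd2.le) hζ')
    rcases le_total (u x) (T + 2) with h | h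
    · have h1 := hK x hx h
      have h2 : deriv kstep (gsq u x / δ ^ 2) / δ ^ 2 * |Λ| ≤ K * kbump (gsq u x / δ ^ 2) := by
        refine (mul_le_mul_of_nonneg_left h1 (div_nonneg hζ' hd2.le)).trans (le_of_eq ?_)
        rw [kbump]; field_simp
      have h3 : w * (deriv kstep (gsq u x / δ ^ 2) / δ ^ 2 * |Λ|) ≤
          K * kbump (gsq u x / δ ^ 2) := by
        refine le_trans (mul_le_of_le_one_left (by positivity) hw1) h2
      have h4 : -(w * (deriv kstep (gsq u x / δ ^ 2) / δ ^ 2 * |Λ|)) ≤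
          w * (deriv kstep (gsq u x / δ ^ 2) / δ ^ 2 * Λ) := by
        rw [← mul_neg, ← mul_neg]
        exact mul_le_mul_of_nonneg_left (mul_le_mul_of_nonneg_left (neg_abs_le _)
          (div_nonneg hζ' hd2.le)) hw0
      linarith
    · have : w = 0 := by
        rw [hw, ramp_one hε (by linarith), ramp_one one_pos (by linarith), sub_self]
      rw [this, zero_mul]; linarith
  rw [mul_add]
  linarith

end HarmonicPolar

end HarmonicPolarFlux

section HarmonicPolarRigidity

variable {n : ℕ}

namespace HarmonicPolar

variable {Ω V : Set (EuclideanSpace ℝ (Fin n))} {u : EuclideanSpace ℝ (Fin n) → ℝ} {c P₀ : ℝ}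

lemma isCompact_frontier (hP : HarmonicPolar Ω V u c P₀) : IsCompact (frontier Ω) :=
  hP.isBounded.isCompact_closure.of_isClosed_subset isClosed_frontier frontier_subset_closure

lemma frontier_subset_nhd (hP : HarmonicPolar Ω V u c P₀) : frontier Ω ⊆ V :=
  hP.frontier_subset.trans hP.closure_subset

lemma exists_bound_frontier (hP : HarmonicPolar Ω V u c P₀) :
    ∃ M : ℝ, ∀ x ∈ frontier Ω, |qflux u x| / ‖gradient u x‖ ≤ M := by
  obtain ⟨M, hM0, hM⟩ := hP.exists_bound hP.isCompact_frontier hP.frontier_subset_nhd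
  obtain ⟨C, hC⟩ := (hP.isCompact_frontier.image_of_continuousOn
    (hP.continuousOn_gsq.mono hP.frontier_subset_nhd)).bddAbove
  refine ⟨M * (1 + C), fun x hx => ?_⟩
  have h1 := (hM x hx).2
  have h2 : gsq u x ≤ C := hC ⟨x, hx, rfl⟩
  rw [gsq_eq_norm_sq] at h1 h2
  have h3 : ‖gradient u x‖ ≤ 1 + C := by nlinarith [norm_nonneg (gradient u x)]
  refine le_trans ?_ (mul_le_mul_of_nonneg_left h3 hM0)
  refine div_le_of_le_mul₀ (norm_nonneg _) (by positivity) ?_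
  linarith

lemma integrableOn_qflux_div (hP : HarmonicPolar Ω V u c P₀)
    {μ : Measure (EuclideanSpace ℝ (Fin n))} (hfin : μ (frontier Ω) ≠ ⊤) :
    IntegrableOn (fun x => qflux u x / ‖gradient u x‖) (frontier Ω) μ := by
  obtain ⟨M, hM⟩ := hP.exists_bound_frontier
  have hm : MeasurableSet (frontier Ω) := isClosed_frontier.measurableSet
  have hg : ContinuousOn (fun x => ‖gradient u x‖) (frontier Ω) := by
    have h := (hP.continuousOn_gsq.mono hP.frontier_subset_nhd).sqrt
    refine h.congr fun x _ => ?_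
    simp only [gsq_eq_norm_sq, Real.sqrt_sq (norm_nonneg _)]
  refine Integrable.mono' (integrableOn_const (C := M) hfin)
    (((hP.continuousOn_qflux.mono hP.frontier_subset_nhd).aemeasurable hm).div
      (hg.aemeasurable hm)).aestronglyMeasurable ?_
  refine (ae_restrict_mem hm).mono fun x hx => ?_
  rw [norm_div, norm_norm, Real.norm_eq_abs]
  exact hM x hx

lemma tendsto_cutoff (u : EuclideanSpace ℝ (Fin n) → ℝ) {x : EuclideanSpace ℝ (Fin n)}
    (h0 : 0 < gsq u x) :
    Tendsto (fun k : ℕ => kstep (gsq u x / (1 / ((k : ℝ) + 1)) ^ 2)) atTop (𝓝 1) := by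
  refine tendsto_const_nhds.congr' ?_
  have h1 : Tendsto (fun k : ℕ => 2 * (1 / ((k : ℝ) + 1)) ^ 2) atTop (𝓝 (2 * 0 ^ 2)) :=
    ((tendsto_one_div_add_atTop_nhds_zero_nat (𝕜 := ℝ)).pow 2).const_mul 2
  filter_upwards [h1.eventually_lt_const (u := gsq u x) (by simpa using h0)] with k hk
  rw [kstep_one]
  rw [le_div_iff₀ (by positivity)]
  exact hk.le

lemma mul_volume_sub_le_cutoff (hP : HarmonicPolar Ω V u c P₀) {m : ℕ} (hm : n = m + 1) {J : ℝ}
    (hJ : ∀ T ε : ℝ, c ≤ T → 0 < ε → ∫ x in Ω \ {0}, kern T ε (u x) * gsq u x = J)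
    {B : Set (EuclideanSpace ℝ (Fin n))} (hB : MeasurableSet B) (hBO : B ⊆ Ω \ {0})
    {T K δ s m₀ P : ℝ} (hT : c ≤ T) (hδ : 0 < δ) (hδ1 : δ ≤ 1) (hs : c < s)
    (hK : ∀ x ∈ Ω \ {0}, u x ≤ T + 2 →
      |∑ j, 2 * hgrad u j x * pd j (qfun (n / ((n : ℝ) - 2)) u) x| ≤ K * gsq u x) (hK0 : 0 ≤ K)
    (hT1 : ∀ x ∈ Ω \ {0}, T ≤ u x → 2 ≤ gsq u x)
    (hT2 : ∀ x ∈ Ω \ {0}, T ≤ u x → qflux u x ≤ P * gsq u x)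
    (hB1 : ∀ x ∈ B, s ≤ u x) (hB2 : ∀ x ∈ B, u x ≤ T + 1)
    (hB3 : ∀ x ∈ B, 2 * δ ^ 2 ≤ gsq u x)
    (hB4 : ∀ x ∈ B, m₀ ≤ 2 * u x ^ (-(n / ((n : ℝ) - 2) : ℝ)) * ∑ i, ∑ j, defect u i j x ^ 2) :
    IntegrableOn (fun x => kstep (gsq u x / δ ^ 2) * qflux u x / ‖gradient u x‖) (frontier Ω)
      μHE[m] ∧
    m₀ * volume.real B - K * ∫ x in Ω \ {0}, kbump (gsq u x / δ ^ 2) ≤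
      P * J - ∫ x in frontier Ω, kstep (gsq u x / δ ^ 2) * qflux u x / ‖gradient u x‖ ∂μHE[m] := by
  set G : EuclideanSpace ℝ (Fin n) → ℝ := fun x => kstep (gsq u x / δ ^ 2) * qflux u x with hG
  have hGc : ContinuousOn G V := (hP.contDiffOn_cutoff δ).continuousOn.mul hP.continuousOn_qflux
  have hδ2 : 0 < δ ^ 2 := by positivity
  have hG0 : ∀ x ∈ V, ‖gradient u x‖ ≤ δ → G x = 0 := fun x _ hx => by
    have : gsq u x / δ ^ 2 ≤ 1 := by
      rw [div_le_one hδ2, gsq_eq_norm_sq]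
      exact pow_le_pow_left₀ (norm_nonneg _) hx 2
    simp only [hG, kstep_zero this, zero_mul]
  obtain ⟨hi, hlim⟩ := hP.tendsto_layer (m := m) (by simp [hm]) le_rfl hδ hGc hG0
  refine ⟨hi.mono_set fun x hx => ⟨hP.frontier_subset hx, hP.eq_of_mem_frontier x hx⟩, ?_⟩
  rw [hP.setIntegral_congr_level fun x _ h0 => by simp [h0]] at hlim
  have hup : ∫ x in Ω \ {0}, kern T 1 (u x) * G x ≤ P * J := by
    have hGa : ∀ x ∈ Ω \ {0}, T ≤ u x → G x = qflux u x := fun x hx hux => by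
      have h2 : 2 ≤ gsq u x / δ ^ 2 := by
        rw [le_div_iff₀ hδ2]
        have : δ ^ 2 ≤ 1 := pow_le_one₀ hδ.le hδ1
        linarith [hT1 x hx hux]
      simp only [hG, kstep_one h2, one_mul]
    have hC := hP.continuousOn_gsq.mono hP.punctured_subset
    rw [← hJ T 1 hT one_pos, ← integral_const_mul]
    refine setIntegral_mono_on (hP.integrableOn_kern hT one_pos (hGc.mono hP.punctured_subset))
      ((hP.integrableOn_kern hT one_pos hC).const_mul P) hP.isOpen_punctured.measurableSet ?_
    intro x hx
    by_cases hx' : T ≤ u x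
    · have h1 := mul_le_mul_of_nonneg_left (hT2 x hx hx') (kern_nonneg (T := T) one_pos (u x))
      rw [hGa x hx hx']
      linarith
    · rw [kern_left one_pos (by linarith)]; simp
  have hlow : ∀ᶠ ε in 𝓝[>] (0 : ℝ), ∫ x in Ω \ {0}, kern c ε (u x) * G x ≤
      P * J - (m₀ * volume.real B - K * ∫ x in Ω \ {0}, kbump (gsq u x / δ ^ 2)) := by
    filter_upwards [Ioo_mem_nhdsGT (show 0 < min (1 / 2) ((s - c) / 2) from
      lt_min (by norm_num) (by linarith))] with ε hε
    have h1 := hε.2.trans_le (min_le_left _ _)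
    have h2 := hε.2.trans_le (min_le_right _ _)
    have h := hP.volume_sub_le_integral_kern hB hBO hT hε.1 hδ (by linarith) hK hK0
      (fun x hx => by linarith [hB1 x hx]) hB2 hB3 hB4
    simp only [hG] at hup ⊢
    linarith
  have := le_of_tendsto hlim hlow
  linarith

/-- The divergence identity for `D(|Du|² u^{-n/(n-2)})`, integrated over `Ω`. -/
lemma mul_volume_le (hP : HarmonicPolar Ω V u c P₀) {m : ℕ} (hm : n = m + 1) {J : ℝ}
    (hJ : ∀ T ε : ℝ, c ≤ T → 0 < ε → ∫ x in Ω \ {0}, kern T ε (u x) * gsq u x = J)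
    (hfin : μHE[m] (frontier Ω) ≠ ⊤)
    {B : Set (EuclideanSpace ℝ (Fin n))} (hB : IsCompact B) (hBO : B ⊆ Ω \ {0})
    (hBu : ∀ x ∈ B, c < u x) (hBg : ∀ x ∈ B, 0 < gsq u x) {m₀ P : ℝ} (hP₀ : P₀ < P)
    (hBm : ∀ x ∈ B, m₀ ≤ 2 * u x ^ (-(n / ((n : ℝ) - 2) : ℝ)) * ∑ i, ∑ j, defect u i j x ^ 2) :
    m₀ * volume.real B ≤ P * J - ∫ x in frontier Ω, qflux u x / ‖gradient u x‖ ∂μHE[m] := by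
  have hBV := hBO.trans hP.punctured_subset
  have huB := hP.contDiffOn.continuousOn.mono hBV
  obtain ⟨s, hs, hB1⟩ := hB.exists_forall_le' huB hBu
  obtain ⟨g, hg, hBg'⟩ := hB.exists_forall_le' (hP.continuousOn_gsq.mono hBV) hBg
  obtain ⟨M, hM⟩ := (hB.image_of_continuousOn huB).bddAbove
  obtain ⟨T₁, hT₁⟩ := hP.exists_forall_of_eventually (hP.tendsto_gsq.eventually_ge_atTop 2)
  obtain ⟨T₂, hT₂⟩ := hP.exists_forall_of_eventually (hP.tendsto_qflux.eventually_lt_const hP₀)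
  set T := max (max c M) (max T₁ T₂) with hT
  have hTc : c ≤ T := (le_max_left _ _).trans (le_max_left _ _)
  have hTM : M ≤ T := (le_max_right _ _).trans (le_max_left _ _)
  have hT1 : T₁ ≤ T := (le_max_left _ _).trans (le_max_right _ _)
  have hT2 : T₂ ≤ T := (le_max_right _ _).trans (le_max_right _ _)
  have hsub : Ω \ {0} ⊆ closure Ω \ {0} := sdiff_subset_sdiff_left subset_closure
  obtain ⟨K, hK0, hK⟩ := hP.exists_bound (hP.isCompact_level c (T + 2))
    fun x hx => hP.closure_subset hx.1
  have key : ∀ᶠ k : ℕ in atTop,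
      IntegrableOn (fun x => kstep (gsq u x / (1 / ((k : ℝ) + 1)) ^ 2) * qflux u x / ‖gradient u x‖)
        (frontier Ω) μHE[m] ∧
      m₀ * volume.real B - K * ∫ x in Ω \ {0}, kbump (gsq u x / (1 / ((k : ℝ) + 1)) ^ 2) ≤
        P * J - ∫ x in frontier Ω,
          kstep (gsq u x / (1 / ((k : ℝ) + 1)) ^ 2) * qflux u x / ‖gradient u x‖ ∂μHE[m] := by
    have h1 : Tendsto (fun k : ℕ => 2 * (1 / ((k : ℝ) + 1)) ^ 2) atTop (𝓝 (2 * 0 ^ 2)) :=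
      ((tendsto_one_div_add_atTop_nhds_zero_nat (𝕜 := ℝ)).pow 2).const_mul 2
    filter_upwards [h1.eventually_lt_const (u := g) (by simpa using hg)] with k hk
    refine hP.mul_volume_sub_le_cutoff hm hJ hB.measurableSet hBO hTc (by positivity) ?_ hs
      (fun x hx hux => (hK x ⟨hsub hx, hP.le_of_mem x hx, hux⟩).1) hK0
      (fun x hx hux => hT₁ x (hsub hx) (hT1.trans hux)) (fun x hx hux => ?_) hB1
      (fun x hx => ?_) (fun x hx => hk.le.trans (hBg' x hx)) hBm
    · rw [div_le_one (by positivity)]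
      linarith [(Nat.cast_nonneg k : (0 : ℝ) ≤ k)]
    · have h2 := hT₁ x (hsub hx) (hT1.trans hux)
      exact ((div_lt_iff₀ (by linarith)).1 (hT₂ x (hsub hx) (hT2.trans hux))).le
    · have : u x ≤ M := hM ⟨x, hx, rfl⟩
      linarith
  obtain ⟨C, hC⟩ := hP.exists_bound_frontier
  have hlim := tendsto_integral_filter_of_dominated_convergence (μ := μHE[m].restrict (frontier Ω))
    (l := atTop) (F := fun (k : ℕ) x =>
      kstep (gsq u x / (1 / ((k : ℝ) + 1)) ^ 2) * qflux u x / ‖gradient u x‖)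
    (f := fun x => qflux u x / ‖gradient u x‖) (fun _ => C)
    (key.mono fun k hk => hk.1.aestronglyMeasurable)
    (Eventually.of_forall fun k => (ae_restrict_mem isClosed_frontier.measurableSet).mono
      fun x hx => ?_)
    (integrableOn_const hfin) (ae_of_all _ fun x => ?_)
  · have hl := (tendsto_const_nhds (x := m₀ * volume.real B)).sub
      (hP.tendsto_integral_kbump.const_mul K)
    have := le_of_tendsto_of_tendsto hl (hlim.const_sub (P * J)) (key.mono fun k hk => hk.2)
    simpa using this
  · rw [norm_div, norm_mul, norm_norm, Real.norm_of_nonneg (kstep_nonneg _), Real.norm_eq_abs]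
    refine le_trans ?_ (hC x hx)
    exact div_le_div_of_nonneg_right (mul_le_of_le_one_left (abs_nonneg _) (kstep_le_one _))
      (norm_nonneg _)
  · rcases (gsq_nonneg u x).eq_or_lt with h0 | h0
    · have h1 : ‖gradient u x‖ = 0 := by
        rw [gsq_eq_norm_sq] at h0
        exact pow_eq_zero_iff two_ne_zero |>.1 h0.symm
      simp [h1]
    · simpa using ((tendsto_cutoff u h0).mul_const (qflux u x)).div_const ‖gradient u x‖

lemma defect_eq_zero_of_gsq_pos (hP : HarmonicPolar Ω V u c P₀) {m : ℕ} (hm : n = m + 1) {J : ℝ}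
    (hJ0 : 0 ≤ J)
    (hJ : ∀ T ε : ℝ, c ≤ T → 0 < ε → ∫ x in Ω \ {0}, kern T ε (u x) * gsq u x = J)
    (hfin : μHE[m] (frontier Ω) ≠ ⊤)
    (hflux : P₀ * J ≤ ∫ x in frontier Ω, qflux u x / ‖gradient u x‖ ∂μHE[m])
    {x : EuclideanSpace ℝ (Fin n)} (hx : x ∈ Ω \ {0}) (hux : c < u x) (hgx : 0 < gsq u x) :
    ∀ i j, defect u i j x = 0 := by
  set D : EuclideanSpace ℝ (Fin n) → ℝ := fun x =>
    2 * u x ^ (-(n / ((n : ℝ) - 2) : ℝ)) * ∑ i, ∑ j, defect u i j x ^ 2 with hD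
  have hxV := hP.punctured_subset hx
  have hup : 0 < u x ^ (-(n / ((n : ℝ) - 2) : ℝ)) := Real.rpow_pos_of_pos (hP.pos x hxV) _
  have hS0 : 0 ≤ ∑ i, ∑ j, defect u i j x ^ 2 :=
    Finset.sum_nonneg fun _ _ => Finset.sum_nonneg fun _ _ => sq_nonneg _
  have hDc : ContinuousOn D (Ω \ {0}) := by
    have h : ContinuousOn (fun x => ∑ j, pd j (pd j (qfun (n / ((n : ℝ) - 2)) u)) x) (Ω \ {0}) :=
      (continuousOn_finsetSum _ fun j _ => (contDiffOn_pd hP.isOpen_nhd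
        (contDiffOn_pd hP.isOpen_nhd (hP.contDiffOn_qfun' _) j) j).continuousOn).mono
        hP.punctured_subset
    exact h.congr fun y hy => (sum_pd_pd_qfun hP.isOpen_nhd hP.contDiffOn hP.pos hP.three_le
      hP.isOpen_punctured hP.punctured_subset hP.harmonic hy).symm
  suffices h : D x ≤ 0 by
    have h1 : ∑ i, ∑ j, defect u i j x ^ 2 = 0 := by
      refine le_antisymm ?_ hS0
      by_contra! hne
      have : 0 < D x := by simp only [hD]; positivity
      linarith
    intro i j
    have h2 := (Finset.sum_eq_zero_iff_of_nonneg fun i _ => Finset.sum_nonneg fun j _ =>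
      sq_nonneg (defect u i j x)).1 h1 i (Finset.mem_univ _)
    have h3 := (Finset.sum_eq_zero_iff_of_nonneg fun j _ => sq_nonneg (defect u i j x)).1 h2 j
      (Finset.mem_univ _)
    exact pow_eq_zero_iff two_ne_zero |>.1 h3
  by_contra! hDx
  have hO := hP.isOpen_punctured
  have hmem := hO.mem_nhds hx
  have hev : ∀ᶠ y in 𝓝 x, y ∈ Ω \ {0} ∧ c < u y ∧ 0 < gsq u y ∧ D x / 2 ≤ D y :=
    (show ∀ᶠ y in 𝓝 x, y ∈ Ω \ {0} from hmem).and
      (((hP.contDiffOn.continuousOn.continuousAt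
        (hP.isOpen_nhd.mem_nhds hxV)).eventually_const_lt hux).and
      (((hP.continuousOn_gsq.continuousAt
        (hP.isOpen_nhd.mem_nhds hxV)).eventually_const_lt hgx).and
      ((hDc.continuousAt hmem).eventually_const_le (by linarith))))
  obtain ⟨r, hr, hball⟩ := Metric.nhds_basis_closedBall.mem_iff.1 hev
  have hv : 0 < volume.real (closedBall x r) :=
    ENNReal.toReal_pos (measure_closedBall_pos _ _ hr).ne' measure_closedBall_lt_top.ne
  have hall : ∀ e : ℝ, 0 < e → D x / 2 * volume.real (closedBall x r) ≤ 0 + e := fun e he => by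
    have h := hP.mul_volume_le hm hJ hfin (isCompact_closedBall x r) (fun y hy => (hball hy).1)
      (fun y hy => (hball hy).2.1) (fun y hy => (hball hy).2.2.1)
      (show P₀ < P₀ + e / (J + 1) by linarith [show 0 < e / (J + 1) by positivity])
      (fun y hy => (hball hy).2.2.2)
    have h2 : e / (J + 1) * J ≤ e := by
      rw [div_mul_eq_mul_div, div_le_iff₀ (by positivity)]
      nlinarith
    linarith
  have := le_of_forall_pos_le_add hall
  nlinarith [mul_pos (half_pos hDx) hv]

end HarmonicPolar

end HarmonicPolarRigidity

section HarmonicPolarConclusion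

variable {n : ℕ}

namespace HarmonicPolar

variable {Ω V : Set (EuclideanSpace ℝ (Fin n))} {u : EuclideanSpace ℝ (Fin n) → ℝ} {c P₀ : ℝ}

lemma qflux_div_sub_eq (hP : HarmonicPolar Ω V u c P₀) {x : EuclideanSpace ℝ (Fin n)}
    (hx : x ∈ V) (hxc : u x = c) :
    qflux u x / ‖gradient u x‖ - ‖gradient u x‖ ^ 3 / u x ^ (2 * ((n : ℝ) - 1) / ((n : ℝ) - 2)) =
      2 * ((n : ℝ) - 1) * c ^ (-(n / ((n : ℝ) - 2) : ℝ)) * (‖gradient u x‖ ^ 2 *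
        (meanH u x / ((n : ℝ) - 1) - ‖gradient u x‖ / (((n : ℝ) - 2) * u x))) := by
  have hn : (3 : ℝ) ≤ n := by exact_mod_cast hP.three_le
  have hn1 : (n : ℝ) - 1 ≠ 0 := by linarith
  have hn2 : (n : ℝ) - 2 ≠ 0 := by linarith
  have hu0 := hP.pos x hx
  have hB : ∑ j, hgrad u j x * pd j u x = hess2 u x (gradient u x) (gradient u x) := by
    rw [hess2_eq_sum hP.isOpen_nhd hP.contDiffOn hx]
    refine Finset.sum_congr rfl fun j _ => ?_
    rw [hgrad, Finset.sum_mul]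
    refine Finset.sum_congr rfl fun i _ => ?_
    rw [gradient_apply, gradient_apply]
    ring
  rw [qflux, sum_pd_qfun_mul hP.isOpen_nhd hP.contDiffOn hP.pos _ hx, hB, gsq_eq_norm_sq, meanH]
  have ha : 2 * ((n : ℝ) - 1) / ((n : ℝ) - 2) = n / ((n : ℝ) - 2) + 1 := by field_simp; ring
  have e1 : u x ^ (-(n / ((n : ℝ) - 2)) - 1 : ℝ) = u x ^ (-(n / ((n : ℝ) - 2)) : ℝ) / u x := by
    rw [Real.rpow_sub_one hu0.ne']
  have e2 : u x ^ (2 * ((n : ℝ) - 1) / ((n : ℝ) - 2)) =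
      u x / u x ^ (-(n / ((n : ℝ) - 2)) : ℝ) := by
    rw [ha, Real.rpow_add_one hu0.ne', Real.rpow_neg hu0.le]
    field_simp
  rw [e1, e2, ← hxc]
  have hy : 0 < u x ^ (-(n / ((n : ℝ) - 2)) : ℝ) := Real.rpow_pos_of_pos hu0 _
  generalize u x ^ (-(n / ((n : ℝ) - 2)) : ℝ) = y at hy ⊢
  rcases eq_or_ne ‖gradient u x‖ 0 with h0 | h0
  · simp [h0]
  · field_simp
    ring

/-- The curvature condition bounds the flux of `D(|Du|² u^{-n/(n-2)})` through the boundary. -/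
lemma integral_le_integral_qflux_div (hP : HarmonicPolar Ω V u c P₀)
    {μ : Measure (EuclideanSpace ℝ (Fin n))} (hfin : μ (frontier Ω) ≠ ⊤)
    (hint : 0 ≤ ∫ x in frontier Ω, ‖gradient u x‖ ^ 2 *
      (meanH u x / ((n : ℝ) - 1) - ‖gradient u x‖ / (((n : ℝ) - 2) * u x)) ∂μ) :
    ∫ x in frontier Ω, ‖gradient u x‖ ^ 3 / u x ^ (2 * ((n : ℝ) - 1) / ((n : ℝ) - 2)) ∂μ ≤
      ∫ x in frontier Ω, qflux u x / ‖gradient u x‖ ∂μ := by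
  have hn : (3 : ℝ) ≤ n := by exact_mod_cast hP.three_le
  have hm : MeasurableSet (frontier Ω) := isClosed_frontier.measurableSet
  have hFc : ContinuousOn (fun x => ‖gradient u x‖ ^ 3 /
      u x ^ (2 * ((n : ℝ) - 1) / ((n : ℝ) - 2))) (frontier Ω) := by
    have h := ((hP.continuousOn_gsq.mono hP.frontier_subset_nhd).sqrt).pow 3
    have hu := ((contDiffOn_rpow hP.contDiffOn hP.pos
      (2 * ((n : ℝ) - 1) / ((n : ℝ) - 2))).continuousOn.mono hP.frontier_subset_nhd)
    refine (h.div hu fun x hx =>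
      (Real.rpow_pos_of_pos (hP.pos x (hP.frontier_subset_nhd hx)) _).ne').congr fun x _ => ?_
    simp only [gsq_eq_norm_sq, Real.sqrt_sq (norm_nonneg _), Pi.div_apply, Pi.pow_apply]
  obtain ⟨C, hC⟩ := hP.isCompact_frontier.exists_bound_of_continuousOn hFc
  have hFi : IntegrableOn (fun x => ‖gradient u x‖ ^ 3 /
      u x ^ (2 * ((n : ℝ) - 1) / ((n : ℝ) - 2))) (frontier Ω) μ :=
    Integrable.mono' (integrableOn_const (C := C) hfin) (hFc.aestronglyMeasurable hm)
      ((ae_restrict_mem hm).mono hC)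
  rw [← sub_nonneg, ← integral_sub (hP.integrableOn_qflux_div hfin) hFi,
    setIntegral_congr_fun hm fun x hx =>
      hP.qflux_div_sub_eq (hP.frontier_subset_nhd hx) (hP.eq_of_mem_frontier x hx),
    integral_const_mul]
  rcases (frontier Ω).eq_empty_or_nonempty with he | ⟨x, hx⟩
  · simp [he]
  · have hc : 0 < c := hP.eq_of_mem_frontier x hx ▸ hP.pos x (hP.frontier_subset_nhd hx)
    exact mul_nonneg (mul_nonneg (by linarith) (Real.rpow_nonneg hc.le _)) hint

lemma qfun_eq_of_defect_eq_zero (hP : HarmonicPolar Ω V u c P₀)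
    {C : Set (EuclideanSpace ℝ (Fin n))} (hC : IsOpen C) (hCc : IsPreconnected C)
    (hCΩ : C ⊆ Ω \ {0}) (h : ∀ x ∈ C, ∀ i j, defect u i j x = 0) {x y : EuclideanSpace ℝ (Fin n)}
    (hx : x ∈ C) (hy : y ∈ C) :
    qfun (2 * ((n : ℝ) - 1) / ((n : ℝ) - 2)) u x = qfun (2 * ((n : ℝ) - 1) / ((n : ℝ) - 2)) u y := by
  have hCV := hCΩ.trans hP.punctured_subset
  refine hC.is_const_of_fderiv_eq_zero hCc
    (((hP.contDiffOn_qfun' _).mono hCV).differentiableOn (by simp)) (fun z hz => ?_) hx hy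
  ext v
  rw [fderiv_apply_eq_sum]
  exact Finset.sum_eq_zero fun j _ => by
    rw [pd_qfun_eq_zero_of_defect hP.isOpen_nhd hP.contDiffOn hP.pos hP.three_le (hCV hz) (h z hz),
      mul_zero]

lemma qfun_eq_limit (hP : HarmonicPolar Ω V u c P₀) {r : ℝ} (hrΩ : ball 0 r \ {0} ⊆ Ω \ {0})
    (h : ∀ x ∈ ball 0 r \ {0}, ∀ i j, defect u i j x = 0) {x : EuclideanSpace ℝ (Fin n)}
    (hx : x ∈ ball 0 r \ {0}) : qfun (2 * ((n : ℝ) - 1) / ((n : ℝ) - 2)) u x = P₀ := by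
  set C : Set (EuclideanSpace ℝ (Fin n)) := ball 0 r ∩ {y | 0 < ⟪x, y⟫_ℝ} with hC
  have hCo : IsOpen C :=
    isOpen_ball.inter (isOpen_lt continuous_const (continuous_const.inner continuous_id))
  have hCc : Convex ℝ C :=
    (convex_ball _ _).inter (convex_halfSpace_gt (innerₗ _ x).isLinear 0)
  have hC0 : C ⊆ ball 0 r \ {0} := fun y hy => ⟨hy.1, by
    rintro rfl
    simpa using hy.2⟩
  have hxx : 0 < ⟪x, x⟫_ℝ := real_inner_self_pos.2 hx.2
  have hev : ∀ᶠ t : ℝ in 𝓝[>] 0, P₀ = P₀ ∧ t • x ∈ C := by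
    filter_upwards [Ioo_mem_nhdsGT one_pos] with t ht
    refine ⟨rfl, ?_, ?_⟩
    · rw [mem_ball_zero_iff, norm_smul, Real.norm_of_nonneg ht.1.le]
      exact lt_of_le_of_lt (mul_le_of_le_one_left (norm_nonneg _) ht.2.le)
        (mem_ball_zero_iff.1 hx.1)
    · change 0 < ⟪x, t • x⟫_ℝ
      rw [real_inner_smul_right]
      exact mul_pos ht.1 hxx
  have hlim : Tendsto (fun t : ℝ => t • x) (𝓝[>] 0) (𝓝[≠] 0) := by
    refine tendsto_nhdsWithin_iff.2 ⟨?_, ?_⟩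
    · have : Tendsto (fun t : ℝ => t • x) (𝓝 0) (𝓝 ((0 : ℝ) • x)) :=
        (continuous_id.smul continuous_const).tendsto 0
      rw [zero_smul] at this
      exact this.mono_left nhdsWithin_le_nhds
    · filter_upwards [self_mem_nhdsWithin] with t ht
      exact smul_ne_zero (ne_of_gt ht) hx.2
  refine tendsto_nhds_unique (tendsto_const_nhds.congr' ?_) (hP.tendsto_qfun.comp hlim)
  filter_upwards [hev] with t ht
  exact hP.qfun_eq_of_defect_eq_zero hCo hCc.isPreconnected (hC0.trans hrΩ)
    (fun y hy => h y (hC0 hy)) ⟨hx.1, hxx⟩ ht.2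

/-- If the trace-free tensor vanishes away from critical points, there are no critical points and
the Hessian identity holds everywhere. -/
lemma hessId_of_forall_defect (hP : HarmonicPolar Ω V u c P₀) (hΩ : IsPreconnected Ω)
    (h : ∀ x ∈ Ω \ {0}, c < u x → 0 < gsq u x → ∀ i j, defect u i j x = 0) :
    ∀ x ∈ Ω \ {0}, HessId u x := by
  set q := qfun (2 * ((n : ℝ) - 1) / ((n : ℝ) - 2)) u with hq
  set S : Set (EuclideanSpace ℝ (Fin n)) := {x | x = 0 ∨ (x ∈ Ω \ {0} ∧ c < u x ∧ q x = P₀)} with hS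
  have hgpos : ∀ x, q x = P₀ → 0 < gsq u x := fun x hx => by
    refine (gsq_nonneg u x).lt_of_ne fun h0 => hP.limit_pos.ne' ?_
    rw [← hx, hq, qfun, ← h0, zero_mul]
  have hnhds : ∀ x ∈ Ω \ {0}, c < u x → 0 < gsq u x →
      ∀ᶠ y in 𝓝 x, y ∈ Ω \ {0} ∧ c < u y ∧ 0 < gsq u y := fun x hx h1 h2 => by
    have hxV := hP.isOpen_nhd.mem_nhds (hP.punctured_subset hx)
    exact (show ∀ᶠ y in 𝓝 x, y ∈ Ω \ {0} from hP.isOpen_punctured.mem_nhds hx).and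
      (((hP.contDiffOn.continuousOn.continuousAt hxV).eventually_const_lt h1).and
        ((hP.continuousOn_gsq.continuousAt hxV).eventually_const_lt h2))
  have hSo : IsOpen S := by
    refine isOpen_iff_mem_nhds.2 fun x hx => ?_
    rcases hx with rfl | ⟨hxΩ, hxc, hxq⟩
    · have hev : ∀ᶠ y in 𝓝[≠] (0 : EuclideanSpace ℝ (Fin n)),
          y ∈ Ω \ {0} ∧ c < u y ∧ 0 < gsq u y := by
        filter_upwards [mem_nhdsWithin_of_mem_nhds (hP.isOpen.mem_nhds hP.zero_mem),
          self_mem_nhdsWithin, hP.tendsto_zero.eventually_gt_atTop c,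
          hP.tendsto_gsq.eventually_gt_atTop 0] with y h1 h2 h3 h4
        exact ⟨⟨h1, h2⟩, h3, h4⟩
      obtain ⟨r, hr, hball⟩ := Metric.mem_nhdsWithin_iff.1 hev
      refine mem_of_superset (ball_mem_nhds 0 hr) fun y hy => ?_
      by_cases hy0 : y = 0
      · exact Or.inl hy0
      · have hy' : y ∈ ball 0 r \ {0} := ⟨hy, hy0⟩
        exact Or.inr ⟨(hball hy').1, (hball hy').2.1,
          hP.qfun_eq_limit (fun z hz => (hball hz).1)
            (fun z hz => h z (hball hz).1 (hball hz).2.1 (hball hz).2.2) hy'⟩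
    · obtain ⟨r, hr, hball⟩ := Metric.mem_nhds_iff.1 (hnhds x hxΩ hxc (hgpos x hxq))
      refine mem_of_superset (ball_mem_nhds x hr) fun y hy => Or.inr ⟨(hball hy).1, (hball hy).2.1, ?_⟩
      rw [← hxq]
      exact hP.qfun_eq_of_defect_eq_zero isOpen_ball (convex_ball _ _).isPreconnected
        (fun z hz => (hball hz).1) (fun z hz => h z (hball hz).1 (hball hz).2.1 (hball hz).2.2)
        hy (mem_ball_self hr)
  have hsub : Ω ⊆ S := by
    refine hΩ.subset_of_closure_inter_subset hSo ⟨0, hP.zero_mem, Or.inl rfl⟩ ?_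
    rintro y ⟨hyS, hyΩ⟩
    by_cases hy0 : y = 0
    · exact Or.inl hy0
    have hy : y ∈ Ω \ {0} := ⟨hyΩ, hy0⟩
    have hqc : ContinuousAt q y := (hP.contDiffOn_qfun' _).continuousOn.continuousAt
      (hP.isOpen_nhd.mem_nhds (hP.punctured_subset hy))
    have hyq : q y = P₀ := by
      by_contra hne
      have h1 : ∀ᶠ z in 𝓝 y, q z ≠ P₀ ∧ z ∈ Ω \ {0} :=
        (hqc.eventually_ne hne).and (hP.isOpen_punctured.mem_nhds hy)
      obtain ⟨z, hz, hzS⟩ := (mem_closure_iff_nhds.1 hyS) _ h1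
      rcases hzS with rfl | hzS
      · exact hz.2.2 rfl
      · exact hz.1 hzS.2.2
    refine Or.inr ⟨hy, (hP.le_of_mem y hy).lt_of_ne fun hc => ?_, hyq⟩
    have := hgpos y hyq
    rw [gsq_eq_norm_sq, hP.gradient_eq_zero hy hc.symm] at this
    simp at this
  intro x hx
  rcases hsub hx.1 with h0 | ⟨_, hxc, hxq⟩
  · exact absurd h0 hx.2
  · have hxV := hP.punctured_subset hx
    exact hessId_of_defect_eq_zero hP.isOpen_nhd hP.contDiffOn hP.three_le hxV (hP.pos x hxV).ne'
      (h x hx hxc (hgpos x hxq))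

end HarmonicPolar

end HarmonicPolarConclusion

section InteriorProblem

variable {n : ℕ} {Ω : Set (EuclideanSpace ℝ (Fin n))} {u : EuclideanSpace ℝ (Fin n) → ℝ} {d c : ℝ}

lemma hess2_congr {f g : EuclideanSpace ℝ (Fin n) → ℝ} {x : EuclideanSpace ℝ (Fin n)}
    (h : f =ᶠ[𝓝 x] g) (v w : EuclideanSpace ℝ (Fin n)) : hess2 f x v w = hess2 g x v w := by
  rw [hess2, hess2, (h.iteratedFDeriv ℝ 2).eq_of_nhds]

lemma lap_congr {f g : EuclideanSpace ℝ (Fin n) → ℝ} {x : EuclideanSpace ℝ (Fin n)}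
    (h : f =ᶠ[𝓝 x] g) : lap f x = lap g x :=
  Finset.sum_congr rfl fun _ _ => hess2_congr h _ _

lemma lap_neg (f : EuclideanSpace ℝ (Fin n) → ℝ) (x : EuclideanSpace ℝ (Fin n)) :
    lap (-f) x = -lap f x := by
  simp only [lap, hess2, ← Finset.sum_neg_distrib]
  refine Finset.sum_congr rfl fun i _ => ?_
  rw [iteratedFDeriv_neg_apply]
  rfl

lemma hessId_of_eventuallyEq_const {x : EuclideanSpace ℝ (Fin n)} (h : u =ᶠ[𝓝 x] fun _ => c) :
    HessId u x := by
  intro v w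
  have h1 : gradient u x = 0 := by simp [gradient, h.fderiv_eq]
  rw [hess2_congr h, h1, hess2, iteratedFDeriv_const_of_ne two_ne_zero]
  simp

/-- Without a pole, the solution of the interior problem is constant. -/
lemma eq_const_of_no_pole (hn : 3 ≤ n) (hΩ : GoodDomain Ω)
    (hsm : ∃ U, IsOpen U ∧ closure Ω ⊆ U ∧ ContDiffOn ℝ (⊤ : ℕ∞) u (U \ {0}))
    (hfr : ∀ x ∈ frontier Ω, u x = c) {v : EuclideanSpace ℝ (Fin n) → ℝ}
    (hv : ContDiffOn ℝ (⊤ : ℕ∞) v Ω) (hlap : ∀ x ∈ Ω, lap v x = 0)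
    (huv : ∀ x ∈ Ω \ {0}, u x = v x) : ∀ x ∈ Ω \ {0}, u x = c := by
  obtain ⟨hO, -, hb, h0⟩ := hΩ
  obtain ⟨U, hU, hΩU, hu⟩ := hsm
  set w := Function.update u 0 (v 0) with hw
  have hwv : EqOn w v Ω := fun x hx => by
    by_cases hx0 : x = 0
    · rw [hx0, hw, Function.update_self]
    · rw [hw, Function.update_of_ne hx0, huv x ⟨hx, hx0⟩]
  have hws : ContDiffOn ℝ (⊤ : ℕ∞) w Ω := hv.congr hwv
  have hwc : ContinuousOn w (closure Ω) := fun x hx => by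
    by_cases hx0 : x = 0
    · exact (hws.continuousOn.continuousAt (hO.mem_nhds (hx0 ▸ h0))).continuousWithinAt
    · have hUo : IsOpen (U \ {0}) := hU.sdiff isClosed_singleton
      have hxU := hUo.mem_nhds (show x ∈ U \ {0} from ⟨hΩU hx, hx0⟩)
      refine ((hu.continuousOn.continuousAt hxU).congr ?_).continuousWithinAt
      filter_upwards [hxU] with y hy
      rw [hw, Function.update_of_ne hy.2]
  have hwl : ∀ x ∈ Ω, lap w x = 0 := fun x hx => by
    rw [lap_congr (hwv.eventuallyEq_of_mem (hO.mem_nhds hx)), hlap x hx]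
  have hwf : ∀ x ∈ frontier Ω, w x = c := fun x hx => by
    rw [hw, Function.update_of_ne, hfr x hx]
    rintro rfl
    rw [hO.frontier_eq] at hx
    exact hx.2 h0
  intro x hx
  have h1 := le_of_harmonic_of_le_frontier (by lia) hO hb hwc hws hwl
    (fun y hy => (hwf y hy).ge) x hx.1
  have h2 := le_of_harmonic_of_le_frontier (c := -c) (by lia) hO hb hwc.neg hws.neg
    (fun y hy => by rw [lap_neg, hwl y hy, neg_zero])
    (fun y hy => by rw [Pi.neg_apply, hwf y hy]) x hx.1
  have h3 : w x = u x := by rw [hw, Function.update_of_ne hx.2]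
  rw [Pi.neg_apply] at h2
  linarith

/-- A harmonic function with a pole at the origin is bounded below by its boundary value. -/
lemma le_of_pole (hn : 3 ≤ n) (hΩ : GoodDomain Ω)
    (hsm : ∃ U, IsOpen U ∧ closure Ω ⊆ U ∧ ContDiffOn ℝ (⊤ : ℕ∞) u (U \ {0}))
    (hlap : ∀ x ∈ Ω \ {0}, lap u x = 0) (hfr : ∀ x ∈ frontier Ω, u x = c)
    (hlim : Tendsto u (𝓝[≠] 0) atTop) : ∀ x ∈ Ω \ {0}, c ≤ u x := by
  obtain ⟨hO, -, hb, h0⟩ := hΩ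
  obtain ⟨U, hU, hΩU, hu⟩ := hsm
  obtain ⟨r, hr, hball⟩ := Metric.mem_nhdsWithin_iff.1 (hlim.eventually_ge_atTop c)
  intro x hx
  by_cases hxr : x ∈ ball 0 r
  · exact hball ⟨hxr, hx.2⟩
  have hne : ∀ y : EuclideanSpace ℝ (Fin n), y ∉ ball 0 (r / 2) → y ≠ 0 := by
    rintro y hy rfl
    exact hy (mem_ball_self (by positivity))
  have hD : IsOpen (Ω \ closedBall 0 (r / 2)) := hO.sdiff isClosed_closedBall
  have hDc : closure (Ω \ closedBall 0 (r / 2)) ⊆ closure Ω \ ball 0 (r / 2) :=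
    closure_minimal (sdiff_subset_sdiff subset_closure ball_subset_closedBall)
      (isClosed_closure.sdiff isOpen_ball)
  have hDU : closure (Ω \ closedBall 0 (r / 2)) ⊆ U \ {0} := fun y hy =>
    ⟨hΩU (hDc hy).1, hne y (hDc hy).2⟩
  refine le_of_harmonic_of_le_frontier (by lia) hD (hb.subset sdiff_subset)
    (hu.continuousOn.mono hDU) (hu.mono (subset_closure.trans hDU))
    (fun y hy => hlap y ⟨hy.1, hne y fun h => hy.2 (ball_subset_closedBall h)⟩) (fun y hy => ?_)
    x ⟨hx.1, fun h => hxr (closedBall_subset_ball (by linarith) h)⟩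
  rw [hD.frontier_eq] at hy
  have hy1 := hDc hy.1
  by_cases hyΩ : y ∈ Ω
  · have hyb : y ∈ closedBall 0 (r / 2) := by
      by_contra hno
      exact hy.2 ⟨hyΩ, hno⟩
    exact hball ⟨closedBall_subset_ball (by linarith) hyb, hne y hy1.2⟩
  · exact (hfr y (by rw [hO.frontier_eq]; exact ⟨hy1.1, hyΩ⟩)).ge

lemma exists_harmonicPolar (hn : 3 ≤ n) (hc : 0 < c) (hΩ : GoodDomain Ω)
    (hsm : ∃ U, IsOpen U ∧ closure Ω ⊆ U ∧ ContDiffOn ℝ (⊤ : ℕ∞) u (U \ {0}))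
    (hlap : ∀ x ∈ Ω \ {0}, lap u x = 0) (hfr : ∀ x ∈ frontier Ω, u x = c) {k : ℝ} (hk : 0 < k)
    {v : EuclideanSpace ℝ (Fin n) → ℝ} (hv : ContDiffOn ℝ (⊤ : ℕ∞) v Ω)
    (huv : ∀ x ∈ Ω \ {0}, u x = k * ‖x‖ ^ ((2 : ℝ) - n) + v x) :
    ∃ V P₀, HarmonicPolar Ω V u c P₀ := by
  have hpole := tendsto_atTop_of_pole hn hΩ.1 hΩ.2.2.2 hk hv huv
  have hle := le_of_pole hn hΩ hsm hlap hfr hpole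
  obtain ⟨P₀, hP₀, h1, h2, h3⟩ := pole_asymptotics hn hΩ.1 hΩ.2.2.2 hk hv huv
  obtain ⟨hO, -, hb, h0⟩ := hΩ
  obtain ⟨U, hU, hΩU, hu⟩ := hsm
  refine ⟨U \ {0} ∩ u ⁻¹' Ioi 0, P₀, ⟨⟨hO, hb, h0,
    hu.continuousOn.isOpen_inter_preimage (hU.sdiff isClosed_singleton) isOpen_Ioi,
    fun h => h.1.2 rfl, fun x hx => ⟨⟨hΩU hx.1, hx.2⟩, ?_⟩, hu.mono inter_subset_left, hfr, hle,
    hpole⟩, hn, fun x hx => hx.2, hlap, hP₀, h1, h2, h3⟩⟩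
  change 0 < u x
  by_cases hxΩ : x ∈ Ω
  · exact hc.trans_le (hle x ⟨hxΩ, hx.2⟩)
  · rw [hfr x (by rw [hO.frontier_eq]; exact ⟨hx.1, hxΩ⟩)]
    exact hc

lemma exists_setIntegral_euclideanHausdorffMeasure (m : ℕ) : ∃ s : ℝ≥0, s ≠ 0 ∧
    (μHE[m] : Measure (EuclideanSpace ℝ (Fin n))) = s • μH[m] ∧
    ∀ (A : Set (EuclideanSpace ℝ (Fin n))) (f : EuclideanSpace ℝ (Fin n) → ℝ),
      ∫ x in A, f x ∂μHE[m] = s * ∫ x in A, f x ∂μH[m] := by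
  refine ⟨_, Measure.addHaarScalarFactor_volume_hausdorffMeasure_ne_zero m,
    Measure.euclideanHausdorffMeasure_def m, fun A f => ?_⟩
  rw [Measure.euclideanHausdorffMeasure_def, Measure.restrict_smul, integral_smul_nnreal_measure]
  rfl

end InteriorProblem


/-- integral conditions for the interior problem force the Hessian identity
(vanishing of the conformal Hessian of `log u`) on `Ω∖{0}`. -/
theorem interior_integral_condition_hessian_identity
    (n : ℕ) (hn : 3 ≤ n) (Ω : Set (EuclideanSpace ℝ (Fin n)))
    (u : EuclideanSpace ℝ (Fin n) → ℝ) (d c : ℝ) (hd : 0 < d) (hc : 0 < c)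
    (hΩ : GoodDomain Ω) (hu : InteriorSol Ω d c u)
    (hlim : (∫ x in frontier Ω,
        ‖gradient u x‖ ^ 3 / u x ^ (2 * ((n : ℝ) - 1) / ((n : ℝ) - 2)) ∂μH[(n : ℝ) - 1]) =
      Filter.limsup (fun t : ℝ =>
        ∫ x in {x | x ∈ closure Ω \ {(0 : EuclideanSpace ℝ (Fin n))} ∧ u x = t},
          ‖gradient u x‖ ^ 3 / u x ^ (2 * ((n : ℝ) - 1) / ((n : ℝ) - 2)) ∂μH[(n : ℝ) - 1])
        Filter.atTop)
    (hint : 0 ≤ ∫ x in frontier Ω,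
        ‖gradient u x‖ ^ 2 *
          (meanH u x / ((n : ℝ) - 1) - ‖gradient u x‖ / (((n : ℝ) - 2) * u x))
        ∂μH[(n : ℝ) - 1]) :
    ∀ x ∈ Ω \ {(0 : EuclideanSpace ℝ (Fin n))}, HessId u x := by
  obtain ⟨hsm, hlap, hfr, v, hv, hvlap, huv⟩ := hu
  have hn3 : (3 : ℝ) ≤ n := by exact_mod_cast hn
  rcases eq_or_ne (d * sArea (frontier Ω) / (((n : ℝ) - 2) * sphereArea n)) 0 with hk | hk
  · intro x hx
    have h := eq_const_of_no_pole hn hΩ hsm hfr hv hvlap fun y hy => by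
      rw [huv y hy, hk, zero_mul, zero_add]
    exact hessId_of_eventuallyEq_const (Set.EqOn.eventuallyEq_of_mem h
      ((hΩ.1.sdiff isClosed_singleton).mem_nhds hx))
  have hA : sArea (frontier Ω) ≠ 0 := fun h => hk (by simp [h])
  have hk0 : 0 < d * sArea (frontier Ω) / (((n : ℝ) - 2) * sphereArea n) :=
    (div_nonneg (mul_nonneg hd.le ENNReal.toReal_nonneg)
      (mul_nonneg (by linarith) ENNReal.toReal_nonneg)).lt_of_ne' hk
  obtain ⟨V, P₀, hP⟩ := exists_harmonicPolar hn hc hΩ hsm hlap hfr hk0 hv huv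
  obtain ⟨J, hJ0, hJ⟩ := hP.exists_flux
  obtain ⟨m, hm⟩ : ∃ m, n = m + 1 := ⟨n - 1, by lia⟩
  have hcast : (n : ℝ) - 1 = m := by rw [hm]; push_cast; ring
  obtain ⟨s, hs, hμ, hs'⟩ := exists_setIntegral_euclideanHausdorffMeasure (n := n) m
  have hs0 : (0 : ℝ) < s := by exact_mod_cast hs.bot_lt
  have hfin : (μHE[m] : Measure (EuclideanSpace ℝ (Fin n))) (frontier Ω) ≠ ⊤ := by
    rw [sArea, hcast, ENNReal.toReal_ne_zero] at hA
    rw [hμ, Measure.smul_apply]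
    exact ENNReal.mul_ne_top ENNReal.coe_ne_top hA.2
  have hmeas : (μH[(n : ℝ) - 1] : Measure (EuclideanSpace ℝ (Fin n))) = μH[(m : ℝ)] := by rw [hcast]
  rw [hmeas] at hint hlim
  have hT := (hP.tendsto_setIntegral_level hm hJ0 hJ).div_const (s : ℝ)
  simp only [hs', mul_div_cancel_left₀ _ hs0.ne'] at hT
  have hint' := hP.integral_le_integral_qflux_div hfin (by
    rw [hs']
    exact mul_nonneg hs0.le hint)
  rw [hs', hlim, hT.limsup_eq, mul_div_cancel₀ _ hs0.ne'] at hint'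
  exact hP.hessId_of_forall_defect hΩ.2.1.isPreconnected fun x hx =>
    hP.defect_eq_zero_of_gsq_pos hm hJ0 hJ hfin hint' hx
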